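/- arXiv:1807.04116 — 10 statements merged into one kernel-verified Lean document; each statement's English description precedes it below -/
import Mathlib

section
/- Let a and b be relatively prime positive integers such that D = a² + b² is not a perfect square. Suppose the negative Pell equation x² − D·y² = −1 has a solution in integers, and suppose D satisfies the one-family condition with respect to a and b. Then there are at most three pairs (X, Y) of positive integers with gcd(X, Y) = 1 satisfying X² − D·Y⁴ = −b². -/
/-- `D = a² + b²` satisfies the one-family condition with respect to `a` and `b`:
letting `(T₁, U₁)` be the pair of positive integers with `T₁² − D·U₁² = −4` and `U₁`
minimal, and `α = (T₁ + U₁·√D)/2 ∈ ℝ`, every pair of coprime integers `(x, y)` with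
`x² − D·y² = −b²` satisfies `x + y·√D = ε₁·(ε₂·a + √D)·α^(2k)` for some integer `k`
and signs `ε₁, ε₂ ∈ {1, −1}`. -/
def OneFamilyCondition (a b : ℤ) : Prop :=
  ∃ T U : ℤ, 0 < T ∧ 0 < U ∧ T ^ 2 - (a ^ 2 + b ^ 2) * U ^ 2 = -4 ∧
    (∀ T' U' : ℤ, 0 < T' → 0 < U' → T' ^ 2 - (a ^ 2 + b ^ 2) * U' ^ 2 = -4 → U ≤ U') ∧
    (∀ x y : ℤ, IsCoprime x y → x ^ 2 - (a ^ 2 + b ^ 2) * y ^ 2 = -b ^ 2 →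
      ∃ (k ε₁ ε₂ : ℤ), (ε₁ = 1 ∨ ε₁ = -1) ∧ (ε₂ = 1 ∨ ε₂ = -1) ∧
        (x : ℝ) + (y : ℝ) * Real.sqrt ((a : ℝ) ^ 2 + (b : ℝ) ^ 2) =
          (ε₁ : ℝ) * ((ε₂ : ℝ) * (a : ℝ) + Real.sqrt ((a : ℝ) ^ 2 + (b : ℝ) ^ 2)) *
            (((T : ℝ) + (U : ℝ) * Real.sqrt ((a : ℝ) ^ 2 + (b : ℝ) ^ 2)) / 2) ^ (2 * k))

/-- The generalized binomial coefficient `x (x - 1) ⋯ (x - j + 1) / j!`. -/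
noncomputable def realBinom (x : ℝ) (j : ℕ) : ℝ := ∏ i ∈ Finset.range j, (x - i) / (i + 1)

lemma realBinom_succ (x : ℝ) (j : ℕ) :
    realBinom x (j + 1) * (j + 1) = realBinom x j * (x - j) := by
  have : (j : ℝ) + 1 ≠ 0 := by positivity
  rw [realBinom, Finset.prod_range_succ, ← realBinom]
  field_simp

lemma mul_realBinom_sub_one (x : ℝ) (j : ℕ) :
    x * realBinom (x - 1) j = realBinom x j * (x - j) := by
  induction j with
  | zero => simp [realBinom]
  | succ j ih =>
    have h1 := realBinom_succ x j
    have h2 := realBinom_succ (x - 1) j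
    have h0 : (j : ℝ) + 1 ≠ 0 := by positivity
    apply mul_right_cancel₀ h0
    push_cast
    linear_combination x * h2 + (x - 1 - j) * ih - (x - (j + 1)) * h1

lemma mul_realBinom_sub_one' (x : ℝ) (j : ℕ) :
    x * realBinom (x - 1) j = realBinom x (j + 1) * (j + 1) := by
  rw [realBinom_succ, mul_realBinom_sub_one]

lemma realBinom_nonneg {x : ℝ} {j : ℕ} (h : (j : ℝ) - 1 ≤ x) : 0 ≤ realBinom x j := by
  refine Finset.prod_nonneg fun i hi => ?_
  have : ((i + 1 : ℕ) : ℝ) ≤ j := by exact_mod_cast Finset.mem_range.1 hi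
  push_cast at this
  have : 0 ≤ x - i := by linarith
  positivity

lemma realBinom_le {x y : ℝ} {j : ℕ} (h : (j : ℝ) - 1 ≤ x) (hxy : x ≤ y) :
    realBinom x j ≤ realBinom y j := by
  refine Finset.prod_le_prod (fun i hi => ?_) fun i hi => ?_
  · have : ((i + 1 : ℕ) : ℝ) ≤ j := by exact_mod_cast Finset.mem_range.1 hi
    push_cast at this
    have : 0 ≤ x - i := by linarith
    positivity
  · gcongr

lemma realBinom_natCast (n j : ℕ) : realBinom n j = n.choose j := by
  induction j with
  | zero => simp [realBinom]
  | succ j ih =>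
    have h0 : (j : ℝ) + 1 ≠ 0 := by positivity
    apply mul_right_cancel₀ h0
    rw [realBinom_succ, ih]
    rcases le_or_gt j n with h | h
    · have := Nat.choose_succ_right_eq n j
      rw [← Nat.cast_sub h]
      exact_mod_cast this.symm
    · simp [Nat.choose_eq_zero_of_lt h, Nat.choose_eq_zero_of_lt (Nat.lt_succ_of_lt h)]

/-- The coefficients of the diagonal Padé approximants of the fourth root. -/
noncomputable def padeCoeff (r k : ℕ) : ℝ :=
  realBinom (r - 1 / 4) (r - k) * realBinom (r + 1 / 4) k

lemma padeCoeff_nonneg {r k : ℕ} (h : k ≤ r) : 0 ≤ padeCoeff r k := by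
  have hk : (k : ℝ) ≤ r := by exact_mod_cast h
  refine mul_nonneg (realBinom_nonneg ?_) (realBinom_nonneg (by linarith))
  rw [Nat.cast_sub h]
  have : (0 : ℝ) ≤ k := by positivity
  linarith

lemma padeCoeff_le {r k : ℕ} (h : k ≤ r) : padeCoeff r k ≤ r.choose k * 2 ^ r := by
  have hk : (k : ℝ) ≤ r := by exact_mod_cast h
  have hk0 : (0 : ℝ) ≤ k := by positivity
  have h1 : realBinom (r - 1 / 4) (r - k) ≤ r.choose k := by
    rw [← Nat.choose_symm h, ← realBinom_natCast]
    refine realBinom_le ?_ (by linarith)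
    rw [Nat.cast_sub h]
    linarith
  have h2 : realBinom (r + 1 / 4) k ≤ 2 ^ r := by
    have : realBinom (r + 1 / 4) k ≤ realBinom ((r + 1 : ℕ) : ℝ) k :=
      realBinom_le (by linarith) (by push_cast; linarith)
    refine this.trans ?_
    rw [realBinom_natCast]
    have : (r + 1).choose k ≤ 2 ^ r := by
      cases k with
      | zero => simpa using Nat.one_le_two_pow
      | succ k =>
        rw [Nat.choose_succ_succ, ← Nat.sum_range_choose,
          ← Finset.sum_pair (f := r.choose) (Nat.lt_succ_self k).ne]
        exact Finset.sum_le_sum_of_subset (by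
          intro i hi
          simp only [Finset.mem_insert, Finset.mem_singleton] at hi
          simp only [Finset.mem_range]
          omega)
    exact_mod_cast this
  exact mul_le_mul h1 h2 (realBinom_nonneg (by linarith)) (by positivity)

lemma sum_padeCoeff_le (r : ℕ) : ∑ k ∈ Finset.range (r + 1), padeCoeff r k ≤ 4 ^ r := by
  calc ∑ k ∈ Finset.range (r + 1), padeCoeff r k
      ≤ ∑ k ∈ Finset.range (r + 1), (r.choose k : ℝ) * 2 ^ r :=
        Finset.sum_le_sum fun k hk => padeCoeff_le (Nat.lt_succ_iff.1 (Finset.mem_range.1 hk))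
    _ = 4 ^ r := by
        rw [← Finset.sum_mul]
        have : ∑ k ∈ Finset.range (r + 1), (r.choose k : ℝ) = 2 ^ r := by
          exact_mod_cast Nat.sum_range_choose r
        rw [this, ← mul_pow]
        norm_num

lemma padeCoeff_mul_left {r k : ℕ} (h : k ≤ r) :
    (((r : ℝ) + 1) ^ 2 - 1 / 16) * padeCoeff r k =
      padeCoeff (r + 1) k * ((r + 1 - k) * (r + 1 - k + 1 / 4)) := by
  have h1 := mul_realBinom_sub_one' ((r : ℝ) + 1 - 1 / 4) (r - k)
  have h2 := mul_realBinom_sub_one ((r : ℝ) + 1 + 1 / 4) k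
  rw [show (r : ℝ) + 1 - 1 / 4 - 1 = r - 1 / 4 by ring, Nat.cast_sub h] at h1
  rw [show (r : ℝ) + 1 + 1 / 4 - 1 = r + 1 / 4 by ring] at h2
  rw [padeCoeff, padeCoeff, Nat.succ_sub h]
  push_cast
  linear_combination ((r : ℝ) + 1 + 1 / 4) * realBinom (r + 1 / 4) k * h1 +
    realBinom (r + 1 - 1 / 4) (r - k + 1) * (r - k + 1) * h2

lemma padeCoeff_mul_right {r k : ℕ} (h : k ≤ r) :
    (((r : ℝ) + 1) ^ 2 - 1 / 16) * padeCoeff r k =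
      padeCoeff (r + 1) (k + 1) * ((k + 1) * (k + 1 - 1 / 4)) := by
  have h1 := mul_realBinom_sub_one ((r : ℝ) + 1 - 1 / 4) (r - k)
  have h2 := mul_realBinom_sub_one' ((r : ℝ) + 1 + 1 / 4) k
  rw [show (r : ℝ) + 1 - 1 / 4 - 1 = r - 1 / 4 by ring, Nat.cast_sub h] at h1
  rw [show (r : ℝ) + 1 + 1 / 4 - 1 = r + 1 / 4 by ring] at h2
  rw [padeCoeff, padeCoeff, Nat.add_sub_add_right]
  push_cast
  linear_combination ((r : ℝ) + 1 + 1 / 4) * realBinom (r + 1 / 4) k * h1 +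
    realBinom (r + 1 - 1 / 4) (r - k) * (k + 1 - 1 / 4) * h2

/-- The remainder of the diagonal Padé approximation on the unit circle. -/
noncomputable def padeRem (r : ℕ) (θ : ℝ) : ℝ :=
  ∑ k ∈ Finset.range (r + 1), padeCoeff r k * Real.sin ((r - 2 * k + 1 / 4) * θ)

lemma hasDerivAt_padeRem_succ (r : ℕ) (θ : ℝ) :
    HasDerivAt (padeRem (r + 1))
      (-(2 * (((r : ℝ) + 1) ^ 2 - 1 / 16) / (r + 1)) * (Real.sin θ * padeRem r θ)) θ := by
  have h0 : (r : ℝ) + 1 ≠ 0 := by positivity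
  have key : ∀ k : ℕ, HasDerivAt
      (fun θ => padeCoeff (r + 1) k * Real.sin (((r + 1 : ℕ) - 2 * k + 1 / 4) * θ))
      (padeCoeff (r + 1) k * (Real.cos (((r + 1 : ℕ) - 2 * k + 1 / 4) * θ) *
        ((r + 1 : ℕ) - 2 * k + 1 / 4))) θ := fun k => by
    have := ((hasDerivAt_id θ).const_mul (((r + 1 : ℕ) : ℝ) - 2 * k + 1 / 4)).sin
    simpa using this.const_mul (padeCoeff (r + 1) k)
  have hd := HasDerivAt.fun_sum (u := Finset.range (r + 1 + 1)) fun k _ => key k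
  refine hd.congr_deriv ?_
  apply mul_left_cancel₀ h0
  set c : ℝ := ((r : ℝ) + 1) ^ 2 - 1 / 16 with hc
  let C : ℝ → ℝ := fun k => Real.cos (((r : ℝ) + 1 - 2 * k + 1 / 4) * θ)
  have e1 : ∑ k ∈ Finset.range (r + 1), c * padeCoeff r k * C k =
      ∑ k ∈ Finset.range (r + 1 + 1),
        padeCoeff (r + 1) k * ((r + 1 - k) * (r + 1 - k + 1 / 4)) * C k := by
    rw [Finset.sum_range_succ _ (r + 1)]
    push_cast
    rw [sub_self, zero_mul, mul_zero, zero_mul, add_zero]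
    refine Finset.sum_congr rfl fun k hk => ?_
    rw [padeCoeff_mul_left (Nat.lt_succ_iff.1 (Finset.mem_range.1 hk))]
  have e2 : ∑ k ∈ Finset.range (r + 1), c * padeCoeff r k * C (k + 1) =
      ∑ k ∈ Finset.range (r + 1 + 1),
        padeCoeff (r + 1) k * (k * (k - 1 / 4)) * C k := by
    rw [Finset.sum_range_succ' _ (r + 1)]
    push_cast
    rw [zero_mul, mul_zero, zero_mul, add_zero]
    refine Finset.sum_congr rfl fun k hk => ?_
    rw [padeCoeff_mul_right (Nat.lt_succ_iff.1 (Finset.mem_range.1 hk))]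
  have e3 : ((r : ℝ) + 1) * (-(2 * c / (r + 1)) * (Real.sin θ * padeRem r θ)) =
      ∑ k ∈ Finset.range (r + 1), c * padeCoeff r k * C k -
      ∑ k ∈ Finset.range (r + 1), c * padeCoeff r k * C (k + 1) := by
    rw [← Finset.sum_sub_distrib, padeRem]
    field_simp
    rw [mul_assoc, Finset.mul_sum, Finset.mul_sum, ← Finset.sum_neg_distrib]
    refine Finset.sum_congr rfl fun k _ => ?_
    have h1 : C k = Real.cos (((r : ℝ) - 2 * k + 1 / 4) * θ + θ) := by
      simp only [C]; congr 1; ring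
    have h2 : C (k + 1) = Real.cos (((r : ℝ) - 2 * k + 1 / 4) * θ - θ) := by
      simp only [C]; congr 1; ring
    rw [h1, h2, Real.cos_add, Real.cos_sub]
    have h3 : ((r - 2 * k) * 4 + 1) * θ / 4 = ((r : ℝ) - 2 * k + 1 / 4) * θ := by ring
    rw [h3]
    ring
  rw [e3, e1, e2, ← Finset.sum_sub_distrib, Finset.mul_sum]
  refine Finset.sum_congr rfl fun k _ => ?_
  simp only [C]
  push_cast
  ring

lemma padeRem_zero_right (r : ℕ) : padeRem r 0 = 0 := by simp [padeRem]

lemma padeRem_zero_left (θ : ℝ) : padeRem 0 θ = Real.sin (θ / 4) := by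
  simp [padeRem, padeCoeff, realBinom]
  congr 1
  ring

/-- A function vanishing at `0` with nonnegative derivative on `[0, π / 2)` is nonnegative there. -/
lemma nonneg_of_hasDerivAt_nonneg {f f' : ℝ → ℝ} (h0 : f 0 = 0) {θ : ℝ} (hθ0 : 0 ≤ θ)
    (hf : ∀ x ∈ Set.Icc 0 θ, HasDerivAt f (f' x) x) (hf' : ∀ x ∈ Set.Icc 0 θ, 0 ≤ f' x) :
    0 ≤ f θ := by
  have : MonotoneOn f (Set.Icc 0 θ) := by
    refine monotoneOn_of_deriv_nonneg (convex_Icc 0 θ)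
      (fun x hx => (hf x hx).continuousAt.continuousWithinAt)
      (fun x hx => ((hf x (interior_subset hx)).differentiableAt).differentiableWithinAt)
      fun x hx => ?_
    rw [(hf x (interior_subset hx)).deriv]
    exact hf' x (interior_subset hx)
  simpa [h0] using this (Set.left_mem_Icc.2 hθ0) (Set.right_mem_Icc.2 hθ0) hθ0

lemma le_padeRem (r : ℕ) {θ : ℝ} (h0 : 0 ≤ θ) (h1 : θ < Real.pi / 2) :
    1 / 4 * (1 / 2) ^ r * Real.sin θ ^ (2 * r + 1) ≤ (-1) ^ r * padeRem r θ := by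
  induction r generalizing θ with
  | zero =>
    rw [padeRem_zero_left]
    have e1 : Real.sin θ = 2 * Real.sin (θ / 2) * Real.cos (θ / 2) := by
      rw [← Real.sin_two_mul]; congr 1; ring
    have e2 : Real.sin (θ / 2) = 2 * Real.sin (θ / 4) * Real.cos (θ / 4) := by
      rw [← Real.sin_two_mul]; congr 1; ring
    have p1 : 0 ≤ Real.sin (θ / 2) :=
      Real.sin_nonneg_of_nonneg_of_le_pi (by linarith) (by linarith [Real.pi_pos])
    have p2 : 0 ≤ Real.sin (θ / 4) :=
      Real.sin_nonneg_of_nonneg_of_le_pi (by linarith) (by linarith [Real.pi_pos])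
    have := mul_le_mul_of_nonneg_left (Real.cos_le_one (θ / 2)) p1
    have := mul_le_mul_of_nonneg_left (Real.cos_le_one (θ / 4)) p2
    simp
    nlinarith
  | succ r ih =>
    set c : ℝ := 2 * (((r : ℝ) + 1) ^ 2 - 1 / 16) / (r + 1) with hc
    have hr : (0 : ℝ) ≤ r := by positivity
    have hcl : (2 * (r : ℝ) + 3) * (1 / 2) ≤ c := by
      rw [hc, le_div_iff₀ (by positivity)]
      nlinarith
    have := nonneg_of_hasDerivAt_nonneg (θ := θ)
      (f := fun θ => (-1) ^ (r + 1) * padeRem (r + 1) θ -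
        1 / 4 * (1 / 2) ^ (r + 1) * Real.sin θ ^ (2 * r + 3))
      (f' := fun θ => (-1) ^ (r + 1) * (-c * (Real.sin θ * padeRem r θ)) -
        1 / 4 * (1 / 2) ^ (r + 1) *
          (((2 * r + 3 : ℕ) : ℝ) * Real.sin θ ^ (2 * r + 3 - 1) * Real.cos θ))
      (by simp [padeRem_zero_right]) h0
      (fun x _ => ((hasDerivAt_padeRem_succ r x).const_mul _).sub
        (((Real.hasDerivAt_sin x).pow (2 * r + 3)).const_mul _)) ?_
    · have e : 2 * (r + 1) + 1 = 2 * r + 3 := by ring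
      rw [e]
      linarith
    · intro x hx
      have hs : 0 ≤ Real.sin x :=
        Real.sin_nonneg_of_nonneg_of_le_pi hx.1 (by linarith [Real.pi_pos, hx.2])
      have hi := ih hx.1 (hx.2.trans_lt h1)
      have hcos := Real.cos_le_one x
      have e : 2 * r + 3 - 1 = (2 * r + 1) + 1 := by omega
      simp only [e]
      set S := Real.sin x ^ (2 * r + 1) with hS
      have hS0 : 0 ≤ S := by positivity
      rw [pow_succ (Real.sin x)]
      have hp : (0 : ℝ) < (1 / 2) ^ r := by positivity
      have a1 : (1 / 4 * (1 / 2) ^ r * S) * Real.sin x * ((2 * (r : ℝ) + 3) * (1 / 2)) ≤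
          ((-1) ^ r * padeRem r x) * Real.sin x * c :=
        mul_le_mul (mul_le_mul_of_nonneg_right hi hs) hcl (by positivity)
          (mul_nonneg (le_trans (by positivity) hi) hs)
      have a2 : (1 / 4 * (1 / 2) ^ r * S) * Real.sin x * ((2 * (r : ℝ) + 3) * (1 / 2)) *
          Real.cos x ≤ (1 / 4 * (1 / 2) ^ r * S) * Real.sin x * ((2 * (r : ℝ) + 3) * (1 / 2)) :=
        mul_le_of_le_one_right (by positivity) hcos
      push_cast
      rw [← hS]
      have b1 : (-1 : ℝ) ^ (r + 1) * (-c * (Real.sin x * padeRem r x)) =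
        ((-1) ^ r * padeRem r x) * Real.sin x * c := by ring
      have b2 : 1 / 4 * (1 / 2 : ℝ) ^ (r + 1) * ((2 * (r : ℝ) + 3) * (S * Real.sin x) *
          Real.cos x) = (1 / 4 * (1 / 2) ^ r * S) * Real.sin x *
            ((2 * (r : ℝ) + 3) * (1 / 2)) * Real.cos x := by ring
      rw [b1, b2]
      linarith

lemma padeRem_le (r : ℕ) {θ : ℝ} (h0 : 0 ≤ θ) (h1 : θ < Real.pi / 2) :
    (-1) ^ r * padeRem r θ ≤ Real.tan θ ^ (2 * r + 1) := by
  induction r generalizing θ with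
  | zero =>
    rw [padeRem_zero_left]
    have := Real.le_tan h0 h1
    have := Real.sin_le (x := θ / 4) (by linarith)
    simp
    linarith
  | succ r ih =>
    set c : ℝ := 2 * (((r : ℝ) + 1) ^ 2 - 1 / 16) / (r + 1) with hc
    have hr : (0 : ℝ) ≤ r := by positivity
    have hcl : c ≤ 2 * (r : ℝ) + 3 := by
      rw [hc, div_le_iff₀ (by positivity)]
      nlinarith
    have hc0 : 0 ≤ c := by
      rw [hc]
      have : 0 ≤ ((r : ℝ) + 1) ^ 2 - 1 / 16 := by nlinarith
      positivity
    have hcos : ∀ x ∈ Set.Icc 0 θ, 0 < Real.cos x := fun x hx =>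
      Real.cos_pos_of_mem_Ioo ⟨by linarith [hx.1, Real.pi_pos], by linarith [hx.2]⟩
    have := nonneg_of_hasDerivAt_nonneg (θ := θ)
      (f := fun θ => Real.tan θ ^ (2 * r + 3) - (-1) ^ (r + 1) * padeRem (r + 1) θ)
      (f' := fun θ => ((2 * r + 3 : ℕ) : ℝ) * Real.tan θ ^ (2 * r + 3 - 1) *
          (1 / Real.cos θ ^ 2) - (-1) ^ (r + 1) * (-c * (Real.sin θ * padeRem r θ)))
      (by simp [padeRem_zero_right]) h0
      (fun x hx => ((Real.hasDerivAt_tan (hcos x hx).ne').pow (2 * r + 3)).sub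
        ((hasDerivAt_padeRem_succ r x).const_mul _)) ?_
    · have e : 2 * (r + 1) + 1 = 2 * r + 3 := by ring
      rw [e]
      linarith
    · intro x hx
      have hx1 := hx.2.trans_lt h1
      have hcx := hcos x hx
      have hs : 0 ≤ Real.sin x :=
        Real.sin_nonneg_of_nonneg_of_le_pi hx.1 (by linarith [Real.pi_pos, hx.2])
      have hi := ih hx.1 hx1
      have hst : Real.sin x ≤ Real.tan x := (Real.sin_le hx.1).trans (Real.le_tan hx.1 hx1)
      have hp : 0 ≤ (-1) ^ r * padeRem r x :=
        le_trans (by positivity) (le_padeRem r hx.1 hx1)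
      have e : 2 * r + 3 - 1 = (2 * r + 1) + 1 := by omega
      simp only [e]
      set t := Real.tan x with ht
      have ht0 : 0 ≤ t := hs.trans hst
      have b1 : (-1 : ℝ) ^ (r + 1) * (-c * (Real.sin x * padeRem r x)) =
        c * (((-1) ^ r * padeRem r x) * Real.sin x) := by ring
      have a1 : c * (((-1) ^ r * padeRem r x) * Real.sin x) ≤
          (2 * (r : ℝ) + 3) * (t ^ (2 * r + 1) * t) :=
        mul_le_mul hcl (mul_le_mul hi hst hs (by positivity)) (by positivity) (by positivity)
      have a2 : 1 ≤ 1 / Real.cos x ^ 2 := by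
        rw [le_div_iff₀ (by positivity)]
        nlinarith [Real.cos_le_one x]
      have a3 := le_mul_of_one_le_right
        (show 0 ≤ (2 * (r : ℝ) + 3) * (t ^ (2 * r + 1) * t) by positivity) a2
      rw [b1, pow_succ t]
      push_cast
      linarith

lemma factorial_dvd_two_pow_mul_prod (s : ℤ) (j : ℕ) :
    (j.factorial : ℤ) ∣ 2 ^ j * ∏ i ∈ Finset.range j, (s - 4 * i) := by
  obtain ⟨e, o, ho, hj⟩ := Nat.exists_eq_two_pow_mul_odd j.factorial_ne_zero
  have he : e ≤ j := by
    rcases Nat.eq_zero_or_pos j with rfl | hj0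
    · have : 2 ^ e ∣ 1 := ⟨o, by simpa using hj⟩
      have := Nat.dvd_one.1 this
      rcases Nat.pow_eq_one.1 this with h | h <;> omega
    · have h1 := Nat.emultiplicity_two_factorial_lt hj0.ne'
      have h2 := le_emultiplicity_of_pow_dvd (show 2 ^ e ∣ j.factorial from ⟨o, hj⟩)
      exact_mod_cast (h2.trans_lt h1).le
  rw [hj]
  push_cast
  refine mul_dvd_mul (pow_dvd_pow 2 he) ?_
  have hcop : IsCoprime (4 : ℤ) o := by
    have : Nat.Coprime (2 ^ 2) o := Nat.Coprime.pow_left 2 (Nat.coprime_two_left.2 ho)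
    exact_mod_cast Nat.isCoprime_iff_coprime.2 this
  obtain ⟨u, v, huv⟩ := hcop
  have hcong : ∏ i ∈ Finset.range j, (s - 4 * i) ≡
      ∏ i ∈ Finset.range j, (-4 * (-(s * u) + i)) [ZMOD o] := by
    refine Int.ModEq.prod fun i _ => ?_
    refine (Int.modEq_iff_dvd.2 ⟨-s * v, ?_⟩)
    linear_combination s * huv
  refine hcong.dvd_iff.2 ?_
  rw [Finset.prod_mul_distrib]
  refine Dvd.dvd.mul_left (dvd_trans ?_ (Nat.factorial_coe_dvd_prod j (-(s * u)))) _
  exact ⟨2 ^ e, by rw [hj]; push_cast; ring⟩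

lemma exists_int_eq_pow_mul_realBinom (s : ℤ) (j : ℕ) :
    ∃ m : ℤ, (m : ℝ) = 8 ^ j * realBinom (s / 4) j := by
  obtain ⟨m, hm⟩ := factorial_dvd_two_pow_mul_prod s j
  refine ⟨m, ?_⟩
  have h0 : (j.factorial : ℝ) ≠ 0 := by exact_mod_cast j.factorial_ne_zero
  apply mul_left_cancel₀ h0
  have : ((2 ^ j * ∏ i ∈ Finset.range j, (s - 4 * i) : ℤ) : ℝ) = j.factorial * m := by
    rw [hm]; push_cast; ring
  rw [← this]
  have hf : (j.factorial : ℝ) = ∏ i ∈ Finset.range j, ((i : ℝ) + 1) := by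
    rw [← Finset.prod_range_add_one_eq_factorial]
    push_cast
    rfl
  have h8 : (8 : ℝ) ^ j = 2 ^ j * ∏ i ∈ Finset.range j, 4 := by
    rw [Finset.prod_const, Finset.card_range, ← mul_pow]; norm_num
  rw [hf, h8, realBinom]
  push_cast
  rw [mul_left_comm, mul_assoc (2 ^ j : ℝ), ← Finset.prod_mul_distrib, ← Finset.prod_mul_distrib]
  congr 1
  refine Finset.prod_congr rfl fun i _ => ?_
  have : (i : ℝ) + 1 ≠ 0 := by positivity
  field_simp

lemma exists_int_eq_pow_mul_padeCoeff {r k : ℕ} (h : k ≤ r) :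
    ∃ m : ℤ, (m : ℝ) = 8 ^ r * padeCoeff r k := by
  obtain ⟨m₁, h₁⟩ := exists_int_eq_pow_mul_realBinom (4 * r - 1) (r - k)
  obtain ⟨m₂, h₂⟩ := exists_int_eq_pow_mul_realBinom (4 * r + 1) k
  refine ⟨m₁ * m₂, ?_⟩
  have e1 : ((4 * r - 1 : ℤ) : ℝ) / 4 = r - 1 / 4 := by push_cast; ring
  have e2 : ((4 * r + 1 : ℤ) : ℝ) / 4 = r + 1 / 4 := by push_cast; ring
  rw [e1] at h₁
  rw [e2] at h₂
  rw [Int.cast_mul, h₁, h₂, padeCoeff]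
  conv_rhs => rw [← Nat.sub_add_cancel h, pow_add]
  rw [Nat.sub_add_cancel h]
  ring

open Complex in
/-- The linear form obtained from the `r`-th Padé approximant takes integer values. -/
lemma exists_int_eq_pade_form (M K X B : ℤ) (N θ ρ φ : ℝ) (hX : (X : ℝ) = N * Real.cos θ)
    (hB : (B : ℝ) = N * Real.sin θ) (hM : (M : ℝ) = ρ * Real.cos (φ - θ / 4))
    (hK : (K : ℝ) = ρ * Real.sin (φ - θ / 4)) (r : ℕ) :
    ∃ L : ℤ, (L : ℝ) = ρ * (8 * N) ^ r *
      (Real.sin φ * (∑ k ∈ Finset.range (r + 1),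
        padeCoeff r k * Real.cos ((r - 2 * k + 1 / 4) * θ)) -
        Real.cos φ * padeRem r θ) := by
  have hm : ∀ k, ∃ m : ℤ, k ≤ r → (m : ℝ) = 8 ^ r * padeCoeff r k := fun k => by
    by_cases h : k ≤ r
    · obtain ⟨m, hm⟩ := exists_int_eq_pow_mul_padeCoeff h
      exact ⟨m, fun _ => hm⟩
    · exact ⟨0, fun h' => absurd h' h⟩
  choose m hm using hm
  let g : GaussianInt := ∑ k ∈ Finset.range (r + 1),
    (m k : GaussianInt) * (⟨M, K⟩ * ⟨X, -B⟩ ^ (r - k) * ⟨X, B⟩ ^ k)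
  have hMK : ((M : ℂ) + K * I) = ρ * exp ((φ - θ / 4 : ℝ) * I) := by
    rw [exp_mul_I, ← ofReal_cos, ← ofReal_sin]
    have h1 : (M : ℂ) = ((M : ℝ) : ℂ) := by simp
    have h2 : (K : ℂ) = ((K : ℝ) : ℂ) := by simp
    rw [h1, h2, hM, hK]
    push_cast
    ring
  have hXB : ((X : ℂ) + B * I) = N * exp (θ * I) := by
    rw [exp_mul_I, ← ofReal_cos, ← ofReal_sin]
    have h1 : (X : ℂ) = ((X : ℝ) : ℂ) := by simp
    have h2 : (B : ℂ) = ((B : ℝ) : ℂ) := by simp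
    rw [h1, h2, hX, hB]
    push_cast
    ring
  have hXB' : ((X : ℂ) + (-B : ℤ) * I) = N * exp (-θ * I) := by
    rw [exp_mul_I, cos_neg, sin_neg, ← ofReal_cos, ← ofReal_sin]
    have h1 : (X : ℂ) = ((X : ℝ) : ℂ) := by simp
    have h2 : (B : ℂ) = ((B : ℝ) : ℂ) := by simp
    rw [Int.cast_neg, h1, h2, hX, hB]
    push_cast
    ring
  refine ⟨g.im, ?_⟩
  rw [GaussianInt.intCast_im]
  have hg : GaussianInt.toComplex g = ∑ k ∈ Finset.range (r + 1),
      ((ρ * (8 * N) ^ r * padeCoeff r k : ℝ) : ℂ) *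
        exp ((φ - (r - 2 * k + 1 / 4) * θ : ℝ) * I) := by
    simp only [g, map_sum, map_mul, map_pow, map_intCast, GaussianInt.toComplex_def']
    refine Finset.sum_congr rfl fun k hk => ?_
    have hk' := Nat.lt_succ_iff.1 (Finset.mem_range.1 hk)
    have h1 : (m k : ℂ) = ((8 ^ r * padeCoeff r k : ℝ) : ℂ) := by rw [← hm k hk']; simp
    rw [hMK, hXB, hXB', h1, mul_pow, mul_pow, ← exp_nat_mul, ← exp_nat_mul]
    have h2 : exp ((φ - (r - 2 * k + 1 / 4) * θ : ℝ) * I) = exp ((φ - θ / 4 : ℝ) * I) *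
        exp (((r - k : ℕ) : ℂ) * (-θ * I)) * exp ((k : ℂ) * (θ * I)) := by
      rw [← exp_add, ← exp_add, Nat.cast_sub hk']
      congr 1
      push_cast
      ring
    have h3 : (N : ℂ) ^ r = N ^ (r - k) * N ^ k := by rw [← pow_add, Nat.sub_add_cancel hk']
    rw [h2]
    push_cast
    rw [mul_pow, h3]
    ring
  rw [hg, im_sum]
  simp only [im_ofReal_mul, exp_ofReal_mul_I_im, Real.sin_sub]
  rw [padeRem, Finset.mul_sum, Finset.mul_sum, ← Finset.sum_sub_distrib, Finset.mul_sum]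
  refine Finset.sum_congr rfl fun k _ => ?_
  ring

lemma pade_form_tail_le {b N x X₃ ρ F : ℝ} {r : ℕ}
    (hb0 : 0 < b) (hN0 : 0 < N) (hx0 : 0 < x) (hρ0 : 0 < ρ) (hX₃0 : 0 < X₃) (hF0 : 0 < F)
    (hx1 : 0.999 * N ≤ x) (hr2 : 3 * F ^ r ≤ ρ * b / x)
    (hX₃ : 0.99 * (b ^ 2 * ρ ^ 4 / (4 * N)) ≤ X₃)
    (hq : 9000 ≤ N / b ^ 2) (hF3 : 32 * N ≤ F ^ 3) :
    ρ * (8 * N) ^ (r + 1) * (b / (4 * X₃) * 4 ^ (r + 1)) ≤ 1 / 4 := by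
  set V : ℝ := ρ * b / x with hVdef
  have hV0 : 0 < V := by positivity
  have e1 : ρ * (8 * N) ^ (r + 1) * (b / (4 * X₃) * 4 ^ (r + 1)) =
      ρ * b * (32 * N) ^ (r + 1) / (4 * X₃) := by
    rw [show 32 * N = 8 * N * 4 by ring, mul_pow (8 * N) 4]; ring
  rw [e1, div_le_iff₀ (by positivity)]
  have h1 : (32 * N) ^ r ≤ (F ^ 3) ^ r := pow_le_pow_left₀ (by positivity) hF3 r
  have h2 : 27 * (F ^ 3) ^ r ≤ V ^ 3 := by
    refine le_trans (le_of_eq ?_) (pow_le_pow_left₀ (by positivity) hr2 3)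
    rw [mul_pow, ← pow_mul, ← pow_mul, mul_comm 3 r]; norm_num
  have h3 : 0.99 * N ^ 3 ≤ x ^ 3 := by
    refine le_trans ?_ (pow_le_pow_left₀ (by positivity) hx1 3)
    rw [mul_pow]
    exact mul_le_mul_of_nonneg_right (by norm_num) (by positivity)
  have h4 : 0.99 * (b ^ 2 * ρ ^ 4 / (4 * N)) =
      ρ * b * (0.2475 / N) * (V ^ 3 * (x ^ 3 / b ^ 2)) := by
    rw [hVdef]
    field_simp
    norm_num
  rw [h4] at hX₃
  have h5 : (32 * N) ^ (r + 1) ≤ 0.2475 / N * (V ^ 3 * (x ^ 3 / b ^ 2)) := by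
    have h6 : 27 * (32 * N) ^ r * (0.99 * N ^ 3 / b ^ 2) ≤ V ^ 3 * (x ^ 3 / b ^ 2) :=
      mul_le_mul (by linarith) (div_le_div_of_nonneg_right h3 (by positivity))
        (by positivity) (by positivity)
    have h7 := mul_le_mul_of_nonneg_left h6 (show 0 ≤ 0.2475 / N by positivity)
    refine le_trans ?_ h7
    have e2 : 0.2475 / N * (27 * (32 * N) ^ r * (0.99 * N ^ 3 / b ^ 2)) =
      (32 * N) ^ r * (0.2475 * 27 * 0.99 * N * (N / b ^ 2)) := by field_simp
    rw [e2, pow_succ]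
    refine mul_le_mul_of_nonneg_left ?_ (by positivity)
    nlinarith
  have h8 := mul_le_mul_of_nonneg_left h5 (show 0 ≤ ρ * b by positivity)
  linarith


lemma tail_lt_pade_remainder {b N x X₃ ρ F : ℝ} {r : ℕ}
    (hb0 : 0 < b) (hN0 : 0 < N) (hx0 : 0 < x) (hρ0 : 0 < ρ) (hX₃0 : 0 < X₃) (hF0 : 0 < F)
    (hx1 : 0.999 * N ≤ x) (hr2 : 3 * F ^ r ≤ ρ * b / x)
    (hX₃ : 0.99 * (b ^ 2 * ρ ^ 4 / (4 * N)) ≤ X₃)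
    (hF4 : 8 * N ^ 2 / b ^ 2 ≤ F ^ 4) :
    b / (4 * X₃) * 4 ^ (r + 1) <
      0.9 * (1 / 4 * (1 / 2) ^ (r + 1) * (b / N) ^ (2 * (r + 1) + 1)) := by
  set V : ℝ := ρ * b / x with hVdef
  have hV0 : 0 < V := by positivity
  have h1 : (8 * N ^ 2 / b ^ 2) ^ r ≤ (F ^ 4) ^ r := pow_le_pow_left₀ (by positivity) hF4 r
  have h2 : 81 * (F ^ 4) ^ r ≤ V ^ 4 := by
    refine le_trans (le_of_eq ?_) (pow_le_pow_left₀ (by positivity) hr2 4)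
    rw [mul_pow, ← pow_mul, ← pow_mul, mul_comm 4 r]; norm_num
  have h3 : 0.99 * N ^ 4 ≤ x ^ 4 := by
    refine le_trans ?_ (pow_le_pow_left₀ (by positivity) hx1 4)
    rw [mul_pow]
    exact mul_le_mul_of_nonneg_right (by norm_num) (by positivity)
  have h4 : 0.99 * (b ^ 2 * ρ ^ 4 / (4 * N)) = V ^ 4 * x ^ 4 * (0.2475 / (b ^ 2 * N)) := by
    rw [hVdef]
    field_simp
    norm_num
  rw [h4] at hX₃
  have h6 : 81 * (8 * N ^ 2 / b ^ 2) ^ r * (0.99 * N ^ 4) ≤ V ^ 4 * x ^ 4 :=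
    mul_le_mul (by linarith) h3 (by positivity) (by positivity)
  have h7 := mul_le_mul_of_nonneg_right h6 (show 0 ≤ 0.2475 / (b ^ 2 * N) by positivity)
  have h8 : (8 * N ^ 2 / b ^ 2) ^ (r + 1) * N < 0.9 * X₃ := by
    have e2 : 81 * (8 * N ^ 2 / b ^ 2) ^ r * (0.99 * N ^ 4) * (0.2475 / (b ^ 2 * N)) =
      (81 * 0.99 * 0.2475 / 8) * ((8 * N ^ 2 / b ^ 2) ^ r * (8 * N ^ 2 / b ^ 2) * N) := by
      field_simp
    rw [e2] at h7
    rw [pow_succ]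
    have : 0 < (8 * N ^ 2 / b ^ 2) ^ r * (8 * N ^ 2 / b ^ 2) * N := by positivity
    linarith
  have e3 : 0.9 * (1 / 4 * (1 / 2) ^ (r + 1) * (b / N) ^ (2 * (r + 1) + 1)) =
      0.9 * X₃ / ((8 * N ^ 2 / b ^ 2) ^ (r + 1) * N) * (b / (4 * X₃) * 4 ^ (r + 1)) := by
    rw [pow_succ (b / N), pow_mul, div_pow, div_pow, div_pow, div_pow, one_pow, mul_pow,
      show (8 : ℝ) = 4 * 2 by norm_num, mul_pow]
    field_simp
  rw [e3]
  refine lt_mul_of_one_lt_left (by positivity) ?_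
  rwa [one_lt_div (by positivity)]


/-- Effective irrationality: the Padé approximants attached to `X + B i` exclude integer points
`M + K i` whose argument is too close to `-θ / 4`. -/
lemma false_of_pade_approximation {M K X B : ℤ} {N X₃ ρ θ φ : ℝ} (hB1 : 1 ≤ B) (hX0 : 0 < X)
    (hN0 : 0 < N) (hρ0 : 0 < ρ)
    (hθ0 : 0 < θ) (hθ1 : θ < Real.pi / 2)
    (hX : (X : ℝ) = N * Real.cos θ) (hB : (B : ℝ) = N * Real.sin θ)
    (hM : (M : ℝ) = ρ * Real.cos (φ - θ / 4)) (hK : (K : ℝ) = ρ * Real.sin (φ - θ / 4))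
    (hV : 3 ≤ ρ * B / X) (hN : 9000 * (B : ℝ) ^ 3 ≤ N)
    (hX₃ : 0.99 * (B ^ 2 * ρ ^ 4 / (4 * N)) ≤ X₃) (hφ : |φ| ≤ B / (4 * X₃))
    (hφ1 : |φ| ≤ 1 / 4) : False := by
  have hB1' : (1 : ℝ) ≤ B := by exact_mod_cast hB1
  have hX0' : (0 : ℝ) < X := by exact_mod_cast hX0
  set b : ℝ := (B : ℝ) with hb
  set x : ℝ := (X : ℝ) with hx
  have hb0 : 0 < b := by linarith
  have hb2 : 1 ≤ b ^ 2 := by nlinarith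
  have hb3 : b ≤ b ^ 3 := by nlinarith [mul_nonneg hb0.le (sub_nonneg.2 hb2)]
  have hb23 : b ^ 2 ≤ b ^ 3 := by nlinarith
  have hNb : 9000 * b ≤ N := by linarith
  have hNb2 : 9000 * b ^ 2 ≤ N := by linarith
  have hxN : x ^ 2 = N ^ 2 - b ^ 2 := by
    rw [hX, hB]; linear_combination N ^ 2 * Real.sin_sq_add_cos_sq θ
  have hx2 : 0.9999 * N ^ 2 ≤ x ^ 2 := by nlinarith
  have hxlt : x ≤ N := by nlinarith
  have hx1 : 0.999 * N ≤ x := by nlinarith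
  have hcosθ : Real.cos θ = x / N := by rw [hX]; field_simp
  have hsinθ : Real.sin θ = b / N := by rw [hB]; field_simp
  have htan : Real.tan θ = b / x := by
    rw [Real.tan_eq_sin_div_cos, hcosθ, hsinθ]; field_simp
  set V : ℝ := ρ * b / x with hVdef
  have hρ : ρ = V * x / b := by rw [hVdef]; field_simp
  set E : ℝ := x ^ 2 / (8 * N * b ^ 2) with hE
  have hEl : 0.9999 * (N / (8 * b ^ 2)) ≤ E := by
    rw [hE, ← sub_nonneg]
    have : x ^ 2 / (8 * N * b ^ 2) - 0.9999 * (N / (8 * b ^ 2)) =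
      (x ^ 2 - 0.9999 * N ^ 2) / (8 * N * b ^ 2) := by field_simp
    rw [this]
    exact div_nonneg (by linarith) (by positivity)
  have hq : 9000 ≤ N / b ^ 2 := by rw [le_div_iff₀ (by positivity)]; linarith
  have hE1 : 1 < E := by
    have : N / (8 * b ^ 2) = N / b ^ 2 / 8 := by field_simp
    linarith
  obtain ⟨r, hr1, hr2⟩ : ∃ r : ℕ, V < 3 / 4 * E ^ (r + 1) ∧ 3 * (E / 4) ^ r ≤ V := by
    have hex : ∃ r : ℕ, V < 3 / 4 * E ^ (r + 1) := by
      obtain ⟨n, hn⟩ := pow_unbounded_of_one_lt (4 / 3 * V) hE1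
      refine ⟨n, ?_⟩
      have : E ^ n ≤ E ^ (n + 1) := pow_le_pow_right₀ hE1.le (Nat.le_succ n)
      linarith
    classical
    refine ⟨Nat.find hex, Nat.find_spec hex, ?_⟩
    rcases h : Nat.find hex with _ | r
    · simpa using hV
    · have h1 := Nat.find_min hex (m := r) (by omega)
      push Not at h1
      refine le_trans ?_ h1
      have h4 : (4 : ℝ) ≤ 4 ^ (r + 1) := by
        have : (1 : ℝ) ≤ 4 ^ r := one_le_pow₀ (by norm_num)
        rw [pow_succ]; linarith
      have h5 : 0 ≤ E ^ (r + 1) := by positivity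
      rw [div_pow]
      have : E ^ (r + 1) / 4 ^ (r + 1) ≤ E ^ (r + 1) / 4 :=
        div_le_div_of_nonneg_left h5 (by norm_num) h4
      linarith
  set F : ℝ := E / 4 with hF
  have hFl : 0.9999 * (N / (32 * b ^ 2)) ≤ F := by
    have : N / (32 * b ^ 2) = N / (8 * b ^ 2) / 4 := by field_simp; norm_num
    rw [hF]; linarith
  have hF0 : 0 < F := by positivity
  have hb6 : (9000 : ℝ) ^ 2 * b ^ 6 ≤ N ^ 2 := by
    have := pow_le_pow_left₀ (by positivity) hN 2
    linarith [this, show (9000 * b ^ 3) ^ 2 = (9000 : ℝ) ^ 2 * b ^ 6 by ring]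
  have hF3 : 32 * N ≤ F ^ 3 := by
    refine le_trans ?_ (pow_le_pow_left₀ (by positivity) hFl 3)
    have : (0.9999 * (N / (32 * b ^ 2))) ^ 3 = 0.9999 ^ 3 / 32 ^ 3 * N * (N ^ 2 / b ^ 6) := by
      field_simp
    rw [this]
    have : 9000 ^ 2 ≤ N ^ 2 / b ^ 6 := by rw [le_div_iff₀ (by positivity)]; linarith
    have := mul_le_mul_of_nonneg_left this (show 0 ≤ 0.9999 ^ 3 / 32 ^ 3 * N by positivity)
    linarith
  have hF4 : 8 * N ^ 2 / b ^ 2 ≤ F ^ 4 := by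
    refine le_trans ?_ (pow_le_pow_left₀ (by positivity) hFl 4)
    have h1 : (0.9999 * (N / (32 * b ^ 2))) ^ 4 =
        0.9999 ^ 4 / 32 ^ 4 * (N ^ 2 / b ^ 2) * (N ^ 2 / b ^ 6) := by
      field_simp
    have h2 : 8 * N ^ 2 / b ^ 2 = 8 * (N ^ 2 / b ^ 2) := by ring
    rw [h1, h2]
    have : 9000 ^ 2 ≤ N ^ 2 / b ^ 6 := by rw [le_div_iff₀ (by positivity)]; linarith
    have := mul_le_mul_of_nonneg_left this
      (show 0 ≤ 0.9999 ^ 4 / 32 ^ 4 * (N ^ 2 / b ^ 2) by positivity)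
    have h3 : 0 ≤ N ^ 2 / b ^ 2 := by positivity
    linarith
  have hV0 : 0 < V := by linarith
  have hX₃0 : 0 < X₃ := lt_of_lt_of_le (by positivity) hX₃
  have hsmall := pade_form_tail_le hb0 hN0 hX0' hρ0 hX₃0 hF0 hx1 hr2 hX₃ hq hF3
  have hnz := tail_lt_pade_remainder hb0 hN0 hX0' hρ0 hX₃0 hF0 hx1 hr2 hX₃ hF4
  obtain ⟨L, hL⟩ := exists_int_eq_pade_form M K X B N θ ρ φ hX hB hM hK (r + 1)
  set C := ∑ k ∈ Finset.range (r + 1 + 1),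
        padeCoeff (r + 1) k * Real.cos (((r + 1 : ℕ) - 2 * k + 1 / 4) * θ) with hC
  have hCle : |C| ≤ 4 ^ (r + 1) := by
    refine (Finset.abs_sum_le_sum_abs _ _).trans (le_trans (Finset.sum_le_sum fun k hk => ?_)
      (sum_padeCoeff_le (r + 1)))
    have h0 := padeCoeff_nonneg (Nat.lt_succ_iff.1 (Finset.mem_range.1 hk))
    rw [abs_mul, abs_of_nonneg h0]
    exact mul_le_of_le_one_right h0 (Real.abs_cos_le_one _)
  have hsinφ : |Real.sin φ| ≤ b / (4 * X₃) := Real.abs_sin_le_abs.trans hφ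
  have hprod : |Real.sin φ * C| ≤ b / (4 * X₃) * 4 ^ (r + 1) := by
    rw [abs_mul]
    exact mul_le_mul hsinφ hCle (abs_nonneg _) (by positivity)
  have hcosφ : 0.9 ≤ Real.cos φ := by
    have := Real.one_sub_sq_div_two_le_cos (x := φ)
    have h2 : φ ^ 2 ≤ (1 / 4) ^ 2 :=
      sq_le_sq' (by linarith [neg_abs_le φ]) (le_trans (le_abs_self φ) hφ1)
    linarith
  have hlow := le_padeRem (r + 1) hθ0.le hθ1
  have hupp := padeRem_le (r + 1) hθ0.le hθ1
  rw [hsinθ] at hlow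
  rw [htan] at hupp
  have habs : |padeRem (r + 1) θ| = (-1) ^ (r + 1) * padeRem (r + 1) θ := by
    have h1 : 0 ≤ (-1) ^ (r + 1) * padeRem (r + 1) θ := le_trans (by positivity) hlow
    rw [← abs_of_nonneg h1, abs_mul, abs_pow, abs_neg, abs_one, one_pow, one_mul]
  rw [← habs] at hlow hupp
  have hmain : ρ * (8 * N) ^ (r + 1) * (b / x) ^ (2 * (r + 1) + 1) < 3 / 4 := by
    have e : ρ * (8 * N) ^ (r + 1) * (b / x) ^ (2 * (r + 1) + 1) = V / E ^ (r + 1) := by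
      rw [hVdef, hE, pow_succ (b / x), pow_mul, div_pow, div_pow, div_pow]
      rw [show 8 * N * b ^ 2 = (8 * N) * b ^ 2 by ring, mul_pow (8 * N)]
      field_simp
    rw [e, div_lt_iff₀ (by positivity)]
    linarith
  have hP : 0 < ρ * (8 * N) ^ (r + 1) := by positivity
  have hcos2 : |Real.cos φ * padeRem (r + 1) θ| ≤ (b / x) ^ (2 * (r + 1) + 1) := by
    rw [abs_mul]
    exact (mul_le_of_le_one_left (abs_nonneg _) (Real.abs_cos_le_one _)).trans hupp
  have hL1 : |(L : ℝ)| < 1 := by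
    rw [hL, abs_mul, abs_of_pos hP]
    have h1 := abs_sub (Real.sin φ * C) (Real.cos φ * padeRem (r + 1) θ)
    have h2 := mul_le_mul_of_nonneg_left (h1.trans (add_le_add hprod hcos2)) hP.le
    rw [mul_add] at h2
    linarith
  have hL0 : L = 0 := by
    have : |L| < 1 := by exact_mod_cast hL1
    exact Int.abs_lt_one_iff.1 this
  rw [hL0, Int.cast_zero, eq_comm, mul_eq_zero, or_iff_right hP.ne', sub_eq_zero] at hL
  rw [hL, abs_mul, abs_of_pos (by linarith : 0 < Real.cos φ)] at hprod
  have := mul_le_mul hcosφ hlow (by positivity) (by linarith)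
  linarith

lemma exists_half_int_mul {D t u T U : ℤ} {s : ℝ} (hs : s ^ 2 = D)
    (h₁ : t ^ 2 - D * u ^ 2 = 4 ∨ t ^ 2 - D * u ^ 2 = -4)
    (h₂ : T ^ 2 - D * U ^ 2 = 4 ∨ T ^ 2 - D * U ^ 2 = -4) :
    ∃ t' u' : ℤ, (t + u * s) / 2 * ((T + U * s) / 2) = (t' + u' * s) / 2 ∧
      (t' ^ 2 - D * u' ^ 2 = 4 ∨ t' ^ 2 - D * u' ^ 2 = -4) := by
  have key : ∀ D t u T U : ZMod 2, t ^ 2 - D * u ^ 2 = 0 → T ^ 2 - D * U ^ 2 = 0 →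
      t * T + D * u * U = 0 ∧ t * U + u * T = 0 := by decide
  have c₁ : (t : ZMod 2) ^ 2 - D * u ^ 2 = 0 := by
    rcases h₁ with h | h <;> have := congrArg (Int.cast : ℤ → ZMod 2) h <;>
      push_cast at this <;> exact this.trans (by decide)
  have c₂ : (T : ZMod 2) ^ 2 - D * U ^ 2 = 0 := by
    rcases h₂ with h | h <;> have := congrArg (Int.cast : ℤ → ZMod 2) h <;>
      push_cast at this <;> exact this.trans (by decide)
  obtain ⟨e₁, e₂⟩ := key _ _ _ _ _ c₁ c₂
  obtain ⟨t', ht'⟩ := (ZMod.intCast_zmod_eq_zero_iff_dvd (t * T + D * u * U) 2).1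
    (by push_cast; exact e₁)
  obtain ⟨u', hu'⟩ := (ZMod.intCast_zmod_eq_zero_iff_dvd (t * U + u * T) 2).1
    (by push_cast; exact e₂)
  push_cast at ht' hu'
  refine ⟨t', u', ?_, ?_⟩
  · have r₁ : (t : ℝ) * T + D * u * U = 2 * t' := by exact_mod_cast ht'
    have r₂ : (t : ℝ) * U + u * T = 2 * u' := by exact_mod_cast hu'
    linear_combination (1 / 4) * r₁ + s / 4 * r₂ + (u : ℝ) * U / 4 * hs
  · have h : 4 * (t' ^ 2 - D * u' ^ 2) = (t ^ 2 - D * u ^ 2) * (T ^ 2 - D * U ^ 2) := by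
      linear_combination -(t * T + D * u * U + 2 * t') * ht' +
        D * (t * U + u * T + 2 * u') * hu'
    rcases h₁ with h₁ | h₁ <;> rcases h₂ with h₂ | h₂ <;> rw [h₁, h₂] at h <;> omega

lemma exists_half_int_zpow {D T U : ℤ} {s : ℝ} (hs : s ^ 2 = D)
    (hTU : T ^ 2 - D * U ^ 2 = -4) (k : ℤ) :
    ∃ t u : ℤ, (((T : ℝ) + U * s) / 2) ^ k = (t + u * s) / 2 ∧
      (t ^ 2 - D * u ^ 2 = 4 ∨ t ^ 2 - D * u ^ 2 = -4) := by
  have hinv : ((T : ℝ) + U * s) / 2 * (((-T : ℤ) + U * s) / 2) = 1 := by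
    have : (T : ℝ) ^ 2 - D * U ^ 2 = -4 := by exact_mod_cast hTU
    push_cast
    linear_combination (-1 / 4) * this + (U : ℝ) ^ 2 / 4 * hs
  have h0 : ((T : ℝ) + U * s) / 2 ≠ 0 := left_ne_zero_of_mul_eq_one hinv
  have hinv' := eq_inv_of_mul_eq_one_right hinv
  induction k using Int.induction_on with
  | zero => exact ⟨2, 0, by norm_num, by norm_num⟩
  | succ k ih =>
    obtain ⟨t, u, h, hn⟩ := ih
    rw [zpow_add_one₀ h0, h]
    exact exists_half_int_mul hs hn (Or.inr hTU)
  | pred k ih =>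
    obtain ⟨t, u, h, hn⟩ := ih
    rw [zpow_sub_one₀ h0, h, ← hinv']
    exact exists_half_int_mul hs hn (Or.inr (by linear_combination hTU))

lemma eq_and_eq_of_add_mul_irrational {s : ℝ} (hs : Irrational s) {p q p' q' : ℤ}
    (h : (p : ℝ) + q * s = p' + q' * s) : p = p' ∧ q = q' := by
  have hq : q = q' := by
    by_contra hne
    have hne' : ((q - q' : ℤ) : ℝ) ≠ 0 := by exact_mod_cast sub_ne_zero.2 hne
    refine hs ⟨((p' - p : ℤ) : ℚ) / ((q - q' : ℤ) : ℚ), ?_⟩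
    rw [Rat.cast_div, Rat.cast_intCast, Rat.cast_intCast, div_eq_iff hne']
    push_cast
    linear_combination -h
  subst hq
  refine ⟨?_, rfl⟩
  exact_mod_cast add_right_cancel h

lemma even_of_sq_add_sq {x y z : ℤ} (h : x ^ 2 + y ^ 2 = 4 * z) :
    ∃ p q, x = 2 * p ∧ y = 2 * q := by
  rcases Int.even_or_odd' x with ⟨p, rfl | rfl⟩ <;> rcases Int.even_or_odd' y with ⟨q, rfl | rfl⟩
  · exact ⟨p, q, rfl, rfl⟩
  all_goals ring_nf at h; omega

/-- The one-family condition writes each solution in terms of a unit of `ℤ[√D]`. -/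
lemma exists_unit_of_oneFamily {a b T U X Y k ε₁ ε₂ : ℤ} {s : ℝ}
    (hs : s ^ 2 = ((a ^ 2 + b ^ 2 : ℤ) : ℝ)) (hirr : Irrational s)
    (hTU : T ^ 2 - (a ^ 2 + b ^ 2) * U ^ 2 = -4)
    (hε₁ : ε₁ = 1 ∨ ε₁ = -1) (hε₂ : ε₂ = 1 ∨ ε₂ = -1) (hY : 0 < Y)
    (h : (X : ℝ) + (Y ^ 2 : ℤ) * s = ε₁ * (ε₂ * a + s) * ((T + U * s) / 2) ^ (2 * k)) :
    ∃ t u ε : ℤ, (ε = 1 ∨ ε = -1) ∧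
      (t ^ 2 - (a ^ 2 + b ^ 2) * u ^ 2 = 4 ∨ t ^ 2 - (a ^ 2 + b ^ 2) * u ^ 2 = -4) ∧
      4 * Y ^ 2 = (t + a * u) ^ 2 + (b * u) ^ 2 ∧
      4 * (ε * X) = a * (t ^ 2 + (a ^ 2 + b ^ 2) * u ^ 2) + 2 * (a ^ 2 + b ^ 2) * t * u := by
  obtain ⟨t, u, hk, hn⟩ := exists_half_int_zpow hs hTU k
  rw [mul_comm 2 k, zpow_mul, hk] at h
  have h' : ((4 * X : ℤ) : ℝ) + (4 * Y ^ 2 : ℤ) * s =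
      (ε₁ * (ε₂ * a * (t ^ 2 + (a ^ 2 + b ^ 2) * u ^ 2) + 2 * (a ^ 2 + b ^ 2) * t * u) : ℤ) +
        (ε₁ * (2 * ε₂ * a * t * u + t ^ 2 + (a ^ 2 + b ^ 2) * u ^ 2) : ℤ) * s := by
    rw [zpow_ofNat] at h
    push_cast at h hs ⊢
    linear_combination 4 * h + (ε₁ * ε₂ * a * u ^ 2 + 2 * ε₁ * t * u + ε₁ * u ^ 2 * s) * hs
  obtain ⟨e₁, e₂⟩ := eq_and_eq_of_add_mul_irrational hirr h'
  have hε₂sq : ε₂ ^ 2 = 1 := by rcases hε₂ with rfl | rfl <;> norm_num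
  have e₂' : 4 * Y ^ 2 = ε₁ * ((ε₂ * t + a * u) ^ 2 + (b * u) ^ 2) := by
    linear_combination e₂ - ε₁ * t ^ 2 * hε₂sq
  have hε₁' : ε₁ = 1 := by
    rcases hε₁ with h | h
    · exact h
    · rw [h] at e₂'
      nlinarith [sq_nonneg (ε₂ * t + a * u), sq_nonneg (b * u), pow_pos hY 2]
  rw [hε₁'] at e₁ e₂'
  refine ⟨ε₂ * t, u, ε₂, hε₂, ?_, by linarith, ?_⟩
  · have : (ε₂ * t) ^ 2 = t ^ 2 := by rw [mul_pow, hε₂sq, one_mul]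
    rwa [this]
  · linear_combination ε₂ * e₁ + (a * (a ^ 2 + b ^ 2) * u ^ 2) * hε₂sq

/-- `X + b i` is, up to conjugation and sign, `(a - b i)` times a fourth power in `ℤ[i]`. -/
lemma exists_fourth_power {a b X Y t u ε : ℤ} (hY : 0 < Y) (hXY : IsCoprime X Y)
    (hε : ε = 1 ∨ ε = -1)
    (hn : t ^ 2 - (a ^ 2 + b ^ 2) * u ^ 2 = 4 ∨ t ^ 2 - (a ^ 2 + b ^ 2) * u ^ 2 = -4)
    (h₁ : 4 * Y ^ 2 = (t + a * u) ^ 2 + (b * u) ^ 2)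
    (h₂ : 4 * (ε * X) = a * (t ^ 2 + (a ^ 2 + b ^ 2) * u ^ 2) + 2 * (a ^ 2 + b ^ 2) * t * u) :
    ∃ m n δ σ : ℤ, (δ = 1 ∨ δ = -1) ∧ (σ = 1 ∨ σ = -1) ∧ m ^ 2 + n ^ 2 = Y ∧
      a * (m ^ 4 - 6 * m ^ 2 * n ^ 2 + n ^ 4) + b * (4 * m * n * (m ^ 2 - n ^ 2)) = δ * X ∧
      a * (4 * m * n * (m ^ 2 - n ^ 2)) - b * (m ^ 4 - 6 * m ^ 2 * n ^ 2 + n ^ 4) = δ * (σ * b) ∧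
      (Y ≠ 1 → 5 ≤ Y ∧ b ≤ 2 * Y) := by
  obtain ⟨p, q, hp, hq⟩ := even_of_sq_add_sq h₁.symm
  obtain ⟨κ, hκ, hn'⟩ : ∃ κ : ℤ, (κ = 1 ∨ κ = -1) ∧
      t ^ 2 - (a ^ 2 + b ^ 2) * u ^ 2 = -4 * κ := by
    rcases hn with h | h
    · exact ⟨-1, Or.inr rfl, by rw [h]; norm_num⟩
    · exact ⟨1, Or.inl rfl, by rw [h]; norm_num⟩
  have hpq : p * p + q * q = Y * Y := by
    rw [hp, hq] at h₁; linarith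
  have hre : a * (p ^ 2 - q ^ 2) + b * (2 * p * q) = ε * X := by
    have : 4 * (a * (p ^ 2 - q ^ 2) + b * (2 * p * q)) = 4 * (ε * X) := by
      linear_combination -h₂ - (a * (t + a * u + 2 * p) + 2 * b * (b * u)) * hp +
        (a * (b * u + 2 * q) - 4 * b * p) * hq
    linarith
  have him : a * (2 * p * q) - b * (p ^ 2 - q ^ 2) = κ * b := by
    have : 4 * (a * (2 * p * q) - b * (p ^ 2 - q ^ 2)) = 4 * (κ * b) := by
      linear_combination -b * hn' + (b * (t + a * u + 2 * p) - 2 * a * (b * u)) * hp -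
        (b * (b * u + 2 * q) + 4 * a * p) * hq
    linarith
  have hcop : Int.gcd p q = 1 := by
    have hgp : ((Int.gcd p q : ℕ) : ℤ) ∣ p := Int.gcd_dvd_left ..
    have hgq : ((Int.gcd p q : ℕ) : ℤ) ∣ q := Int.gcd_dvd_right ..
    have hgY : ((Int.gcd p q : ℕ) : ℤ) ∣ Y := by
      rw [← Int.pow_dvd_pow_iff two_ne_zero, show Y ^ 2 = p ^ 2 + q ^ 2 by linarith]
      exact dvd_add (pow_dvd_pow_of_dvd hgp 2) (pow_dvd_pow_of_dvd hgq 2)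
    have hgX : ((Int.gcd p q : ℕ) : ℤ) ∣ ε * X := by
      rw [← hre]
      refine dvd_add (Dvd.dvd.mul_left (dvd_sub ?_ ?_) _) (Dvd.dvd.mul_left (Dvd.dvd.mul_left hgq _) _)
      · exact dvd_pow hgp two_ne_zero
      · exact dvd_pow hgq two_ne_zero
    have hgX' : ((Int.gcd p q : ℕ) : ℤ) ∣ X := by
      rcases hε with rfl | rfl <;> simpa using hgX
    have := hXY.isUnit_of_dvd' hgX' hgY
    simpa using Int.isUnit_iff_natAbs_eq.1 this
  have hlow : Y ≠ 1 → b ≤ 2 * Y := by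
    intro hY1
    have hu : u ≠ 0 := by
      rintro rfl
      refine hY1 ?_
      have : t ^ 2 = 4 * Y ^ 2 := by rw [h₁]; ring
      rcases hn with h | h
      · nlinarith
      · nlinarith
    have hu2 : 1 ≤ u ^ 2 := by have := sq_pos_of_ne_zero hu; omega
    refine abs_le_of_sq_le_sq' ?_ (by linarith) |>.2
    nlinarith [sq_nonneg (t + a * u), sq_nonneg b]
  obtain ⟨m, n, hc, hz, hg, hpar⟩ := PythagoreanTriple.coprime_classification.1 ⟨hpq, hcop⟩
  have hYmn : m ^ 2 + n ^ 2 = Y := by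
    rcases hz with h | h
    · exact h.symm
    · nlinarith [sq_nonneg m, sq_nonneg n]
  have h5 : Y ≠ 1 → 5 ≤ Y := by
    intro hY1
    have hm : m ≠ 0 := by
      rintro rfl
      have h1 : n.natAbs = 1 := by simpa using hg
      have := Int.natAbs_sq n
      rw [h1] at this
      apply hY1; rw [← hYmn, ← this]; norm_num
    have hn : n ≠ 0 := by
      rintro rfl
      have h1 : m.natAbs = 1 := by simpa using hg
      have := Int.natAbs_sq m
      rw [h1] at this
      apply hY1; rw [← hYmn, ← this]; norm_num
    have hm1 := sq_pos_of_ne_zero hm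
    have hn1 := sq_pos_of_ne_zero hn
    rcases hpar with ⟨h, -⟩ | ⟨-, h⟩
    · obtain ⟨c, rfl⟩ := Int.dvd_of_emod_eq_zero h
      have hc0 := sq_pos_of_ne_zero (right_ne_zero_of_mul hm)
      nlinarith
    · obtain ⟨c, rfl⟩ := Int.dvd_of_emod_eq_zero h
      have hc0 := sq_pos_of_ne_zero (right_ne_zero_of_mul hn)
      nlinarith
  have hεsq : ε ^ 2 = 1 := by rcases hε with rfl | rfl <;> norm_num
  have hεκ : ε * κ = 1 ∨ ε * κ = -1 := by
    rcases hε with rfl | rfl <;> rcases hκ with rfl | rfl <;> norm_num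
  rcases hc with ⟨h1, h2⟩ | ⟨h1, h2⟩
  · rw [h1, h2] at hre him
    refine ⟨m, n, ε, ε * κ, hε, hεκ, hYmn, ?_, ?_, fun h => ⟨h5 h, hlow h⟩⟩
    · linear_combination hre
    · linear_combination him - κ * b * hεsq
  · rw [h1, h2] at hre him
    refine ⟨m, -n, -ε, ε * κ, ?_, hεκ, by rw [neg_sq, hYmn], ?_, ?_, fun h => ⟨h5 h, hlow h⟩⟩
    · rcases hε with rfl | rfl <;> norm_num
    · linear_combination -hre
    · linear_combination -him + κ * b * hεsq

lemma exists_int_add_mul_I_of_pow_four_eq {g : ℂ} {p q : ℤ}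
    (h : g ^ 4 = ((p : ℂ) + q * Complex.I) ^ 4) :
    ∃ M K : ℤ, g = M + K * Complex.I := by
  have hI := Complex.I_sq
  have hfac : (g - (p + q * Complex.I)) * (g + (p + q * Complex.I)) *
      ((g - Complex.I * (p + q * Complex.I)) * (g + Complex.I * (p + q * Complex.I))) = 0 := by
    linear_combination h - (g ^ 2 - (p + q * Complex.I) ^ 2) * (p + q * Complex.I) ^ 2 * hI
  rcases mul_eq_zero.1 hfac with h | h <;> rcases mul_eq_zero.1 h with h | h
  · exact ⟨p, q, by linear_combination h⟩
  · exact ⟨-p, -q, by push_cast; linear_combination h⟩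
  · exact ⟨-q, p, by push_cast; linear_combination h + q * hI⟩
  · exact ⟨q, -p, by push_cast; linear_combination h - q * hI⟩

lemma eq_mul_cos_arctan_and_eq_mul_sin_arctan {x b r : ℝ} (hx : 0 < x) (hr : 0 < r)
    (h : x ^ 2 + b ^ 2 = r ^ 2) :
    x = r * Real.cos (Real.arctan (b / x)) ∧ b = r * Real.sin (Real.arctan (b / x)) := by
  have e : √(1 + (b / x) ^ 2) = r / x := by
    rw [show 1 + (b / x) ^ 2 = (r / x) ^ 2 by rw [div_pow, div_pow, ← h]; field_simp]
    exact Real.sqrt_sq (by positivity)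
  rw [Real.cos_arctan, Real.sin_arctan, e]
  constructor <;> field_simp

lemma ofReal_mul_exp_arctan {x b r τ : ℝ} (hx : 0 < x) (hr : 0 < r)
    (h : x ^ 2 + b ^ 2 = r ^ 2) (hτ : τ = 1 ∨ τ = -1) :
    (r : ℂ) * Complex.exp ((τ * Real.arctan (b / x) : ℝ) * Complex.I) =
      x + τ * b * Complex.I := by
  obtain ⟨hc, hs⟩ := eq_mul_cos_arctan_and_eq_mul_sin_arctan hx hr h
  have hc' : (x : ℂ) = r * (Real.cos (Real.arctan (b / x)) : ℝ) := by exact_mod_cast hc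
  have hs' : (b : ℂ) = r * (Real.sin (Real.arctan (b / x)) : ℝ) := by exact_mod_cast hs
  rw [Complex.exp_mul_I, ← Complex.ofReal_cos, ← Complex.ofReal_sin]
  rcases hτ with rfl | rfl
  · rw [one_mul]
    push_cast at hc' hs' ⊢
    linear_combination -hc' - Complex.I * hs'
  · rw [neg_one_mul, Real.cos_neg, Real.sin_neg]
    push_cast at hc' hs' ⊢
    linear_combination -hc' + Complex.I * hs'

/-- The quotient of two solutions, as a fourth power in `ℤ[i]`. -/
lemma exists_fourth_power_quotient {a b X X₃ m n δ σ m₃ n₃ δ₃ σ₃ : ℤ}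
    (hσ : σ = 1 ∨ σ = -1)
    (h₁ : a * (m ^ 4 - 6 * m ^ 2 * n ^ 2 + n ^ 4) + b * (4 * m * n * (m ^ 2 - n ^ 2)) = δ * X)
    (h₂ : a * (4 * m * n * (m ^ 2 - n ^ 2)) - b * (m ^ 4 - 6 * m ^ 2 * n ^ 2 + n ^ 4) =
      δ * (σ * b))
    (h₃ : a * (m₃ ^ 4 - 6 * m₃ ^ 2 * n₃ ^ 2 + n₃ ^ 4) +
      b * (4 * m₃ * n₃ * (m₃ ^ 2 - n₃ ^ 2)) = δ₃ * X₃)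
    (h₄ : a * (4 * m₃ * n₃ * (m₃ ^ 2 - n₃ ^ 2)) -
      b * (m₃ ^ 4 - 6 * m₃ ^ 2 * n₃ ^ 2 + n₃ ^ 4) = δ₃ * (σ₃ * b)) :
    ∃ p q : ℤ, ((a ^ 2 + b ^ 2 : ℤ) : ℂ) * ((p : ℂ) + q * Complex.I) ^ 4 =
      (δ * δ₃ : ℤ) * (X₃ + (σ * σ₃ : ℤ) * b * Complex.I) * (X - b * Complex.I) := by
  have hI := Complex.I_sq
  have hpow : ∀ u v : ℂ, (u + v * Complex.I) ^ 4 =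
      (u ^ 4 - 6 * u ^ 2 * v ^ 2 + v ^ 4) + 4 * u * v * (u ^ 2 - v ^ 2) * Complex.I := by
    intro u v
    linear_combination (6 * u ^ 2 * v ^ 2 + 4 * u * v ^ 3 * Complex.I +
      v ^ 4 * (Complex.I ^ 2 - 1)) * hI
  have g₁ := congrArg (Int.cast : ℤ → ℂ) h₁
  have g₂ := congrArg (Int.cast : ℤ → ℂ) h₂
  have g₃ := congrArg (Int.cast : ℤ → ℂ) h₃
  have g₄ := congrArg (Int.cast : ℤ → ℂ) h₄
  push_cast at g₁ g₂ g₃ g₄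
  have mulI : ∀ A B C E : ℂ, (A + B * Complex.I) * (C - E * Complex.I) =
      (A * C + B * E) + (B * C - A * E) * Complex.I := by
    intro A B C E
    linear_combination -B * E * hI
  have ez : ((a : ℂ) - b * Complex.I) * (m + n * Complex.I) ^ 4 = δ * (X + σ * b * Complex.I) := by
    rw [hpow]
    linear_combination g₁ + Complex.I * g₂ - b * (4 * m * n * (m ^ 2 - n ^ 2)) * hI
  have ez' : ((a : ℂ) + b * Complex.I) * (m - n * Complex.I) ^ 4 =
      δ * (X - σ * b * Complex.I) := by
    rw [sub_eq_add_neg (m : ℂ), ← neg_mul, hpow]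
    linear_combination g₁ - Complex.I * g₂ - b * (4 * m * n * (m ^ 2 - n ^ 2)) * hI
  have ew : ((a : ℂ) - b * Complex.I) * (m₃ + n₃ * Complex.I) ^ 4 =
      δ₃ * (X₃ + σ₃ * b * Complex.I) := by
    rw [hpow]
    linear_combination g₃ + Complex.I * g₄ - b * (4 * m₃ * n₃ * (m₃ ^ 2 - n₃ ^ 2)) * hI
  have ew' : ((a : ℂ) + b * Complex.I) * (m₃ - n₃ * Complex.I) ^ 4 =
      δ₃ * (X₃ - σ₃ * b * Complex.I) := by
    rw [sub_eq_add_neg (m₃ : ℂ), ← neg_mul, hpow]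
    linear_combination g₃ - Complex.I * g₄ - b * (4 * m₃ * n₃ * (m₃ ^ 2 - n₃ ^ 2)) * hI
  have hD : ((a : ℂ) - b * Complex.I) * (a + b * Complex.I) = a ^ 2 + b ^ 2 := by
    linear_combination -(b : ℂ) ^ 2 * hI
  rcases hσ with rfl | rfl
  · refine ⟨m₃ * m + n₃ * n, n₃ * m - m₃ * n, ?_⟩
    push_cast at *
    rw [← mulI, ← hD, mul_pow]
    linear_combination (a + b * Complex.I) * (m - n * Complex.I) ^ 4 * ew +
      δ₃ * (X₃ + σ₃ * b * Complex.I) * ez'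
  · refine ⟨m₃ * m + n₃ * n, m₃ * n - n₃ * m, ?_⟩
    have : ((m₃ : ℂ) * m + n₃ * n) + (m₃ * n - n₃ * m) * Complex.I =
        (m₃ - n₃ * Complex.I) * (m + n * Complex.I) := by
      linear_combination n₃ * n * hI
    push_cast at *
    rw [this, ← hD, mul_pow]
    linear_combination (a - b * Complex.I) * (m + n * Complex.I) ^ 4 * ew' +
      δ₃ * (X₃ - σ₃ * b * Complex.I) * ez

/-- Two solutions of the equation give a Gaussian integer with argument close to
`-arctan (b / X) / 4`. -/
lemma exists_polar_form {a b X Y X₃ Y₃ m n δ σ m₃ n₃ δ₃ σ₃ : ℤ} {θ N : ℝ}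
    (hb : 0 < b) (hX : 0 < X) (hY : 0 < Y) (hX₃ : X < X₃) (hY₃ : 0 < Y₃)
    (he : X ^ 2 - (a ^ 2 + b ^ 2) * Y ^ 4 = -b ^ 2)
    (he₃ : X₃ ^ 2 - (a ^ 2 + b ^ 2) * Y₃ ^ 4 = -b ^ 2)
    (hδ : δ = 1 ∨ δ = -1) (hδ₃ : δ₃ = 1 ∨ δ₃ = -1)
    (hσ : σ = 1 ∨ σ = -1) (hσ₃ : σ₃ = 1 ∨ σ₃ = -1)
    (h₁ : a * (m ^ 4 - 6 * m ^ 2 * n ^ 2 + n ^ 4) + b * (4 * m * n * (m ^ 2 - n ^ 2)) = δ * X)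
    (h₂ : a * (4 * m * n * (m ^ 2 - n ^ 2)) - b * (m ^ 4 - 6 * m ^ 2 * n ^ 2 + n ^ 4) =
      δ * (σ * b))
    (h₃ : a * (m₃ ^ 4 - 6 * m₃ ^ 2 * n₃ ^ 2 + n₃ ^ 4) +
      b * (4 * m₃ * n₃ * (m₃ ^ 2 - n₃ ^ 2)) = δ₃ * X₃)
    (h₄ : a * (4 * m₃ * n₃ * (m₃ ^ 2 - n₃ ^ 2)) -
      b * (m₃ ^ 4 - 6 * m₃ ^ 2 * n₃ ^ 2 + n₃ ^ 4) = δ₃ * (σ₃ * b))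
    (hθ : θ = Real.arctan (b / X)) (hN : N = √((a : ℝ) ^ 2 + (b : ℝ) ^ 2) * (Y : ℝ) ^ 2) :
    ∃ (M K : ℤ) (ρ φ : ℝ), 0 < ρ ∧ ρ ^ 2 ≤ 2 * (Y * Y₃) ∧
      (M : ℝ) = ρ * Real.cos (φ - θ / 4) ∧ (K : ℝ) = ρ * Real.sin (φ - θ / 4) ∧
      |φ| ≤ b / (4 * X₃) ∧ 4 ≤ ρ * (b / X₃ + b / X) ∧
      (X : ℝ) = N * Real.cos θ ∧ (b : ℝ) = N * Real.sin θ := by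
  have hbR : (0 : ℝ) < b := by exact_mod_cast hb
  have hXR : (0 : ℝ) < X := by exact_mod_cast hX
  have hYR : (0 : ℝ) < Y := by exact_mod_cast hY
  have hY₃R : (0 : ℝ) < Y₃ := by exact_mod_cast hY₃
  have hXX : (X : ℝ) < X₃ := by exact_mod_cast hX₃
  have hX₃R : (0 : ℝ) < X₃ := hXR.trans hXX
  obtain ⟨p, q, hpq⟩ := exists_fourth_power_quotient hσ h₁ h₂ h₃ h₄
  obtain ⟨D, hD⟩ : ∃ D : ℝ, (a : ℝ) ^ 2 + (b : ℝ) ^ 2 = D := ⟨_, rfl⟩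
  rw [hD] at hN
  have hD0 : 0 < D := by rw [← hD]; positivity
  have hsD := Real.sq_sqrt hD0.le
  have hsD0 := Real.sqrt_pos.2 hD0
  have hN0 : 0 < N := by rw [hN]; positivity
  have heR : (X : ℝ) ^ 2 + (b : ℝ) ^ 2 = N ^ 2 := by
    have : (X : ℝ) ^ 2 - ((a : ℝ) ^ 2 + (b : ℝ) ^ 2) * Y ^ 4 = -(b : ℝ) ^ 2 := by
      exact_mod_cast he
    rw [hN, mul_pow, hsD, ← hD]; linarith
  have heR₃ : (X₃ : ℝ) ^ 2 + (b : ℝ) ^ 2 = (√D * (Y₃ : ℝ) ^ 2) ^ 2 := by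
    have : (X₃ : ℝ) ^ 2 - ((a : ℝ) ^ 2 + (b : ℝ) ^ 2) * Y₃ ^ 4 = -(b : ℝ) ^ 2 := by
      exact_mod_cast he₃
    rw [mul_pow, hsD, ← hD]; linarith
  obtain ⟨τ, hτdef⟩ : ∃ τ : ℝ, τ = ((σ * σ₃ : ℤ) : ℝ) := ⟨_, rfl⟩
  have hτ : τ = 1 ∨ τ = -1 := by
    rw [hτdef]; rcases hσ with rfl | rfl <;> rcases hσ₃ with rfl | rfl <;> norm_num
  have hτabs : |τ| = 1 := by rcases hτ with h | h <;> rw [h] <;> norm_num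
  set θ₃ := Real.arctan ((b : ℝ) / X₃) with hθ₃
  have hθpos : 0 < θ := by rw [hθ]; exact Real.arctan_pos.2 (by positivity)
  have hθ₃pos : 0 < θ₃ := Real.arctan_pos.2 (by positivity)
  have hθlt : θ < Real.pi / 2 := by rw [hθ]; exact Real.arctan_lt_pi_div_two _
  have hθθ₃ : θ₃ < θ := by
    rw [hθ]; exact Real.arctan_strictMono (div_lt_div_of_pos_left hbR hXR hXX)
  have hle : ∀ x : ℝ, 0 < x → Real.arctan x ≤ x := fun x hx => by
    simpa using Real.le_tan (Real.arctan_nonneg.2 hx.le) (Real.arctan_lt_pi_div_two x)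
  have hθle : θ ≤ b / X := by rw [hθ]; exact hle _ (by positivity)
  have hθ₃le : θ₃ ≤ b / X₃ := hle _ (by positivity)
  obtain ⟨c, p', q', hc0, hc2, hc⟩ : ∃ (c : ℝ) (p' q' : ℤ), 1 ≤ c ∧ c ≤ 2 ∧
      (D : ℂ) * ((p' : ℂ) + q' * Complex.I) ^ 4 =
        (c : ℂ) ^ 2 * ((X₃ + τ * b * Complex.I) * (X - b * Complex.I)) := by
    rw [← hD, hτdef]
    have hδδ : δ * δ₃ = 1 ∨ δ * δ₃ = -1 := by
      rcases hδ with rfl | rfl <;> rcases hδ₃ with rfl | rfl <;> norm_num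
    rcases hδδ with h | h <;> rw [h] at hpq <;> push_cast at hpq
    · refine ⟨1, p, q, le_rfl, one_le_two, ?_⟩
      push_cast
      linear_combination hpq
    · refine ⟨2, p - q, p + q, one_le_two, le_rfl, ?_⟩
      have hI := Complex.I_sq
      have e : ((p - q : ℤ) : ℂ) + (p + q : ℤ) * Complex.I =
          (1 + Complex.I) * (p + q * Complex.I) := by
        push_cast; linear_combination -(q : ℂ) * hI
      have e4 : (1 + Complex.I) ^ 4 = -4 := by
        linear_combination (Complex.I ^ 2 + 4 * Complex.I + 5) * hI
      rw [e, mul_pow, e4]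
      push_cast
      linear_combination -4 * hpq
  have hρsq : √(c * (Y * Y₃)) ^ 2 = c * (Y * Y₃) := Real.sq_sqrt (by positivity)
  have hρ0 : 0 < √(c * (Y * Y₃)) := Real.sqrt_pos.2 (by positivity)
  set ρ := √(c * ((Y : ℝ) * Y₃)) with hρ
  set φ := τ * θ₃ / 4 with hφ
  have hφabs : |φ| = θ₃ / 4 := by
    rw [hφ, abs_div, abs_mul, hτabs, one_mul, abs_of_pos hθ₃pos, abs_of_pos (by norm_num)]
  obtain ⟨M, K, hMK⟩ : ∃ M K : ℤ,
      (ρ : ℂ) * Complex.exp ((φ - θ / 4 : ℝ) * Complex.I) = M + K * Complex.I := by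
    refine exists_int_add_mul_I_of_pow_four_eq (p := p') (q := q') ?_
    have hDC : (D : ℂ) ≠ 0 := by exact_mod_cast hD0.ne'
    refine mul_left_cancel₀ hDC ?_
    have e₁ := ofReal_mul_exp_arctan hX₃R (by positivity) heR₃ hτ
    have e₂ := ofReal_mul_exp_arctan hXR hN0 heR (Or.inr rfl)
    rw [hc, mul_pow, ← Complex.exp_nat_mul]
    have hexp : Complex.exp ((4 : ℕ) * ((φ - θ / 4 : ℝ) * Complex.I)) =
        Complex.exp ((τ * θ₃ : ℝ) * Complex.I) * Complex.exp ((-1 * θ : ℝ) * Complex.I) := by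
      rw [← Complex.exp_add]
      congr 1
      rw [hφ]; push_cast; ring
    have hρ4 : (D : ℂ) * (ρ : ℂ) ^ 4 = (c : ℂ) ^ 2 * ((√D * (Y₃ : ℝ) ^ 2 : ℝ) * (N : ℝ)) := by
      have : D * ρ ^ 4 = c ^ 2 * ((√D * (Y₃ : ℝ) ^ 2) * N) := by
        rw [hN, show ρ ^ 4 = (ρ ^ 2) ^ 2 by ring, hρsq]
        linear_combination -(c ^ 2 * (Y : ℝ) ^ 2 * Y₃ ^ 2) * hsD
      exact_mod_cast this
    rw [hexp, ← mul_assoc, hρ4]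
    rw [← hθ] at e₂
    have e₂' : ((-1 : ℝ) : ℂ) = -1 := by norm_num
    rw [e₂'] at e₂
    simp only [Complex.ofReal_intCast] at e₁ e₂
    linear_combination (c : ℂ) ^ 2 * (N * Complex.exp ((-1 * θ : ℝ) * Complex.I)) * e₁ +
      (c : ℂ) ^ 2 * (X₃ + τ * b * Complex.I) * e₂
  have hM : (M : ℝ) = ρ * Real.cos (φ - θ / 4) := by
    have := congrArg Complex.re hMK
    rw [Complex.re_ofReal_mul, Complex.exp_ofReal_mul_I_re] at this
    simpa using this.symm
  have hK : (K : ℝ) = ρ * Real.sin (φ - θ / 4) := by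
    have := congrArg Complex.im hMK
    rw [Complex.im_ofReal_mul, Complex.exp_ofReal_mul_I_im] at this
    simpa using this.symm
  have hφθ := abs_le.1 hφabs.le
  have hsin : Real.sin (φ - θ / 4) ≠ 0 := by
    refine (Real.sin_neg_of_neg_of_neg_pi_lt ?_ ?_).ne
    · linarith [hφθ.2]
    · linarith [hφθ.1]
  have hK0 : K ≠ 0 := by
    rintro rfl
    rw [Int.cast_zero] at hK
    exact mul_ne_zero hρ0.ne' hsin hK.symm
  have hK1 : (1 : ℝ) ≤ |(K : ℝ)| := by exact_mod_cast Int.one_le_abs hK0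
  obtain ⟨hXc, hbs⟩ := eq_mul_cos_arctan_and_eq_mul_sin_arctan hXR hN0 heR
  rw [← hθ] at hXc hbs
  refine ⟨M, K, ρ, φ, hρ0, ?_, hM, hK, ?_, ?_, hXc, hbs⟩
  · rw [hρsq]; gcongr
  · rw [hφabs, show (b : ℝ) / (4 * X₃) = b / X₃ / 4 by rw [div_div, mul_comm]]
    gcongr
  · have h1 : |Real.sin (φ - θ / 4)| ≤ (b / X₃ + b / X) / 4 := by
      refine Real.abs_sin_le_abs.trans (abs_le.2 ⟨?_, ?_⟩) <;> linarith [hφθ.1, hφθ.2]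
    rw [hK, abs_mul, abs_of_pos hρ0] at hK1
    nlinarith [mul_le_mul_of_nonneg_left h1 hρ0.le]

/-- Consecutive solutions with `Y ≥ 5` are far apart. -/
lemma gap_of_polar_bound {D b X Y X₃ Y₃ ρ : ℝ} (hb : 1 ≤ b) (hbD : b ^ 2 ≤ D) (hX : 0 < X)
    (hXX : X < X₃) (hY : 5 ≤ Y) (hY₃ : 0 < Y₃) (he : X ^ 2 = D * Y ^ 4 - b ^ 2)
    (he₃ : X₃ ^ 2 = D * Y₃ ^ 4 - b ^ 2) (hρ0 : 0 < ρ) (hρ : ρ ^ 2 ≤ 2 * (Y * Y₃))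
    (h : 4 ≤ ρ * (b / X₃ + b / X)) :
    3.96 ≤ ρ * b / X ∧ 7.8 * (D * Y ^ 3) ≤ Y₃ * b ^ 2 := by
  have hX₃ : 0 < X₃ := hX.trans hXX
  have hb0 : 0 < b := by linarith
  have hD : 0 < D := by nlinarith
  have hY0 : 0 < Y := by linarith
  have hYsq : 25 ≤ Y ^ 2 := by nlinarith
  have hY4 : 625 ≤ Y ^ 4 := by nlinarith
  have h1 : 2 ≤ ρ * b / X := by
    have : b / X₃ ≤ b / X := by gcongr
    have := mul_le_mul_of_nonneg_left this hρ0.le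
    rw [mul_div_assoc]; linarith
  have h2 : 2 * X ≤ ρ * b := (le_div_iff₀ hX).1 h1
  have h3 : 4 * X ^ 2 ≤ 2 * (Y * Y₃) * b ^ 2 := by
    nlinarith [pow_le_pow_left₀ (by positivity) h2 2, mul_le_mul_of_nonneg_right hρ (sq_nonneg b)]
  have h4 : 2 * (Y ^ 4 - 1) ≤ Y * Y₃ := by
    have : D * (2 * (Y ^ 4 - 1)) ≤ D * (Y * Y₃) := by
      have : Y * Y₃ * b ^ 2 ≤ Y * Y₃ * D := by gcongr
      nlinarith
    exact le_of_mul_le_mul_left this hD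
  have h5 : 49 * Y ≤ Y₃ := by
    refine le_of_mul_le_mul_left ?_ hY0
    nlinarith
  have h6 : 100 * X ≤ X₃ := by
    refine abs_le_of_sq_le_sq' ?_ hX₃.le |>.2
    have : (49 * Y) ^ 4 ≤ Y₃ ^ 4 := by gcongr
    have := mul_le_mul_of_nonneg_left this hD.le
    have : D * 625 ≤ D * Y ^ 4 := by gcongr
    nlinarith
  have h7 : 3.96 ≤ ρ * b / X := by
    have : b / X₃ ≤ b / X / 100 := by
      rw [div_div]; gcongr; linarith
    have := mul_le_mul_of_nonneg_left this hρ0.le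
    rw [mul_div_assoc]; linarith
  refine ⟨h7, ?_⟩
  have h8 : 3.96 * X ≤ ρ * b := (le_div_iff₀ hX).1 h7
  have h9 : 3.96 ^ 2 * X ^ 2 ≤ 2 * (Y * Y₃) * b ^ 2 := by
    nlinarith [pow_le_pow_left₀ (by positivity) h8 2, mul_le_mul_of_nonneg_right hρ (sq_nonneg b)]
  refine le_of_mul_le_mul_left ?_ hY0
  have : D * 625 ≤ D * Y ^ 4 := by gcongr
  rw [he] at h9
  norm_num at h9 ⊢
  nlinarith

lemma false_of_large_solution {D b X Y X₃ Y₃ Y₀ ρ φ N θ : ℝ} {M K X' b' : ℤ} (hb' : (b' : ℝ) = b)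
    (hX' : (X' : ℝ) = X) (hb : 1 ≤ b) (hbD : b ^ 2 ≤ D)
    (hX : 0 < X) (hXX : X < X₃) (hY₀ : 5 ≤ Y₀) (hbY₀ : b ≤ 2 * Y₀) (hY : 5 ≤ Y) (hY₃ : 0 < Y₃)
    (hgap : 7.8 * (D * Y₀ ^ 3) ≤ Y * b ^ 2)
    (he : X ^ 2 = D * Y ^ 4 - b ^ 2) (he₃ : X₃ ^ 2 = D * Y₃ ^ 4 - b ^ 2) (hρ0 : 0 < ρ)
    (hρ : ρ ^ 2 ≤ 2 * (Y * Y₃)) (h : 4 ≤ ρ * (b / X₃ + b / X)) (hθ0 : 0 < θ)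
    (hθ1 : θ < Real.pi / 2) (hN : N = √D * Y ^ 2)
    (hXc : X = N * Real.cos θ) (hbs : b = N * Real.sin θ)
    (hM : (M : ℝ) = ρ * Real.cos (φ - θ / 4)) (hK : (K : ℝ) = ρ * Real.sin (φ - θ / 4))
    (hφ : |φ| ≤ b / (4 * X₃)) : False := by
  obtain ⟨hV, hgap'⟩ := gap_of_polar_bound hb hbD hX hXX hY hY₃ he he₃ hρ0 hρ h
  have hX₃ : 0 < X₃ := hX.trans hXX
  have hb0 : 0 < b := by linarith
  have hD : 0 < D := by nlinarith
  have hY0 : 0 < Y := by linarith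
  have hsD := Real.sqrt_pos.2 hD
  have hsq := Real.sq_sqrt hD.le
  have hbs' : b ≤ √D := Real.le_sqrt_of_sq_le hbD
  have hN0 : 0 < N := by rw [hN]; positivity
  have hY4 : 625 ≤ Y ^ 4 := by
    calc (625 : ℝ) = 5 ^ 4 := by norm_num
      _ ≤ Y ^ 4 := by gcongr
  have hYb : 97.5 * b ≤ Y := by
    have h1 : 7.8 * Y₀ ^ 3 ≤ Y := by
      have : D * (7.8 * Y₀ ^ 3) ≤ D * Y := by
        have : Y * b ^ 2 ≤ Y * D := by gcongr
        linarith
      exact le_of_mul_le_mul_left this hD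
    have h2 : 5 ^ 2 * Y₀ ≤ Y₀ ^ 3 := by
      rw [pow_succ Y₀ 2]; gcongr
    norm_num at h1 ⊢
    linarith
  have hY₃Y : Y ≤ Y₃ := by
    have : Y ^ 4 < Y₃ ^ 4 := by
      have : D * Y ^ 4 < D * Y₃ ^ 4 := by
        linarith [pow_lt_pow_left₀ hXX hX.le two_ne_zero]
      exact lt_of_mul_lt_mul_left this hD.le
    exact (lt_of_pow_lt_pow_left₀ 4 hY₃.le this).le
  have hY₃4 : 625 ≤ Y₃ ^ 4 := hY4.trans (by gcongr)
  refine false_of_pade_approximation (M := M) (K := K) (X := X') (B := b') (N := N) (X₃ := X₃)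
    (ρ := ρ) (θ := θ) (φ := φ) ?_ ?_ hN0 hρ0 hθ0 hθ1 (hX'.trans hXc) (hb'.trans hbs) hM hK ?_ ?_
    ?_ ?_ ?_
  · rw [← hb'] at hb; exact_mod_cast hb
  · rw [← hX'] at hX; exact_mod_cast hX
  · rw [hb', hX']; linarith
  · rw [hb', hN]
    have : (97.5 * b) ^ 2 ≤ Y ^ 2 := by gcongr
    have := mul_le_mul hbs' this (by positivity) hsD.le
    refine le_trans ?_ this
    linarith [pow_pos hb0 3]
  · rw [hb']
    have h1 : ρ ^ 4 ≤ 4 * (Y * Y₃) ^ 2 :=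
      calc ρ ^ 4 = (ρ ^ 2) ^ 2 := by ring
        _ ≤ (2 * (Y * Y₃)) ^ 2 := by gcongr
        _ = 4 * (Y * Y₃) ^ 2 := by ring
    have h2 : b ^ 2 * ρ ^ 4 / (4 * N) ≤ √D * Y₃ ^ 2 := by
      rw [div_le_iff₀ (by positivity), hN]
      calc b ^ 2 * ρ ^ 4 ≤ D * (4 * (Y * Y₃) ^ 2) := by gcongr
        _ = √D * Y₃ ^ 2 * (4 * (√D * Y ^ 2)) := by
          linear_combination -(4 * (Y * Y₃) ^ 2) * hsq
    refine (mul_le_mul_of_nonneg_left h2 (by norm_num)).trans ?_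
    refine abs_le_of_sq_le_sq' ?_ hX₃.le |>.2
    have : D * 625 ≤ D * Y₃ ^ 4 := by gcongr
    rw [mul_pow, mul_pow, hsq, he₃, ← pow_mul]
    norm_num
    linarith
  · rw [hb']; exact hφ
  · refine hφ.trans ?_
    rw [div_le_div_iff₀ (by positivity) (by norm_num)]
    have : b ≤ X₃ := by
      refine abs_le_of_sq_le_sq' ?_ hX₃.le |>.2
      have : D * 625 ≤ D * Y₃ ^ 4 := by gcongr
      linarith
    linarith

lemma OneFamilyCondition.exists_fourth_power {a b X Y : ℤ} (hnotsq : ¬ IsSquare (a ^ 2 + b ^ 2))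
    (hofc : OneFamilyCondition a b) (hY : 0 < Y) (hXY : IsCoprime X Y)
    (he : X ^ 2 - (a ^ 2 + b ^ 2) * Y ^ 4 = -b ^ 2) :
    ∃ m n δ σ : ℤ, (δ = 1 ∨ δ = -1) ∧ (σ = 1 ∨ σ = -1) ∧ m ^ 2 + n ^ 2 = Y ∧
      a * (m ^ 4 - 6 * m ^ 2 * n ^ 2 + n ^ 4) + b * (4 * m * n * (m ^ 2 - n ^ 2)) = δ * X ∧
      a * (4 * m * n * (m ^ 2 - n ^ 2)) - b * (m ^ 4 - 6 * m ^ 2 * n ^ 2 + n ^ 4) = δ * (σ * b) ∧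
      (Y ≠ 1 → 5 ≤ Y ∧ b ≤ 2 * Y) := by
  obtain ⟨T, U, -, -, hTU, -, hfam⟩ := hofc
  obtain ⟨k, ε₁, ε₂, hε₁, hε₂, h⟩ := hfam X (Y ^ 2) hXY.pow_right (by rw [← he]; ring)
  have hD0 : (0 : ℤ) ≤ a ^ 2 + b ^ 2 := by positivity
  have hcast : ((a ^ 2 + b ^ 2 : ℤ) : ℝ) = (a : ℝ) ^ 2 + (b : ℝ) ^ 2 := by push_cast; rfl
  have hirr : Irrational √((a : ℝ) ^ 2 + (b : ℝ) ^ 2) := by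
    rw [← hcast, irrational_sqrt_intCast_iff_of_nonneg hD0]
    exact hnotsq
  have hs : √((a : ℝ) ^ 2 + (b : ℝ) ^ 2) ^ 2 = ((a ^ 2 + b ^ 2 : ℤ) : ℝ) := by
    rw [hcast, Real.sq_sqrt (by positivity)]
  obtain ⟨t, u, ε, hε, hn, h₁, h₂⟩ :=
    exists_unit_of_oneFamily hs hirr hTU hε₁ hε₂ hY h
  exact _root_.exists_fourth_power hY hXY hε hn h₁ h₂

/-- There are no three solutions with `1 < Y₁ < Y₂ < Y₃`. -/
lemma OneFamilyCondition.false_of_three_solutions {a b X₁ Y₁ X₂ Y₂ X₃ Y₃ : ℤ}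
    (hb : 0 < b) (hnotsq : ¬ IsSquare (a ^ 2 + b ^ 2)) (hofc : OneFamilyCondition a b)
    (hX₁ : 0 < X₁) (hX₂ : 0 < X₂) (hX₃ : 0 < X₃) (hY₁ : 1 < Y₁) (hY₁₂ : Y₁ < Y₂) (hY₂₃ : Y₂ < Y₃)
    (hc₁ : IsCoprime X₁ Y₁) (hc₂ : IsCoprime X₂ Y₂) (hc₃ : IsCoprime X₃ Y₃)
    (he₁ : X₁ ^ 2 - (a ^ 2 + b ^ 2) * Y₁ ^ 4 = -b ^ 2)
    (he₂ : X₂ ^ 2 - (a ^ 2 + b ^ 2) * Y₂ ^ 4 = -b ^ 2)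
    (he₃ : X₃ ^ 2 - (a ^ 2 + b ^ 2) * Y₃ ^ 4 = -b ^ 2) : False := by
  have hY₁0 : 0 < Y₁ := by linarith
  have hY₂0 : 0 < Y₂ := by linarith
  have hY₃0 : 0 < Y₃ := by linarith
  have hXlt : ∀ {X Y X' Y' : ℤ}, 0 < X' → 0 < Y → Y < Y' →
      X ^ 2 - (a ^ 2 + b ^ 2) * Y ^ 4 = -b ^ 2 →
      X' ^ 2 - (a ^ 2 + b ^ 2) * Y' ^ 4 = -b ^ 2 → X < X' := by
    intro X Y X' Y' h1 h2 h3 h4 h5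
    refine lt_of_pow_lt_pow_left₀ 2 h1.le ?_
    have : Y ^ 4 < Y' ^ 4 := by gcongr
    have : (a ^ 2 + b ^ 2) * Y ^ 4 < (a ^ 2 + b ^ 2) * Y' ^ 4 := by
      gcongr
    linarith
  have hX₁₂ := hXlt hX₂ hY₁0 hY₁₂ he₁ he₂
  have hX₂₃ := hXlt hX₃ hY₂0 hY₂₃ he₂ he₃
  obtain ⟨m₁, n₁, δ₁, σ₁, hδ₁, hσ₁, -, f₁, g₁, hl₁⟩ := hofc.exists_fourth_power hnotsq hY₁0 hc₁ he₁
  obtain ⟨m₂, n₂, δ₂, σ₂, hδ₂, hσ₂, -, f₂, g₂, hl₂⟩ := hofc.exists_fourth_power hnotsq hY₂0 hc₂ he₂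
  obtain ⟨m₃, n₃, δ₃, σ₃, hδ₃, hσ₃, -, f₃, g₃, -⟩ := hofc.exists_fourth_power hnotsq hY₃0 hc₃ he₃
  obtain ⟨h5₁, hbY₁⟩ := hl₁ hY₁.ne'
  have h5₂ : 5 ≤ Y₂ := by linarith
  obtain ⟨M, K, ρ, φ, hρ0, hρ, -, -, -, h4, -, -⟩ := exists_polar_form hb hX₁ hY₁0 hX₁₂ hY₂0
    he₁ he₂ hδ₁ hδ₂ hσ₁ hσ₂ f₁ g₁ f₂ g₂ rfl rfl
  obtain ⟨M', K', ρ', φ', hρ0', hρ', hM', hK', hφ', h4', hXc, hbs⟩ := exists_polar_form hb hX₂ hY₂0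
    hX₂₃ hY₃0 he₂ he₃ hδ₂ hδ₃ hσ₂ hσ₃ f₂ g₂ f₃ g₃ rfl rfl
  have castEq : ∀ {X Y : ℤ}, X ^ 2 - (a ^ 2 + b ^ 2) * Y ^ 4 = -b ^ 2 →
      (X : ℝ) ^ 2 = ((a : ℝ) ^ 2 + (b : ℝ) ^ 2) * (Y : ℝ) ^ 4 - (b : ℝ) ^ 2 := by
    intro X Y h
    have : X ^ 2 = (a ^ 2 + b ^ 2) * Y ^ 4 - b ^ 2 := by linarith
    exact_mod_cast this
  have hb1 : (1 : ℝ) ≤ b := by exact_mod_cast hb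
  have hbD : (b : ℝ) ^ 2 ≤ (a : ℝ) ^ 2 + (b : ℝ) ^ 2 := by nlinarith [sq_nonneg (a : ℝ)]
  have hX₁R : (0 : ℝ) < X₁ := by exact_mod_cast hX₁
  have hX₂R : (0 : ℝ) < X₂ := by exact_mod_cast hX₂
  have hbR : (0 : ℝ) < b := by exact_mod_cast hb
  have h5₁R : (5 : ℝ) ≤ Y₁ := by exact_mod_cast h5₁
  obtain ⟨-, hgap⟩ := gap_of_polar_bound hb1 hbD hX₁R (by exact_mod_cast hX₁₂)
    h5₁R (by exact_mod_cast hY₂0) (castEq he₁) (castEq he₂) hρ0 hρ h4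
  exact false_of_large_solution rfl rfl hb1 hbD hX₂R (by exact_mod_cast hX₂₃) h5₁R
    (by exact_mod_cast hbY₁) (by exact_mod_cast h5₂) (by exact_mod_cast hY₃0) hgap (castEq he₂)
    (castEq he₃) hρ0' hρ' h4' (Real.arctan_pos.2 (div_pos hbR hX₂R)) (Real.arctan_lt_pi_div_two _)
    rfl hXc hbs hM' hK' hφ'

/-- Theorem 1.2: Let `a` and `b` be relatively prime positive integers such that
`D = a² + b²` is not a perfect square. Suppose the negative Pell equation
`x² − D·y² = −1` has an integer solution and `D` satisfies the one-family condition
with respect to `a` and `b`. Then `X² − D·Y⁴ = −b²` has at most three solutions in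
coprime positive integers. -/
theorem at_most_three_coprime_solutions
    (a b : ℤ) (ha : 0 < a) (hb : 0 < b) (hab : IsCoprime a b)
    (hnotsq : ¬ IsSquare (a ^ 2 + b ^ 2))
    (hpell : ∃ x y : ℤ, x ^ 2 - (a ^ 2 + b ^ 2) * y ^ 2 = -1)
    (hofc : OneFamilyCondition a b) :
    {XY : ℤ × ℤ | 0 < XY.1 ∧ 0 < XY.2 ∧ IsCoprime XY.1 XY.2 ∧
      XY.1 ^ 2 - (a ^ 2 + b ^ 2) * XY.2 ^ 4 = -b ^ 2}.encard ≤ 3 := by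
  set S := {XY : ℤ × ℤ | 0 < XY.1 ∧ 0 < XY.2 ∧ IsCoprime XY.1 XY.2 ∧
    XY.1 ^ 2 - (a ^ 2 + b ^ 2) * XY.2 ^ 4 = -b ^ 2} with hS
  have hinj : Set.InjOn Prod.snd S := by
    rintro ⟨X, Y⟩ ⟨hX, -, -, he⟩ ⟨X', Y'⟩ ⟨hX', -, -, he'⟩ (rfl : Y = Y')
    have : X ^ 2 = X' ^ 2 := by simp only at he he'; linarith
    rw [Prod.mk.injEq]
    exact ⟨(pow_left_inj₀ hX.le hX'.le two_ne_zero).1 this, rfl⟩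
  rw [← hinj.encard_image]
  have hone : Prod.snd '' S ⊆ insert 1 {Y | 1 < Y ∧ Y ∈ Prod.snd '' S} := by
    rintro Y ⟨⟨X, Y'⟩, h, rfl⟩
    rcases (Int.add_one_le_iff.2 h.2.1).eq_or_lt with h1 | h1
    · exact Or.inl h1.symm
    · exact Or.inr ⟨h1, _, h, rfl⟩
  refine (Set.encard_le_encard hone).trans ((Set.encard_insert_le _ _).trans ?_)
  suffices h : {Y | 1 < Y ∧ Y ∈ Prod.snd '' S}.encard ≤ 2 from
    (add_le_add_left h 1).trans (by norm_num)
  by_contra! h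
  obtain ⟨t, ht, hcard⟩ := Set.exists_subset_encard_eq (Order.add_one_le_of_lt h)
  rw [show (2 : ℕ∞) + 1 = 3 by norm_num, Set.encard_eq_three] at hcard
  obtain ⟨x, y, z, hxy, hxz, hyz, rfl⟩ := hcard
  have key : ∀ Y₁ Y₂ Y₃ : ℤ, Y₁ ∈ ({x, y, z} : Set ℤ) → Y₂ ∈ ({x, y, z} : Set ℤ) →
      Y₃ ∈ ({x, y, z} : Set ℤ) → Y₁ < Y₂ → Y₂ < Y₃ → False := by
    intro Y₁ Y₂ Y₃ h₁ h₂ h₃ h₁₂ h₂₃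
    obtain ⟨hY₁, ⟨X₁, _⟩, ⟨hX₁, -, hc₁, he₁⟩, rfl⟩ := ht h₁
    obtain ⟨-, ⟨X₂, _⟩, ⟨hX₂, -, hc₂, he₂⟩, rfl⟩ := ht h₂
    obtain ⟨-, ⟨X₃, _⟩, ⟨hX₃, -, hc₃, he₃⟩, rfl⟩ := ht h₃
    exact hofc.false_of_three_solutions hb hnotsq hX₁ hX₂ hX₃ hY₁ h₁₂ h₂₃ hc₁ hc₂ hc₃ he₁ he₂ he₃
  have mx : x ∈ ({x, y, z} : Set ℤ) := by simp
  have my : y ∈ ({x, y, z} : Set ℤ) := by simp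
  have mz : z ∈ ({x, y, z} : Set ℤ) := by simp
  rcases lt_or_gt_of_ne hxy with h1 | h1 <;> rcases lt_or_gt_of_ne hxz with h2 | h2 <;>
    rcases lt_or_gt_of_ne hyz with h3 | h3
  · exact key _ _ _ mx my mz h1 h3
  · exact key _ _ _ mx mz my h2 h3
  · linarith
  · exact key _ _ _ mz mx my h2 h1
  · exact key _ _ _ my mx mz h1 h2
  · linarith
  · exact key _ _ _ my mz mx h3 h2
  · exact key _ _ _ mz my mx h3 h1
end

section
/- Let a, m be positive integers and p a prime, and let b = p^m or b = 2·p^m. Suppose gcd(a, b) = 1, D = a² + b² is not a perfect square, and the negative Pell equation x² − D·y² = −1 has an integer solution. Then D satisfies the one-family condition with respect to a and b; that is, every pair of coprime integers (x, y) with x² − D·y² = −b² satisfies x + y·√D = ε₁·(ε₂·a + √D)·α^(2k) for some integer k and some signs ε₁, ε₂ ∈ {1, −1}, where (T₁, U₁) is the pair of positive integers with T₁² − D·U₁² = −4 and U₁ minimal, and α = (T₁ + U₁·√D)/2 ∈ ℝ. -/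
/-- `z = (t + u√D)/2` for integers `t, u` with `t² - D u² = 4n`: a half-integral quadratic
number of norm `n`. -/
def IsHalfIntegralOfNorm (D n : ℤ) (z : ℝ) : Prop :=
  ∃ t u : ℤ, t ^ 2 - D * u ^ 2 = 4 * n ∧ 2 * z = t + u * Real.sqrt (D : ℝ)

namespace IsHalfIntegralOfNorm

variable {D n k : ℤ} {z v : ℝ}

theorem one : IsHalfIntegralOfNorm D 1 1 := ⟨2, 0, by ring, by push_cast; ring⟩

theorem neg (h : IsHalfIntegralOfNorm D n z) : IsHalfIntegralOfNorm D n (-z) := by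
  obtain ⟨t, u, h, hz⟩ := h
  exact ⟨-t, -u, by linarith, by push_cast; linarith⟩

theorem mul (hD : 0 ≤ D) (hz : IsHalfIntegralOfNorm D n z) (hv : IsHalfIntegralOfNorm D k v) :
    IsHalfIntegralOfNorm D (n * k) (z * v) := by
  obtain ⟨t, u, h, hz⟩ := hz
  obtain ⟨T, U, H, hv⟩ := hv
  have parity : ∀ {r s l : ℤ}, r ^ 2 - D * s ^ 2 = 4 * l → (Even r ↔ Even D ∨ Even s) := by
    intro r s l e
    have : Even (r ^ 2 - D * s ^ 2) := e ▸ ⟨2 * l, by ring⟩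
    simpa [Int.even_sub, Int.even_mul, Int.even_pow] using this
  have e := parity h
  have E := parity H
  obtain ⟨r, hr⟩ : Even (t * T + D * u * U) := by
    simp only [Int.even_add, Int.even_mul]; tauto
  obtain ⟨s, hs⟩ : Even (t * U + u * T) := by
    simp only [Int.even_add, Int.even_mul]; tauto
  have hw : Real.sqrt (D : ℝ) ^ 2 = D := Real.sq_sqrt (by exact_mod_cast hD)
  refine ⟨r, s, ?_, ?_⟩
  · have : 4 * (r ^ 2 - D * s ^ 2) = 4 * (4 * (n * k)) := by
      calc 4 * (r ^ 2 - D * s ^ 2) = (r + r) ^ 2 - D * (s + s) ^ 2 := by ring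
        _ = (t ^ 2 - D * u ^ 2) * (T ^ 2 - D * U ^ 2) := by rw [← hr, ← hs]; ring
        _ = 4 * (4 * (n * k)) := by rw [h, H]; ring
    linarith
  · have hr' : (t * T + D * u * U : ℝ) = r + r := by exact_mod_cast hr
    have hs' : (t * U + u * T : ℝ) = s + s := by exact_mod_cast hs
    have : (2 * z) * (2 * v) = (t + u * Real.sqrt D) * (T + U * Real.sqrt D) := by rw [hz, hv]
    linear_combination this / 2 + hr' / 2 + Real.sqrt D * hs' / 2 + (u : ℝ) * U / 2 * hw

/-- The conjugate of a half-integral number of norm `n` is `n / z`. -/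
theorem mul_conj (hD : 0 ≤ D) {t u : ℤ} (h : t ^ 2 - D * u ^ 2 = 4 * n)
    (hz : 2 * z = t + u * Real.sqrt (D : ℝ)) : z * (t - u * Real.sqrt (D : ℝ)) = 2 * n := by
  have hw : Real.sqrt (D : ℝ) ^ 2 = D := Real.sq_sqrt (by exact_mod_cast hD)
  have h' : (t ^ 2 - D * u ^ 2 : ℝ) = 4 * n := by exact_mod_cast h
  linear_combination (t - u * Real.sqrt D) / 2 * hz + h' / 2 - (u : ℝ) ^ 2 / 2 * hw

theorem inv (hD : 0 ≤ D) (hn : n ^ 2 = 1) (h : IsHalfIntegralOfNorm D n z) :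
    IsHalfIntegralOfNorm D n z⁻¹ := by
  obtain ⟨t, u, h, hz⟩ := h
  have hc := mul_conj hD h hz
  have hn' : (n : ℝ) ^ 2 = 1 := by exact_mod_cast hn
  have hz0 : z ≠ 0 := by
    rintro rfl
    have : (n : ℝ) = 0 := by linarith
    simp [this] at hn'
  refine ⟨n * t, -(n * u), by linear_combination n ^ 2 * h + 4 * n * hn, ?_⟩
  push_cast
  field_simp
  linear_combination -(n : ℝ) * hc - 2 * hn'

theorem zpow (hD : 0 ≤ D) (h : IsHalfIntegralOfNorm D 1 z) (j : ℤ) :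
    IsHalfIntegralOfNorm D 1 (z ^ j) := by
  have hpow : ∀ i : ℕ, IsHalfIntegralOfNorm D 1 (z ^ i) := fun i ↦ by
    induction i with
    | zero => simpa using one
    | succ i ih => simpa [pow_succ] using ih.mul hD h
  obtain ⟨i, rfl | rfl⟩ := j.eq_nat_or_neg
  · simpa using hpow i
  · simpa using (hpow i).inv hD (by norm_num)

/-- If `(T, U)` is the least positive solution of `T² - D U² = -4`, then every positive
half-integral number of norm `1` is an even power of `(T + U√D)/2`. -/
theorem eq_zpow_of_pos (hD : 0 < D) (hsq : ¬ IsSquare D) {T U : ℤ} (hT : 0 < T)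
    (hTU : T ^ 2 - D * U ^ 2 = -4)
    (hmin : ∀ T' U' : ℤ, 0 < T' → 0 < U' → T' ^ 2 - D * U' ^ 2 = -4 → U ≤ U')
    {α β : ℝ} (hα : 2 * α = T + U * Real.sqrt (D : ℝ)) (hα0 : 0 < α)
    (hβ : IsHalfIntegralOfNorm D 1 β) (hβ0 : 0 < β) : ∃ j : ℤ, β = α ^ (2 * j) := by
  have hw : 0 < Real.sqrt (D : ℝ) := Real.sqrt_pos.2 (by exact_mod_cast hD)
  have hαc := mul_conj (n := -1) hD.le (by linarith) hα
  push_cast at hαc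
  have hα1 : 1 < α := by
    have hT' : (0 : ℝ) < T := by exact_mod_cast hT
    nlinarith
  have hαH : IsHalfIntegralOfNorm D (-1) α := ⟨T, U, by linarith, hα⟩
  have hα2 : IsHalfIntegralOfNorm D 1 (α ^ 2) := by
    simpa [pow_two] using hαH.mul hD.le hαH
  obtain ⟨j, hj₁, hj₂⟩ := exists_mem_Ico_zpow hβ0 (y := α ^ 2) (by nlinarith)
  refine ⟨j, ?_⟩
  have hpos : 0 < (α ^ 2) ^ j := by positivity
  rw [zpow_mul, zpow_ofNat]
  by_contra hne
  replace hj₁ : (α ^ 2) ^ j < β := lt_of_le_of_ne hj₁ (Ne.symm hne)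
  rw [zpow_add_one₀ (by positivity)] at hj₂
  obtain ⟨δ, hδ⟩ : ∃ δ, δ = β * ((α ^ 2) ^ j)⁻¹ * α⁻¹ := ⟨_, rfl⟩
  have hδH : IsHalfIntegralOfNorm D (-1) δ := by
    have := (hβ.mul hD.le ((hα2.zpow hD.le j).inv hD.le (by norm_num))).mul hD.le
      (hαH.inv hD.le (by norm_num))
    simpa [hδ] using this
  have hβδ : β = (α ^ 2) ^ j * (δ * α) := by rw [hδ]; field_simp
  have hlow : 1 < δ * α := by rw [hβδ] at hj₁; exact (lt_mul_iff_one_lt_right hpos).1 hj₁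
  have hup : δ < α := by
    rw [hβδ] at hj₂
    have := lt_of_mul_lt_mul_left hj₂ hpos.le
    rw [pow_two] at this
    exact lt_of_mul_lt_mul_right this hα0.le
  have hδ0 : 0 < δ := by by_contra! h; nlinarith
  obtain ⟨r, s, hrs, hδe⟩ := hδH
  have hδc := mul_conj hD.le hrs hδe
  push_cast at hδc
  have hs0 : 0 < s := by
    have : (0 : ℝ) < s := by
      by_contra! h
      have : (s : ℝ) * Real.sqrt D ≤ 0 := mul_nonpos_of_nonpos_of_nonneg h hw.le
      nlinarith
    exact_mod_cast this
  have hsU : s < U := by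
    have e₁ : δ * (s * Real.sqrt D) = δ ^ 2 + 1 := by
      linear_combination -(δ * hδe + hδc) / 2
    have e₂ : α * (U * Real.sqrt D) = α ^ 2 + 1 := by
      linear_combination -(α * hα + hαc) / 2
    have : (s : ℝ) < U := by
      by_contra! h
      have h₁ : (U : ℝ) * Real.sqrt D ≤ s * Real.sqrt D := mul_le_mul_of_nonneg_right h hw.le
      have h₂ := mul_le_mul_of_nonneg_left h₁ (mul_pos hδ0 hα0).le
      nlinarith [mul_pos (sub_pos.2 hup) (sub_pos.2 hlow)]
    exact_mod_cast this
  rcases lt_trichotomy r 0 with hr | rfl | hr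
  · exact absurd (hmin (-r) s (by linarith) hs0 (by linarith)) (by linarith)
  · have h4 : D * s ^ 2 = 4 := by linarith
    have hs2 : s ≤ 2 := by nlinarith
    have hss : s = 1 ∨ s = 2 := by omega
    rcases hss with rfl | rfl
    · exact hsq ⟨2, by linarith⟩
    · exact hsq ⟨1, by linarith⟩
  · exact absurd (hmin r s hr hs0 (by linarith)) (by linarith)

end IsHalfIntegralOfNorm

theorem exists_least_pos_solution_neg_four {D : ℤ} (hsq : ¬ IsSquare D)
    (hpell : ∃ x y : ℤ, x ^ 2 - D * y ^ 2 = -1) :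
    ∃ T U : ℤ, 0 < T ∧ 0 < U ∧ T ^ 2 - D * U ^ 2 = -4 ∧
      ∀ T' U' : ℤ, 0 < T' → 0 < U' → T' ^ 2 - D * U' ^ 2 = -4 → U ≤ U' := by
  obtain ⟨x, y, h⟩ := hpell
  have hy : y ≠ 0 := by rintro rfl; nlinarith [sq_nonneg x]
  have hx : x ≠ 0 := by
    rintro rfl
    have hy2 : IsUnit (y ^ 2) := IsUnit.of_mul_eq_one D (by linarith)
    have hy1 : y ^ 2 = 1 := (Int.isUnit_iff.1 hy2).resolve_right (by nlinarith [sq_nonneg y])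
    exact hsq ⟨1, by rw [hy1] at h; linarith⟩
  obtain ⟨U, ⟨hU, T, hT, hTU⟩, hmin⟩ := Int.exists_least_of_bdd
    (P := fun U ↦ 0 < U ∧ ∃ T : ℤ, 0 < T ∧ T ^ 2 - D * U ^ 2 = -4)
    ⟨0, fun z hz ↦ hz.1.le⟩
    ⟨2 * |y|, by positivity, 2 * |x|, by positivity, by
      rw [mul_pow, mul_pow, sq_abs, sq_abs]; linarith⟩
  exact ⟨T, U, hT, hU, hTU, fun T' U' hT' hU' h' ↦ hmin U' ⟨hU', T', hT', h'⟩⟩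

/-- An odd prime power dividing `(x - c)(x + c)` divides one of the factors, unless the
prime divides both `x` and `c`. -/
theorem Int.pow_dvd_sub_or_pow_dvd_add {p : ℤ} (hp : Prime p) (hp2 : ¬ p ∣ 2) {x c : ℤ} {n : ℕ}
    (hxc : ¬ (p ∣ x ∧ p ∣ c)) (h : p ^ n ∣ (x - c) * (x + c)) :
    p ^ n ∣ x - c ∨ p ^ n ∣ x + c := by
  by_cases h₁ : p ∣ x - c
  · have h₂ : ¬ p ∣ x + c := fun h₂ ↦ by
      have hx : p ∣ 2 * x := by
        have := dvd_add h₁ h₂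
        rwa [show x - c + (x + c) = 2 * x by ring] at this
      have hc : p ∣ 2 * c := by
        have := dvd_sub h₂ h₁
        rwa [show x + c - (x - c) = 2 * c by ring] at this
      exact hxc ⟨(hp.dvd_or_dvd hx).resolve_left hp2, (hp.dvd_or_dvd hc).resolve_left hp2⟩
    exact .inl (hp.pow_dvd_of_dvd_mul_right n h₂ h)
  · exact .inr (hp.pow_dvd_of_dvd_mul_left n h₁ h)

/-- A power of two dividing `(x - c)(x + c)` with `x, c` odd divides the double of one of
the factors. -/
theorem Int.two_pow_dvd_two_mul_sub_or_add {x c : ℤ} {n : ℕ} (hx : Odd x) (hc : Odd c)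
    (h : 2 ^ n ∣ (x - c) * (x + c)) : 2 ^ n ∣ 2 * (x - c) ∨ 2 ^ n ∣ 2 * (x + c) := by
  obtain ⟨r, hr⟩ := hx.sub_odd hc
  obtain ⟨s, hs⟩ := hx.add_odd hc
  have hodd : Odd (r + s) := by
    have : r + s = x := by omega
    rwa [this]
  have e : (x - c) * (x + c) = 4 * (r * s) := by rw [hr, hs]; ring
  rw [e] at h
  rcases Int.even_or_odd r with hre | hro
  · left
    have hso : ¬ (2 : ℤ) ∣ s := by
      rw [← even_iff_two_dvd, Int.not_even_iff_odd]
      exact (Int.odd_add'.1 hodd).2 hre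
    have h' := Int.prime_two.pow_dvd_of_dvd_mul_right n hso (a := 4 * r)
      (by rwa [mul_assoc])
    rwa [hr, show 2 * (r + r) = 4 * r by ring]
  · right
    have hro' : ¬ (2 : ℤ) ∣ r := by
      rwa [← even_iff_two_dvd, Int.not_even_iff_odd]
    have h' := Int.prime_two.pow_dvd_of_dvd_mul_left n hro' (b := 4 * s)
      (by rwa [mul_left_comm])
    rwa [hs, show 2 * (s + s) = 4 * s by ring]

theorem sq_dvd_two_mul_sub_or_add {a b : ℤ} {m p : ℕ} (hm : 0 < m) (hp : p.Prime)
    (hb : b = (p : ℤ) ^ m ∨ b = 2 * (p : ℤ) ^ m) (hab : IsCoprime a b) {x y : ℤ}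
    (hxy : IsCoprime x y) (h : x ^ 2 - (a ^ 2 + b ^ 2) * y ^ 2 = -b ^ 2) :
    b ^ 2 ∣ 2 * (x - a * y) ∨ b ^ 2 ∣ 2 * (x + a * y) := by
  have hprod : b ^ 2 ∣ (x - a * y) * (x + a * y) := ⟨y ^ 2 - 1, by linear_combination h⟩
  have hbodd : Even b → Odd x ∧ Odd (a * y) := by
    intro hbe
    have hao : Odd a := by
      rw [← Int.not_even_iff_odd, even_iff_two_dvd]
      exact fun h2 ↦ Int.prime_two.not_isUnit (hab.isUnit_of_dvd' h2 (even_iff_two_dvd.1 hbe))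
    have hpar : Even x ↔ Even y := by
      have h0 : Even (x ^ 2 - (a ^ 2 + b ^ 2) * y ^ 2) := by
        rw [h]; simpa [Int.even_pow] using hbe
      have hae : ¬ Even a := Int.not_even_iff_odd.2 hao
      simpa [Int.even_sub, Int.even_mul, Int.even_add, Int.even_pow, hbe, hae] using h0
    have hx : Odd x := by
      rw [← Int.not_even_iff_odd]
      exact fun hx ↦ Int.prime_two.not_isUnit (hxy.isUnit_of_dvd' (even_iff_two_dvd.1 hx)
        (even_iff_two_dvd.1 (hpar.1 hx)))
    refine ⟨hx, hao.mul ?_⟩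
    rw [← Int.not_even_iff_odd] at hx ⊢
    exact fun hy ↦ hx (hpar.2 hy)
  by_cases hp2 : p = 2
  · subst hp2
    obtain ⟨n, hn, hbn⟩ : ∃ n, n ≠ 0 ∧ b = 2 ^ n := by
      rcases hb with rfl | rfl
      · exact ⟨m, hm.ne', by norm_num⟩
      · exact ⟨m + 1, by omega, by rw [pow_succ']; norm_num⟩
    obtain ⟨hx, hc⟩ := hbodd (hbn ▸ (even_two.pow_of_ne_zero hn))
    rw [hbn, ← pow_mul] at hprod ⊢
    exact Int.two_pow_dvd_two_mul_sub_or_add hx hc hprod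
  · have hpZ : Prime (p : ℤ) := Nat.prime_iff_prime_int.1 hp
    have hpodd : Odd p := hp.odd_of_ne_two hp2
    have hpn2 : ¬ (p : ℤ) ∣ 2 := fun hd ↦
      hp2 ((Nat.prime_dvd_prime_iff_eq hp Nat.prime_two).1 (by exact_mod_cast hd))
    have hpmb : (p : ℤ) ^ m ∣ b := by
      rcases hb with rfl | rfl
      · exact dvd_rfl
      · exact dvd_mul_left _ _
    have hpb : (p : ℤ) ∣ b := (dvd_pow_self _ hm.ne').trans hpmb
    have hxc : ¬ ((p : ℤ) ∣ x ∧ (p : ℤ) ∣ a * y) := fun ⟨h₁, h₂⟩ ↦ by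
      rcases hpZ.dvd_or_dvd h₂ with h₂ | h₂
      · exact hpZ.not_isUnit (hab.isUnit_of_dvd' h₂ hpb)
      · exact hpZ.not_isUnit (hxy.isUnit_of_dvd' h₁ h₂)
    have hpp : (p : ℤ) ^ (m * 2) ∣ (x - a * y) * (x + a * y) :=
      (pow_mul (p : ℤ) m 2 ▸ pow_dvd_pow_of_dvd hpmb 2).trans hprod
    have key := Int.pow_dvd_sub_or_pow_dvd_add hpZ hpn2 hxc hpp
    rcases hb with hb | hb
    · rw [hb, ← pow_mul]
      exact key.imp (fun h ↦ h.mul_left 2) (fun h ↦ h.mul_left 2)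
    · obtain ⟨hx, hc⟩ := hbodd ⟨(p : ℤ) ^ m, by rw [hb]; ring⟩
      have hcop : IsCoprime (2 : ℤ) ((p : ℤ) ^ (m * 2)) := by
        refine IsCoprime.pow_right ?_
        exact_mod_cast Nat.isCoprime_iff_coprime.2 (Nat.coprime_two_left.2 hpodd)
      have up : ∀ w : ℤ, Even w → (p : ℤ) ^ (m * 2) ∣ w → b ^ 2 ∣ 2 * w := fun w he hd ↦ by
        have := mul_dvd_mul_left 2 (hcop.mul_dvd (even_iff_two_dvd.1 he) hd)
        rwa [hb, show (2 * (p : ℤ) ^ m) ^ 2 = 2 * (2 * (p : ℤ) ^ (m * 2)) by ring]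
      exact key.imp (up _ (hx.sub_odd hc)) (up _ (hx.add_odd hc))

/-- Lemma 3.1: Let `a, m` be positive integers and `p` a prime, and let `b = p^m` or
`b = 2·p^m`. Suppose `gcd(a, b) = 1`, `D = a² + b²` is not a perfect square, and the
negative Pell equation `x² − D·y² = −1` has an integer solution. Then `D` satisfies
the one-family condition with respect to `a` and `b`. -/
theorem one_family_of_prime_power
    (a : ℤ) (m p : ℕ) (ha : 0 < a) (hm : 0 < m) (hp : p.Prime)
    (b : ℤ) (hb : b = (p : ℤ) ^ m ∨ b = 2 * (p : ℤ) ^ m)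
    (hab : IsCoprime a b)
    (hnotsq : ¬ IsSquare (a ^ 2 + b ^ 2))
    (hpell : ∃ x y : ℤ, x ^ 2 - (a ^ 2 + b ^ 2) * y ^ 2 = -1) :
    OneFamilyCondition a b := by
  obtain ⟨T, U, hT, hU, hTU, hmin⟩ := exists_least_pos_solution_neg_four hnotsq hpell
  refine ⟨T, U, hT, hU, hTU, hmin, fun x y hxy h ↦ ?_⟩
  have hb0 : b ≠ 0 := by
    have hp0 : (p : ℤ) ≠ 0 := by exact_mod_cast hp.ne_zero
    rcases hb with rfl | rfl <;> positivity
  have hD : 0 < a ^ 2 + b ^ 2 := by positivity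
  obtain ⟨ε, hε, u, hu⟩ : ∃ ε : ℤ, (ε = 1 ∨ ε = -1) ∧ b ^ 2 ∣ 2 * (x - ε * a * y) := by
    rcases sq_dvd_two_mul_sub_or_add hm hp hb hab hxy h with h | h
    · exact ⟨1, .inl rfl, by simpa using h⟩
    · exact ⟨-1, .inr rfl, by simpa using h⟩
  have hε2 : ε ^ 2 = 1 := by rcases hε with rfl | rfl <;> norm_num
  have hcast : (a : ℝ) ^ 2 + (b : ℝ) ^ 2 = ((a ^ 2 + b ^ 2 : ℤ) : ℝ) := by push_cast; rfl
  rw [hcast]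
  obtain ⟨w, hwdef⟩ : ∃ w, w = Real.sqrt ((a ^ 2 + b ^ 2 : ℤ) : ℝ) := ⟨_, rfl⟩
  have hw : w ^ 2 = (a : ℝ) ^ 2 + (b : ℝ) ^ 2 := by
    rw [hwdef, hcast]; exact Real.sq_sqrt (by exact_mod_cast hD.le)
  have hw0 : 0 < w := hwdef ▸ Real.sqrt_pos.2 (by exact_mod_cast hD)
  obtain ⟨β, hβ⟩ : ∃ β : ℝ, 2 * β = ((2 * y - ε * a * u : ℤ) : ℝ) + u * w :=
    ⟨_, mul_div_cancel₀ _ two_ne_zero⟩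
  have hnorm : (2 * y - ε * a * u) ^ 2 - (a ^ 2 + b ^ 2) * u ^ 2 = 4 * 1 := by
    refine mul_left_cancel₀ (pow_ne_zero 2 hb0) ?_
    linear_combination (b ^ 2 * a ^ 2 * u ^ 2 + 4 * a ^ 2 * y ^ 2) * hε2 - 4 * h +
      (2 * (x + ε * a * y) + b ^ 2 * u) * hu
  have hβH : IsHalfIntegralOfNorm (a ^ 2 + b ^ 2) 1 β := ⟨_, u, hnorm, by rw [hβ, hwdef]⟩
  have hβ0 : β ≠ 0 := by
    rintro rfl
    have := IsHalfIntegralOfNorm.mul_conj hD.le hnorm (by rw [hβ, hwdef])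
    norm_num at this
  have hprod : (x : ℝ) + y * w = (ε * a + w) * β := by
    have hu' : (2 * (x - ε * a * y) : ℝ) = b ^ 2 * u := by exact_mod_cast hu
    have hε2' : (ε : ℝ) ^ 2 = 1 := by exact_mod_cast hε2
    push_cast at hβ
    linear_combination (-(ε * a + w) * hβ + hu' - u * hw + a ^ 2 * u * hε2') / 2
  rw [← hwdef]
  have hα : 2 * ((T + U * w) / 2 : ℝ) =
      T + U * Real.sqrt ((a ^ 2 + b ^ 2 : ℤ) : ℝ) := by rw [← hwdef]; ring
  have hα0 : 0 < ((T + U * w) / 2 : ℝ) := by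
    have hT' : (0 : ℝ) < T := by exact_mod_cast hT
    have hU' : (0 : ℝ) < U := by exact_mod_cast hU
    positivity
  rcases lt_or_gt_of_ne hβ0 with hneg | hpos
  · obtain ⟨k, hk⟩ := hβH.neg.eq_zpow_of_pos hD hnotsq hT hTU hmin hα hα0 (neg_pos.2 hneg)
    refine ⟨k, -1, ε, .inr rfl, hε, ?_⟩
    rw [hprod, ← hk]; push_cast; ring
  · obtain ⟨k, hk⟩ := hβH.eq_zpow_of_pos hD hnotsq hT hTU hmin hα hα0 hpos
    refine ⟨k, 1, ε, .inl rfl, hε, ?_⟩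
    rw [hprod, ← hk]; push_cast; ring
end

section
/- Let a and b be relatively prime positive integers such that D = a² + b² is not a perfect square. Suppose D satisfies the one-family condition with respect to a and b, and suppose the negative Pell equation x² − D·y² = −1 has an integer solution. If (X, Y) is a pair of positive integers with gcd(X, Y) = 1, (X, Y) ≠ (a, 1), and X² − D·Y⁴ = −b², then there exist integers r, s with gcd(r, s) = 1 and s > r > 0, and signs ε₁, ε₂, ε₃ ∈ {1, −1}, such that in the Gaussian integers ε₁·X + ε₂·b·i = (a + b·i)·(r + ε₃·s·i)⁴ and Y = r² + s². -/
/-- Powers of a real number of the form `(t + u√D)/2` with `t² - Du² = -4` are again half-integral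
combinations of `1` and `√D`, of norm `±1`. -/
theorem exists_half_integral_pow {D T U : ℤ} {d : ℝ} (hd : d ^ 2 = D)
    (h : T ^ 2 - D * U ^ 2 = -4) (n : ℕ) :
    ∃ p q : ℤ, (((T : ℝ) + U * d) / 2) ^ n = (p + q * d) / 2 ∧
      (p ^ 2 - D * q ^ 2 = 4 ∨ p ^ 2 - D * q ^ 2 = -4) := by
  induction n with
  | zero => exact ⟨2, 0, by norm_num, by norm_num⟩
  | succ n ih =>
    obtain ⟨p, q, hpow, hnorm⟩ := ih
    have parity : ∀ x y : ℤ, (x ^ 2 - D * y ^ 2 = 4 ∨ x ^ 2 - D * y ^ 2 = -4) →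
        (Even x ↔ Even D ∨ Even y) := by
      intro x y hxy
      have he : Even (x ^ 2 - D * y ^ 2) := by
        rcases hxy with hxy | hxy <;> rw [hxy] <;> decide
      simpa [parity_simps] using he
    have hpq := parity p q hnorm
    have hTU := parity T U (Or.inr h)
    obtain ⟨p', hp'⟩ : (2 : ℤ) ∣ p * T + D * q * U := by
      rw [← even_iff_two_dvd]
      simp only [parity_simps]
      tauto
    obtain ⟨q', hq'⟩ : (2 : ℤ) ∣ p * U + q * T := by
      rw [← even_iff_two_dvd]
      simp only [parity_simps]
      tauto
    refine ⟨p', q', ?_, ?_⟩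
    · have hp'' : (p : ℝ) * T + D * q * U = 2 * p' := by exact_mod_cast hp'
      have hq'' : (p : ℝ) * U + q * T = 2 * q' := by exact_mod_cast hq'
      rw [pow_succ, hpow]
      linear_combination (q * U / 4 : ℝ) * hd + hp'' / 4 + d * hq'' / 4
    · have hmul : 4 * (p' ^ 2 - D * q' ^ 2) = (p ^ 2 - D * q ^ 2) * (T ^ 2 - D * U ^ 2) := by
        linear_combination -(p * T + D * q * U + 2 * p') * hp' + D * (p * U + q * T + 2 * q') * hq'
      rw [h] at hmul
      rcases hnorm with hnorm | hnorm <;> rw [hnorm] at hmul <;> omega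

theorem exists_half_integral_zpow {D T U : ℤ} {d : ℝ} (hd : d ^ 2 = D)
    (h : T ^ 2 - D * U ^ 2 = -4) (k : ℤ) :
    ∃ p q : ℤ, (((T : ℝ) + U * d) / 2) ^ k = (p + q * d) / 2 ∧
      (p ^ 2 - D * q ^ 2 = 4 ∨ p ^ 2 - D * q ^ 2 = -4) := by
  obtain ⟨n, rfl | rfl⟩ := k.eq_nat_or_neg
  · simpa only [zpow_natCast] using exists_half_integral_pow hd h n
  · have hinv : (((T : ℝ) + U * d) / 2)⁻¹ = (((-T : ℤ) : ℝ) + U * d) / 2 := by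
      have h' : (T : ℝ) ^ 2 - D * U ^ 2 = -4 := by exact_mod_cast h
      apply inv_eq_of_mul_eq_one_right
      push_cast
      linear_combination (U ^ 2 / 4 : ℝ) * hd - h' / 4
    obtain ⟨p, q, hpq⟩ := exists_half_integral_pow (T := -T) (U := U) hd (by rw [← h]; ring) n
    exact ⟨p, q, by rw [zpow_neg, zpow_natCast, ← inv_pow, hinv]; exact hpq.1, hpq.2⟩

theorem intCast_add_mul_sqrt_inj {D : ℤ} (hD : 0 ≤ D) (hns : ¬ IsSquare D) {x y z w : ℤ}
    (h : (x : ℝ) + y * √(D : ℝ) = z + w * √(D : ℝ)) : x = z ∧ y = w := by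
  have hirr : Irrational √(D : ℝ) := irrational_sqrt_intCast_iff.2 ⟨hns, hD⟩
  have hyw : y = w := by
    by_contra hne
    have hne' : y - w ≠ 0 := sub_ne_zero.2 hne
    refine (hirr.intCast_mul hne').ne_int (z - x) ?_
    push_cast
    linear_combination h
  subst hyw
  exact ⟨by exact_mod_cast add_right_cancel h, rfl⟩

/-- If a sum of two squares is divisible by `4`, both terms are even. -/
theorem even_and_even_of_sq_add_sq_eq {x y z : ℤ} (h : x ^ 2 + y ^ 2 = 4 * z) :
    2 ∣ x ∧ 2 ∣ y := by
  rcases Int.even_or_odd' x with ⟨u, rfl | rfl⟩ <;> rcases Int.even_or_odd' y with ⟨v, rfl | rfl⟩ <;>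
    ring_nf at h <;> omega

/-- Up to sign, the fourth power of a Gaussian integer depends only on the absolute values of its
coordinates, in either order. -/
theorem exists_ordered_coords {u v : ℤ} (huv : IsCoprime u v) (hu : u ≠ 0) (hv : v ≠ 0)
    (hpar : u % 2 ≠ v % 2) :
    ∃ r s η : ℤ, IsCoprime r s ∧ 0 < r ∧ r < s ∧ (η = 1 ∨ η = -1) ∧
      r ^ 2 + s ^ 2 = u ^ 2 + v ^ 2 ∧ (r * s) ^ 2 = (u * v) ^ 2 ∧
      r * s * (r ^ 2 - s ^ 2) = η * (u * v * (u ^ 2 - v ^ 2)) := by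
  have hne : |u| ≠ |v| := by
    intro h
    rcases abs_eq_abs.1 h with h | h <;> omega
  have hcop : IsCoprime |u| |v| := huv.abs_abs
  have key : |u| * |v| = u * v ∨ |u| * |v| = -(u * v) := by
    rw [← abs_mul]; exact abs_choice _
  have hsq : (|u| * |v|) ^ 2 = (u * v) ^ 2 := by rw [mul_pow, sq_abs, sq_abs, mul_pow]
  rcases hne.lt_or_gt with hlt | hlt <;> rcases key with key | key
  · exact ⟨|u|, |v|, 1, hcop, abs_pos.2 hu, hlt, Or.inl rfl, by simp, hsq, by
      rw [key, sq_abs, sq_abs]; ring⟩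
  · exact ⟨|u|, |v|, -1, hcop, abs_pos.2 hu, hlt, Or.inr rfl, by simp, hsq, by
      rw [key, sq_abs, sq_abs]; ring⟩
  · exact ⟨|v|, |u|, -1, hcop.symm, abs_pos.2 hv, hlt, Or.inr rfl, by simp [add_comm],
      by rw [mul_comm, hsq], by rw [mul_comm |v|, key, sq_abs, sq_abs]; ring⟩
  · exact ⟨|v|, |u|, 1, hcop.symm, abs_pos.2 hv, hlt, Or.inl rfl, by simp [add_comm],
      by rw [mul_comm, hsq], by rw [mul_comm |v|, key, sq_abs, sq_abs]; ring⟩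

/-- Under the one-family condition, `X + b·i` is, up to signs, of the form `(a - b·i)·(m + n·i)²`
with `m + n·i` of absolute value `Y`. -/
theorem OneFamilyCondition.exists_sq_representation {a b X Y : ℤ} (h : OneFamilyCondition a b)
    (hnotsq : ¬ IsSquare (a ^ 2 + b ^ 2)) (hY : 0 < Y) (hXY : IsCoprime X Y)
    (heq : X ^ 2 - (a ^ 2 + b ^ 2) * Y ^ 4 = -b ^ 2) :
    ∃ m n δ₁ δ₂ : ℤ, (δ₁ = 1 ∨ δ₁ = -1) ∧ (δ₂ = 1 ∨ δ₂ = -1) ∧ m ^ 2 + n ^ 2 = Y ^ 2 ∧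
      a * (m ^ 2 - n ^ 2) + 2 * b * m * n = δ₁ * X ∧
      2 * a * m * n - b * (m ^ 2 - n ^ 2) = δ₂ * b := by
  obtain ⟨T, U, -, -, hTU, -, hfam⟩ := h
  obtain ⟨k, ε₁, ε₂, hε₁, hε₂, hxy⟩ := hfam X (Y ^ 2) hXY.pow_right (by rw [← heq]; ring)
  have hD : 0 ≤ a ^ 2 + b ^ 2 := by positivity
  have hcast : (a : ℝ) ^ 2 + (b : ℝ) ^ 2 = ((a ^ 2 + b ^ 2 : ℤ) : ℝ) := by push_cast; rfl
  rw [hcast] at hxy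
  have hd : √((a ^ 2 + b ^ 2 : ℤ) : ℝ) ^ 2 = ((a ^ 2 + b ^ 2 : ℤ) : ℝ) :=
    Real.sq_sqrt (by exact_mod_cast hD)
  obtain ⟨p, q, hpow, hnorm⟩ := exists_half_integral_zpow hd hTU k
  rw [mul_comm 2 k, zpow_mul, hpow] at hxy
  have hε₂sq : ε₂ ^ 2 = 1 := by rcases hε₂ with rfl | rfl <;> norm_num
  obtain ⟨h₁, h₂⟩ := intCast_add_mul_sqrt_inj (x := 4 * X) (y := 4 * Y ^ 2)
    (z := ε₁ * (ε₂ * a * (p ^ 2 + (a ^ 2 + b ^ 2) * q ^ 2) + 2 * (a ^ 2 + b ^ 2) * p * q))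
    (w := ε₁ * (p ^ 2 + (a ^ 2 + b ^ 2) * q ^ 2 + 2 * ε₂ * a * p * q)) hD hnotsq (by
      generalize √((a ^ 2 + b ^ 2 : ℤ) : ℝ) = d at hd hxy
      push_cast at hd hxy ⊢
      norm_cast at hxy
      push_cast at hxy
      linear_combination 4 * hxy +
        (ε₁ * (ε₂ * a * q ^ 2 + d * q ^ 2 + 2 * p * q) : ℝ) * hd)
  have hY2 : 0 < Y ^ 2 := by positivity
  have hε₁' : ε₁ = 1 := by
    rcases hε₁ with rfl | rfl
    · rfl
    · have : 4 * Y ^ 2 = -((p + ε₂ * a * q) ^ 2 + (b * q) ^ 2) := by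
        linear_combination h₂ + a ^ 2 * q ^ 2 * hε₂sq
      nlinarith [sq_nonneg (p + ε₂ * a * q), sq_nonneg (b * q)]
  subst hε₁'
  have hsum : (p + a * (ε₂ * q)) ^ 2 + (b * (ε₂ * q)) ^ 2 = 4 * Y ^ 2 := by
    linear_combination -h₂ + (a ^ 2 + b ^ 2) * q ^ 2 * hε₂sq
  obtain ⟨⟨m, hm⟩, ⟨n, hn⟩⟩ := even_and_even_of_sq_add_sq_eq hsum
  have hsqdiff : 4 * (m ^ 2 - n ^ 2) = (p + a * (ε₂ * q)) ^ 2 - (b * (ε₂ * q)) ^ 2 := by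
    rw [hm, hn]; ring
  have hprod : 4 * (m * n) = (p + a * (ε₂ * q)) * (b * (ε₂ * q)) := by rw [hm, hn]; ring
  have hre : a * (m ^ 2 - n ^ 2) + 2 * b * m * n = ε₂ * X := by
    apply mul_left_cancel₀ (show (4 : ℤ) ≠ 0 by norm_num)
    linear_combination a * hsqdiff + 2 * b * hprod - ε₂ * h₁ - a * p ^ 2 * hε₂sq
  have him : 4 * (2 * a * m * n - b * (m ^ 2 - n ^ 2)) =
      -b * (p ^ 2 - (a ^ 2 + b ^ 2) * q ^ 2) := by
    linear_combination 2 * a * hprod - b * hsqdiff + b * (a ^ 2 + b ^ 2) * q ^ 2 * hε₂sq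
  have hmn : m ^ 2 + n ^ 2 = Y ^ 2 := by
    rw [hm, hn] at hsum
    linarith
  rcases hnorm with hnorm | hnorm <;> rw [hnorm] at him
  · exact ⟨m, n, ε₂, -1, hε₂, Or.inr rfl, hmn, hre, by linarith⟩
  · exact ⟨m, n, ε₂, 1, hε₂, Or.inl rfl, hmn, hre, by linarith⟩

/-- Lemma 3.2aa: Let `a` and `b` be relatively prime positive integers such that
`D = a² + b²` is not a perfect square, suppose `D` satisfies the one-family condition
with respect to `a` and `b`, and the negative Pell equation `x² − D·y² = −1` has an
integer solution. If `(X, Y) ≠ (a, 1)` is a coprime positive integer solution to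
`X² − D·Y⁴ = −b²`, then `±X ± b·i = (a + b·i)·(r ± s·i)⁴` and `Y = r² + s²` for some
coprime integers `r, s` with `s > r > 0`. -/
theorem solution_gaussian_representation
    (a b : ℤ) (ha : 0 < a) (hb : 0 < b) (hab : IsCoprime a b)
    (hnotsq : ¬ IsSquare (a ^ 2 + b ^ 2))
    (hofc : OneFamilyCondition a b)
    (hpell : ∃ x y : ℤ, x ^ 2 - (a ^ 2 + b ^ 2) * y ^ 2 = -1)
    (X Y : ℤ) (hX : 0 < X) (hY : 0 < Y) (hXY : IsCoprime X Y)
    (hne : (X, Y) ≠ (a, 1))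
    (heq : X ^ 2 - (a ^ 2 + b ^ 2) * Y ^ 4 = -b ^ 2) :
    ∃ (r s ε₁ ε₂ ε₃ : ℤ), IsCoprime r s ∧ 0 < r ∧ r < s ∧
      (ε₁ = 1 ∨ ε₁ = -1) ∧ (ε₂ = 1 ∨ ε₂ = -1) ∧ (ε₃ = 1 ∨ ε₃ = -1) ∧
      (⟨ε₁ * X, ε₂ * b⟩ : GaussianInt) = (⟨a, b⟩ : GaussianInt) *
        (⟨r, ε₃ * s⟩ : GaussianInt) ^ 4 ∧
      Y = r ^ 2 + s ^ 2 := by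
  obtain ⟨m, n, δ₁, δ₂, hδ₁, hδ₂, hmn, hre, him⟩ :=
    hofc.exists_sq_representation hnotsq hY hXY heq
  have sq_one : ∀ {ε : ℤ}, ε = 1 ∨ ε = -1 → ε ^ 2 = 1 := by
    rintro ε (rfl | rfl) <;> norm_num
  have hcop : Int.gcd m n = 1 := by
    have hmY : ((Int.gcd m n : ℕ) : ℤ) ∣ Y := by
      rw [← Int.pow_dvd_pow_iff two_ne_zero, ← hmn]
      exact dvd_add (pow_dvd_pow_of_dvd (Int.gcd_dvd_left ..) 2)
        (pow_dvd_pow_of_dvd (Int.gcd_dvd_right ..) 2)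
    have hmX : ((Int.gcd m n : ℕ) : ℤ) ∣ X := by
      have hX' : X = δ₁ * (m * (a * m + 2 * b * n) - n * (a * n)) := by
        linear_combination -δ₁ * hre - X * sq_one hδ₁
      rw [hX']
      exact ((((Int.gcd_dvd_left ..).mul_right _).sub
        ((Int.gcd_dvd_right ..).mul_right _))).mul_left _
    have := Int.isUnit_iff.1 (hXY.isUnit_of_dvd' hmX hmY)
    omega
  have hpyth : PythagoreanTriple m n Y := by
    unfold PythagoreanTriple
    linear_combination hmn
  obtain ⟨u, v, hform, hYuv, huv, hpar⟩ :=
    PythagoreanTriple.coprime_classification.1 ⟨hpyth, hcop⟩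
  have hYuv : Y = u ^ 2 + v ^ 2 := by
    rcases hYuv with h | h
    · exact h
    · nlinarith [sq_nonneg u, sq_nonneg v]
  have hpq : ∃ σ : ℤ, (σ = 1 ∨ σ = -1) ∧
      m ^ 2 - n ^ 2 = σ * ((u ^ 2 + v ^ 2) ^ 2 - 8 * (u * v) ^ 2) ∧
      m * n = 2 * (u * v * (u ^ 2 - v ^ 2)) := by
    rcases hform with ⟨rfl, rfl⟩ | ⟨rfl, rfl⟩
    · exact ⟨1, Or.inl rfl, by ring, by ring⟩
    · exact ⟨-1, Or.inr rfl, by ring, by ring⟩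
  obtain ⟨σ, hσ, hdiff, hprod⟩ := hpq
  have huv0 : u * v ≠ 0 := by
    intro h0
    have hY1 : Y = 1 := by
      have : Y * Y = 1 * 1 := by
        rcases mul_eq_zero.1 h0 with rfl | rfl
        · rw [Int.gcd_zero_left] at huv
          have : v ^ 2 = 1 := by rw [← sq_abs, Int.abs_eq_natAbs, huv]; rfl
          rw [hYuv]; linear_combination (v ^ 2 + 1) * this
        · rw [Int.gcd_zero_right] at huv
          have : u ^ 2 = 1 := by rw [← sq_abs, Int.abs_eq_natAbs, huv]; rfl
          rw [hYuv]; linear_combination (u ^ 2 + 1) * this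
      nlinarith
    subst hY1
    have hXa : X ^ 2 = a ^ 2 := by linear_combination heq
    exact hne (by rw [(pow_left_inj₀ hX.le ha.le two_ne_zero).1 hXa])
  obtain ⟨r, s, η, hrs, hr, hlt, hη, hsum, hmul, hodd⟩ := exists_ordered_coords
    (Int.isCoprime_iff_gcd_eq_one.2 huv) (left_ne_zero_of_mul huv0) (right_ne_zero_of_mul huv0)
    (by omega)
  have unit_mul : ∀ {x y : ℤ}, (x = 1 ∨ x = -1) → (y = 1 ∨ y = -1) → x * y = 1 ∨ x * y = -1 := by
    rintro x y (rfl | rfl) (rfl | rfl) <;> norm_num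
  have neg_unit : ∀ {x : ℤ}, (x = 1 ∨ x = -1) → -x = 1 ∨ -x = -1 := by
    rintro x (rfl | rfl) <;> norm_num
  have hε₃ := neg_unit (unit_mul hσ hη)
  refine ⟨r, s, σ * δ₁, -(σ * δ₂), -(σ * η), hrs, hr, hlt, unit_mul hσ hδ₁,
    neg_unit (unit_mul hσ hδ₂), hε₃, ?_, by rw [hYuv, hsum]⟩
  have hfourth : (⟨r, -(σ * η) * s⟩ : GaussianInt) ^ 4 =
      ⟨σ * (m ^ 2 - n ^ 2), -(σ * (2 * (m * n)))⟩ := by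
    have hsq := sq_one hε₃
    have hσ2 := sq_one hσ
    have hη2 := sq_one hη
    generalize hε : -(σ * η) = ε at hsq
    have hre4 : σ * (m ^ 2 - n ^ 2) = r ^ 4 - 6 * r ^ 2 * s ^ 2 + s ^ 4 := by
      rw [hdiff, ← hsum, ← hmul]
      linear_combination ((r ^ 2 + s ^ 2) ^ 2 - 8 * (r * s) ^ 2) * hσ2
    have him4 : -(σ * (2 * (m * n))) = 4 * ε * (r * s * (r ^ 2 - s ^ 2)) := by
      rw [hprod, hodd, ← hε]
      linear_combination 4 * σ * (u * v * (u ^ 2 - v ^ 2)) * hη2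
    rw [hre4, him4]
    ext
    · simp only [pow_succ, pow_zero, one_mul, Zsqrtd.re_mul, Zsqrtd.im_mul]
      linear_combination (-6 * r ^ 2 * s ^ 2 + (ε ^ 2 + 1) * s ^ 4) * hsq
    · simp only [pow_succ, pow_zero, one_mul, Zsqrtd.re_mul, Zsqrtd.im_mul]
      linear_combination -4 * ε * r * s ^ 3 * hsq
  rw [hfourth]
  ext
  · simp only [Zsqrtd.re_mul]
    linear_combination -σ * hre
  · simp only [Zsqrtd.im_mul]
    linear_combination σ * him
end

section
/- Let a and b be relatively prime positive integers, and let (X, Y) be a pair of positive integers with gcd(X, Y) = 1, Y > 1, and X² − (a² + b²)·Y⁴ = −b². Then every prime divisor q of Y satisfies q ≡ 1 (mod 4). Consequently Y ≥ 5, and if Y > 5 then Y ≥ 13. -/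
/-- A prime `q` with `q ∣ x ^ 2 + y ^ 2` and `q ∤ x` is not `3` modulo `4`. -/
theorem mod_four_ne_three_of_dvd_sq_add_sq {q : ℕ} (hq : q.Prime) {x y : ℤ}
    (hx : ¬ (q : ℤ) ∣ x) (h : (q : ℤ) ∣ x ^ 2 + y ^ 2) : q % 4 ≠ 3 := by
  have : Fact q.Prime := ⟨hq⟩
  have hx' : (x : ZMod q) ≠ 0 := by rwa [Ne, ZMod.intCast_zmod_eq_zero_iff_dvd]
  have h' := (ZMod.intCast_zmod_eq_zero_iff_dvd _ q).2 h
  push_cast at h'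
  exact ZMod.mod_four_ne_three_of_sq_eq_neg_sq' hx' (by linear_combination h' : (y : ZMod q) ^ 2 = _)

/-- If `4 ∣ x ^ 2 + y ^ 2` then `x` is even. -/
theorem two_dvd_of_four_dvd_sq_add_sq {x y : ℤ} (h : 4 ∣ x ^ 2 + y ^ 2) : 2 ∣ x := by
  by_contra hx
  have hx1 := Int.sq_mod_four_eq_one_of_odd (Int.not_even_iff_odd.1 (mt Even.two_dvd hx))
  rcases Int.even_or_odd y with ⟨k, rfl⟩ | hy
  · ring_nf at h hx1
    omega
  · have := Int.sq_mod_four_eq_one_of_odd hy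
    omega

/-- Lemma 3.4(a): Let `a` and `b` be relatively prime positive integers and `(X, Y)` a
coprime positive integer solution of `X² − (a² + b²)·Y⁴ = −b²` with `Y > 1`. Then every
prime divisor `q` of `Y` satisfies `q ≡ 1 (mod 4)`; consequently `Y ≥ 5`, and if
`Y > 5` then `Y ≥ 13`. -/
theorem prime_divisors_of_Y
    (a b X Y : ℤ) (ha : 0 < a) (hb : 0 < b) (hab : IsCoprime a b)
    (hX : 0 < X) (hY : 1 < Y) (hXY : IsCoprime X Y)
    (heq : X ^ 2 - (a ^ 2 + b ^ 2) * Y ^ 4 = -b ^ 2) :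
    (∀ q : ℕ, q.Prime → (q : ℤ) ∣ Y → q % 4 = 1) ∧
      5 ≤ Y ∧ (5 < Y → 13 ≤ Y) := by
  have hsum : X ^ 2 + b ^ 2 = (a ^ 2 + b ^ 2) * Y ^ 4 := by linear_combination heq
  have hmod : ∀ q : ℕ, q.Prime → (q : ℤ) ∣ Y → q % 4 = 1 := by
    intro q hq hqY
    have hqX : ¬ (q : ℤ) ∣ X := fun h =>
      (Nat.prime_iff_prime_int.1 hq).not_isUnit (hXY.isUnit_of_dvd' h hqY)
    have hdvd : (q : ℤ) ^ 2 ∣ X ^ 2 + b ^ 2 := hsum ▸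
      ((pow_dvd_pow_of_dvd hqY 2).trans (pow_dvd_pow Y (by norm_num))).mul_left _
    have h3 := mod_four_ne_three_of_dvd_sq_add_sq hq hqX ((dvd_pow_self _ two_ne_zero).trans hdvd)
    rcases hq.eq_two_or_odd with rfl | hodd
    · exact absurd (two_dvd_of_four_dvd_sq_add_sq (by simpa using hdvd)) hqX
    · omega
  have h2 : ¬ (2 : ℤ) ∣ Y := fun h => by simpa using hmod 2 Nat.prime_two h
  have h3 : ¬ (3 : ℤ) ∣ Y := fun h => by simpa using hmod 3 Nat.prime_three h
  have h7 : ¬ (7 : ℤ) ∣ Y := fun h => by simpa using hmod 7 (by norm_num) h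
  have h11 : ¬ (11 : ℤ) ∣ Y := fun h => by simpa using hmod 11 (by norm_num) h
  refine ⟨hmod, by omega, fun h5 => ?_⟩
  by_contra! h13
  interval_cases Y <;> omega
end

section
/- Let a and b be relatively prime positive integers such that D = a² + b² is not a perfect square, suppose the negative Pell equation x² − D·y² = −1 has an integer solution, and suppose D satisfies the one-family condition with respect to a and b. If (X, Y) is a pair of positive integers with gcd(X, Y) = 1, Y > 1, and X² − D·Y⁴ = −b², then Y > b/2. -/
/-- An equality `p + q * s = p' + q' * s` with `s` irrational determines the coefficient of `s`. -/
lemma Irrational.coeff_eq {s : ℝ} (hs : Irrational s) {p q p' q' : ℤ}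
    (h : (p : ℝ) + q * s = p' + q' * s) : q = q' := by
  by_contra hne
  refine (hs.intCast_mul (sub_ne_zero.mpr hne)).ne_int (p' - p) ?_
  push_cast
  linarith

/-- The half-integral elements `(t + u * s) / 2` of norm `± 1` are closed under multiplication. -/
lemma exists_half_mul {D : ℤ} {s : ℝ} (hs : s ^ 2 = D) {t u T U : ℤ}
    (h : t ^ 2 - D * u ^ 2 = 4 ∨ t ^ 2 - D * u ^ 2 = -4)
    (H : T ^ 2 - D * U ^ 2 = 4 ∨ T ^ 2 - D * U ^ 2 = -4) :
    ∃ t' u' : ℤ, (t' ^ 2 - D * u' ^ 2 = 4 ∨ t' ^ 2 - D * u' ^ 2 = -4) ∧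
      ((t : ℝ) + u * s) / 2 * ((T + U * s) / 2) = (t' + u' * s) / 2 := by
  have parity : ∀ x y : ℤ, (x ^ 2 - D * y ^ 2 = 4 ∨ x ^ 2 - D * y ^ 2 = -4) →
      (Even x ↔ Even (D * y)) := by
    intro x y hxy
    have he : Even (x ^ 2 - D * y ^ 2) := by
      rcases hxy with hxy | hxy <;> rw [hxy] <;> decide
    simpa [Int.even_sub, Int.even_mul, Int.even_pow] using he
  have h₁ := parity t u h
  have h₂ := parity T U H
  obtain ⟨m, hm⟩ : Even (t * T + D * (u * U)) := by
    simp only [Int.even_add, Int.even_mul] at *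
    tauto
  obtain ⟨n, hn⟩ : Even (t * U + u * T) := by
    simp only [Int.even_add, Int.even_mul] at *
    tauto
  have key : 4 * (m ^ 2 - D * n ^ 2) = (t ^ 2 - D * u ^ 2) * (T ^ 2 - D * U ^ 2) := by
    linear_combination (-(t * T + D * (u * U)) - 2 * m) * hm + D * (t * U + u * T + 2 * n) * hn
  refine ⟨m, n, ?_, ?_⟩
  · rcases h with h | h <;> rcases H with H | H <;> rw [h, H] at key <;> omega
  · have hm' : (t : ℝ) * T + D * (u * U) = m + m := by exact_mod_cast hm
    have hn' : (t : ℝ) * U + u * T = n + n := by exact_mod_cast hn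
    linear_combination (u * U / 4 : ℝ) * hs + hm' / 4 + s * hn' / 4

/-- Every power of `(T + U * s) / 2`, of norm `-1`, has the form `(t + u * s) / 2`, of norm `± 1`. -/
lemma exists_half_zpow {D : ℤ} {s : ℝ} (hs : s ^ 2 = D) {T U : ℤ}
    (H : T ^ 2 - D * U ^ 2 = -4) (k : ℤ) :
    ∃ t u : ℤ, (t ^ 2 - D * u ^ 2 = 4 ∨ t ^ 2 - D * u ^ 2 = -4) ∧
      (((T : ℝ) + U * s) / 2) ^ k = (t + u * s) / 2 := by
  have H' : (T : ℝ) ^ 2 - D * U ^ 2 = -4 := by exact_mod_cast H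
  have hinv : ((T : ℝ) + U * s) / 2 * (((-T : ℤ) + U * s) / 2) = 1 := by
    push_cast
    linear_combination (U ^ 2 / 4 : ℝ) * hs - H' / 4
  have hne : ((T : ℝ) + U * s) / 2 ≠ 0 := left_ne_zero_of_mul_eq_one hinv
  induction k with
  | zero => exact ⟨2, 0, by norm_num, by norm_num⟩
  | succ k ih =>
    obtain ⟨t, u, h, e⟩ := ih
    obtain ⟨t', u', h', e'⟩ := exists_half_mul hs h (Or.inr H)
    exact ⟨t', u', h', by rw [zpow_add_one₀ hne, e, e']⟩
  | pred k ih =>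
    obtain ⟨t, u, h, e⟩ := ih
    obtain ⟨t', u', h', e'⟩ := exists_half_mul hs h (T := -T) (U := U) (Or.inr (by rw [neg_sq, H]))
    exact ⟨t', u', h', by rw [zpow_sub_one₀ hne, e, inv_eq_of_mul_eq_one_right hinv, e']⟩

/-- Lemma 3.4(b): Let `a` and `b` be relatively prime positive integers such that
`D = a² + b²` is not a perfect square, suppose the negative Pell equation
`x² − D·y² = −1` has an integer solution and `D` satisfies the one-family condition
with respect to `a` and `b`. If `(X, Y)` is a coprime positive integer solution of
`X² − D·Y⁴ = −b²` with `Y > 1`, then `Y > b/2`. -/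
theorem Y_gt_half_b
    (a b : ℤ) (ha : 0 < a) (hb : 0 < b) (hab : IsCoprime a b)
    (hnotsq : ¬ IsSquare (a ^ 2 + b ^ 2))
    (hpell : ∃ x y : ℤ, x ^ 2 - (a ^ 2 + b ^ 2) * y ^ 2 = -1)
    (hofc : OneFamilyCondition a b)
    (X Y : ℤ) (hX : 0 < X) (hY : 1 < Y) (hXY : IsCoprime X Y)
    (heq : X ^ 2 - (a ^ 2 + b ^ 2) * Y ^ 4 = -b ^ 2) :
    (b : ℝ) / 2 < (Y : ℝ) := by
  obtain ⟨T, U, -, -, hTU, -, hfam⟩ := hofc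
  obtain ⟨k, ε₁, ε₂, h₁, h₂, h⟩ := hfam X (Y ^ 2) hXY.pow_right (by rw [← heq]; ring)
  have hcast : (a : ℝ) ^ 2 + (b : ℝ) ^ 2 = ((a ^ 2 + b ^ 2 : ℤ) : ℝ) := by push_cast; rfl
  have hD : 0 ≤ a ^ 2 + b ^ 2 := by positivity
  have hirr : Irrational (√((a ^ 2 + b ^ 2 : ℤ) : ℝ)) :=
    irrational_sqrt_intCast_iff.mpr ⟨hnotsq, hD⟩
  have hs : √((a ^ 2 + b ^ 2 : ℤ) : ℝ) ^ 2 = ((a ^ 2 + b ^ 2 : ℤ) : ℝ) :=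
    Real.sq_sqrt (by exact_mod_cast hD)
  rw [hcast] at h
  generalize √((a ^ 2 + b ^ 2 : ℤ) : ℝ) = s at h hirr hs
  obtain ⟨t, u, hn, hp⟩ := exists_half_zpow hs hTU k
  rw [mul_comm 2 k, zpow_mul, hp, zpow_ofNat] at h
  push_cast at hs
  -- Comparing coefficients exhibits `4 * Y ^ 2` as a sum of two squares, up to the sign `ε₁`.
  have hcoeff : 4 * Y ^ 2 = ε₁ * (t ^ 2 + (a ^ 2 + b ^ 2) * u ^ 2 + 2 * ε₂ * a * t * u) := by
    refine hirr.coeff_eq (p := 4 * X)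
      (p' := ε₁ * (ε₂ * a * (t ^ 2 + (a ^ 2 + b ^ 2) * u ^ 2) + 2 * (a ^ 2 + b ^ 2) * t * u)) ?_
    push_cast at h ⊢
    linear_combination 4 * h + (ε₁ : ℝ) * (ε₂ * a * u ^ 2 + 2 * t * u + u ^ 2 * s) * hs
  have hε₂ : ε₂ ^ 2 = 1 := by rcases h₂ with rfl | rfl <;> norm_num
  have hsum : 4 * Y ^ 2 = (t + ε₂ * a * u) ^ 2 + b ^ 2 * u ^ 2 := by
    have hexp : t ^ 2 + (a ^ 2 + b ^ 2) * u ^ 2 + 2 * ε₂ * a * t * u =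
        (t + ε₂ * a * u) ^ 2 + b ^ 2 * u ^ 2 := by
      linear_combination (-(a ^ 2 * u ^ 2)) * hε₂
    rw [hexp] at hcoeff
    rcases h₁ with rfl | rfl
    · linarith
    · nlinarith [sq_nonneg (t + ε₂ * a * u), sq_nonneg (b * u)]
  suffices hlt : b < 2 * Y by
    have : (b : ℝ) < 2 * Y := by exact_mod_cast hlt
    linarith
  by_contra! hle
  have hY4 : 4 * Y ^ 2 ≤ b ^ 2 := by nlinarith
  have hu : u ≠ 0 := by
    rintro rfl
    rcases hn with hn | hn <;> nlinarith
  have hu1 : 1 ≤ u ^ 2 := by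
    have := sq_pos_of_ne_zero hu
    omega
  have hbu : b ^ 2 ≤ b ^ 2 * u ^ 2 := le_mul_of_one_le_right (sq_nonneg b) hu1
  have ht : t + ε₂ * a * u = 0 := by
    have : (t + ε₂ * a * u) ^ 2 ≤ 0 := by linarith
    exact pow_eq_zero_iff two_ne_zero |>.mp (le_antisymm this (sq_nonneg _))
  have hnorm : t ^ 2 - (a ^ 2 + b ^ 2) * u ^ 2 = -(b ^ 2 * u ^ 2) := by
    linear_combination (t - ε₂ * a * u) * ht + a ^ 2 * u ^ 2 * hε₂
  rw [ht] at hsum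
  rcases hn with hn | hn <;> nlinarith
end

section
/- Let a and m be positive integers and p a prime such that gcd(a, p^m) = 1 and D = a² + p^(2m) is not a perfect square, and suppose the negative Pell equation x² − D·y² = −1 has an integer solution. Put b = p^m. If (X, Y) is a pair of positive integers with gcd(X, Y) = 1, Y > 1, and X² − D·Y⁴ = −b², then Y > b²/4; moreover, if p ≠ 2 then Y > b²/2. -/
open Pell in
theorem Pell.exists_sq_add_mul_sq_of_neg_one {D : ℤ} (hD : 0 < D) (hns : ¬IsSquare D)
    (hneg : ∃ x y : ℤ, x ^ 2 - D * y ^ 2 = -1) {T k : ℤ} (hT : 0 < T)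
    (h : T ^ 2 - D * k ^ 2 = 1) : ∃ r s : ℤ, T = r ^ 2 + D * s ^ 2 ∧ k = 2 * r * s := by
  obtain ⟨x, y, hxy⟩ := hneg
  obtain ⟨f, hf⟩ := IsFundamental.exists_of_not_isSquare hD hns
  have coe_mul (A B : Solution₁ D) : ((A * B : Solution₁ D) : ℤ√D) = A * B := rfl
  have coe_sq (A B : Solution₁ D) (z : ℤ√D) (hA : A = B * B) :
      ((A : ℤ√D) * (z * z)) = (B * z) * (B * z) := by
    rw [hA, coe_mul]
    ring
  have hroot : ∃ w : ℤ√D, (f : ℤ√D) = w * w := by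
    have hE : (x ^ 2 + D * y ^ 2) ^ 2 - D * (2 * x * y) ^ 2 = 1 := by
      linear_combination (x ^ 2 - D * y ^ 2 - 1) * hxy
    let E : Solution₁ D := Solution₁.mk _ _ hE
    have hEx : E.x = x ^ 2 + D * y ^ 2 := Solution₁.x_mk _ _ hE
    have hEy : E.y = 2 * x * y := Solution₁.y_mk _ _ hE
    have hEcoe : (E : ℤ√D) = ⟨x, y⟩ * ⟨x, y⟩ := by
      ext
      · change E.x = _
        rw [hEx]
        simp
        ring
      · change E.y = _
        rw [hEy]
        simp
        ring
    obtain ⟨n, hn | hn⟩ := hf.eq_zpow_or_neg_zpow E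
    · obtain ⟨i, hi⟩ | ⟨i, hi⟩ := n.even_or_odd
      · exfalso
        have hone : E * (f ^ (-i) * f ^ (-i)) = 1 := by
          rw [hn, hi, ← zpow_add, ← zpow_add]
          simp
        set g := f ^ (-i) with hg
        have hz := coe_sq (g * g) g ⟨x, y⟩ rfl
        rw [← hEcoe, ← coe_mul, mul_comm (g * g), hone] at hz
        have h1 := congrArg Zsqrtd.re hz
        have hp := g.prop
        simp only [Zsqrtd.re_mul, Zsqrtd.im_mul] at h1
        change 1 = (g.x * x + D * g.y * y) * (g.x * x + D * g.y * y) +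
          D * (g.x * y + g.y * x) * (g.x * y + g.y * x) at h1
        have h2 : (g.x * x + D * g.y * y) ^ 2 - D * (g.x * y + g.y * x) ^ 2 = -1 := by
          linear_combination (x ^ 2 - D * y ^ 2) * hp + hxy
        have h3 : D * (g.x * y + g.y * x) ^ 2 = 1 := by
          nlinarith
        have h4 : D = 1 := Int.eq_one_of_dvd_one hD.le ⟨_, h3.symm⟩
        exact hns (h4 ▸ IsSquare.one)
      · refine ⟨(f ^ (-i) : Solution₁ D) * ⟨x, y⟩, ?_⟩
        rw [← coe_sq _ (f ^ (-i)) ⟨x, y⟩ rfl, ← hEcoe, ← coe_mul, hn, hi,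
          ← zpow_add, ← zpow_add]
        congr 1
        rw [show -i + -i + (2 * i + 1) = 1 by ring, zpow_one]
    · exfalso
      have h1 := Solution₁.x_zpow_pos hf.x_pos n
      have h2 : E.x = -(f ^ n).x := by rw [hn, Solution₁.x_neg]
      rw [hEx] at h2
      nlinarith [sq_nonneg x, mul_nonneg hD.le (sq_nonneg y)]
  obtain ⟨w, hw⟩ := hroot
  let A : Solution₁ D := Solution₁.mk T k h
  have hAx : A.x = T := Solution₁.x_mk _ _ h
  have hAy : A.y = k := Solution₁.y_mk _ _ h
  have hsq : ∃ z : ℤ√D, (A : ℤ√D) = z * z := by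
    obtain ⟨n, hn | hn⟩ := hf.eq_zpow_or_neg_zpow A
    · obtain ⟨i, hi⟩ | ⟨i, hi⟩ := n.even_or_odd
      · exact ⟨(f ^ i : Solution₁ D), by rw [hn, hi, zpow_add, coe_mul]⟩
      · refine ⟨(f ^ i : Solution₁ D) * w, ?_⟩
        rw [← coe_sq _ (f ^ i) w rfl, ← hw, ← coe_mul, hn, hi, ← zpow_add,
          ← zpow_add_one, two_mul]
    · exfalso
      have h1 := Solution₁.x_zpow_pos hf.x_pos n
      have h2 : A.x = -(f ^ n).x := by rw [hn, Solution₁.x_neg]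
      omega
  obtain ⟨z, hz⟩ := hsq
  have hre : A.x = (z * z).re := congrArg Zsqrtd.re hz
  have him : A.y = (z * z).im := congrArg Zsqrtd.im hz
  rw [hAx, Zsqrtd.re_mul] at hre
  rw [hAy, Zsqrtd.im_mul] at him
  exact ⟨z.re, z.im, by rw [hre]; ring, by rw [him]; ring⟩

theorem Int.prime_pow_dvd_or_dvd_of_dvd_mul {p : ℤ} (hp : Prime p) {n : ℕ} {u v : ℤ}
    (h : p ^ n ∣ u * v) (huv : p ∣ u → ¬p ∣ v) : p ^ n ∣ u ∨ p ^ n ∣ v := by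
  by_cases hu : p ∣ u
  · exact .inl (((hp.coprime_iff_not_dvd.mpr (huv hu)).pow_left).dvd_of_dvd_mul_right h)
  · exact .inr (((hp.coprime_iff_not_dvd.mpr hu).pow_left).dvd_of_dvd_mul_left h)

/-- If `X² - (a² + b²) Y⁴ = -b²` and `X ≡ a Y²` modulo `b²`, then `Y` is the hypotenuse of a right
triangle with a leg divisible by `b`. -/
theorem exists_sq_eq_sq_add_mul_sq_of_dvd {a b X Y : ℤ} (hb : 0 < b)
    (hns : ¬IsSquare (a ^ 2 + b ^ 2)) (hneg : ∃ x y : ℤ, x ^ 2 - (a ^ 2 + b ^ 2) * y ^ 2 = -1)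
    (hY : 1 < Y) (heq : X ^ 2 - (a ^ 2 + b ^ 2) * Y ^ 4 = -b ^ 2)
    (hdvd : b ^ 2 ∣ X - a * Y ^ 2) : ∃ c s : ℤ, s ≠ 0 ∧ Y ^ 2 = c ^ 2 + (b * s) ^ 2 := by
  obtain ⟨k, hk⟩ := hdvd
  have hX : X = a * Y ^ 2 + b ^ 2 * k := by linarith
  have hmul : k * (b ^ 2 * k + 2 * a * Y ^ 2) = Y ^ 4 - 1 := by
    refine mul_left_cancel₀ (pow_ne_zero 2 hb.ne') ?_
    rw [hX] at heq
    linear_combination heq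
  have hpell : (Y ^ 2 - a * k) ^ 2 - (a ^ 2 + b ^ 2) * k ^ 2 = 1 := by
    linear_combination -hmul
  have hT : 0 < Y ^ 2 - a * k := by
    by_contra! hT
    nlinarith [sq_nonneg (b * k), pow_pos (zero_lt_one.trans hY) 2]
  have hD : 0 < a ^ 2 + b ^ 2 := by positivity
  obtain ⟨r, s, hr, hs⟩ := Pell.exists_sq_add_mul_sq_of_neg_one hD hns hneg hT hpell
  refine ⟨r + a * s, s, ?_, by linear_combination hr + a * hs⟩
  rintro rfl
  have hk0 : k = 0 := by simpa using hs
  have h4 : 1 < Y ^ 4 := one_lt_pow₀ hY (by norm_num)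
  rw [hk0] at hmul
  linarith

theorem Int.abs_lt_of_sq_eq_sq_add_sq {Y c w : ℤ} (hY : 0 < Y) (hw : w ≠ 0)
    (h : Y ^ 2 = c ^ 2 + w ^ 2) : |c| < Y :=
  abs_lt_of_sq_lt_sq (by have : 0 < w ^ 2 := by positivity
                         linarith) hY.le


/-- Lemma 3.4(c): Let `a` and `m` be positive integers and `p` a prime such that
`gcd(a, p^m) = 1` and `D = a² + p^(2m)` is not a perfect square, and suppose the
negative Pell equation `x² − D·y² = −1` has an integer solution. Put `b = p^m`.
If `(X, Y)` is a coprime positive integer solution of `X² − D·Y⁴ = −b²` with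
`Y > 1`, then `Y > b²/4`; moreover, if `p ≠ 2` then `Y > b²/2`. -/
theorem Y_gt_quarter_b_sq
    (a : ℤ) (m p : ℕ) (ha : 0 < a) (hm : 0 < m) (hp : p.Prime)
    (b : ℤ) (hb : b = (p : ℤ) ^ m)
    (hab : IsCoprime a b)
    (hnotsq : ¬ IsSquare (a ^ 2 + b ^ 2))
    (hpell : ∃ x y : ℤ, x ^ 2 - (a ^ 2 + b ^ 2) * y ^ 2 = -1)
    (X Y : ℤ) (hX : 0 < X) (hY : 1 < Y) (hXY : IsCoprime X Y)
    (heq : X ^ 2 - (a ^ 2 + b ^ 2) * Y ^ 4 = -b ^ 2) :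
    (b : ℝ) ^ 2 / 4 < (Y : ℝ) ∧ (p ≠ 2 → (b : ℝ) ^ 2 / 2 < (Y : ℝ)) := by
  have hp' : Prime (p : ℤ) := Nat.prime_iff_prime_int.mp hp
  have hb0 : 0 < b := hb ▸ pow_pos (by exact_mod_cast hp.pos) m
  have hpb : (p : ℤ) ∣ b := hb ▸ dvd_pow_self _ hm.ne'
  have hpa : ¬(p : ℤ) ∣ a := fun h ↦ hp'.not_isUnit (hab.isUnit_of_dvd' h hpb)
  have hpY : ¬(p : ℤ) ∣ Y := fun h ↦ by
    have hX2 : (p : ℤ) ∣ X ^ 2 := by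
      rw [show X ^ 2 = (a ^ 2 + b ^ 2) * Y ^ 3 * Y - b * b by linear_combination heq]
      exact dvd_sub (h.mul_left _) (hpb.mul_left _)
    exact hp'.not_isUnit (hXY.isUnit_of_dvd' (hp'.dvd_of_dvd_pow hX2) h)
  have hfac : (X - a * Y ^ 2) * (X + a * Y ^ 2) = b ^ 2 * (Y ^ 4 - 1) := by
    linear_combination heq
  have hb2 : b ^ 2 = (p : ℤ) ^ (m * 2) := by rw [hb, pow_mul]
  have triangle (h : b ^ 2 ∣ X - a * Y ^ 2 ∨ b ^ 2 ∣ X + a * Y ^ 2) :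
      ∃ c s : ℤ, s ≠ 0 ∧ Y ^ 2 = c ^ 2 + (b * s) ^ 2 := by
    obtain h | h := h
    · exact exists_sq_eq_sq_add_mul_sq_of_dvd hb0 hnotsq hpell hY heq h
    · exact exists_sq_eq_sq_add_mul_sq_of_dvd (a := -a) hb0 (by rwa [neg_sq])
        (by rwa [neg_sq]) hY (X := X) (by rwa [neg_sq]) (by simpa using h)
  suffices h : b ^ 2 < 4 * Y ∧ (p ≠ 2 → b ^ 2 < 2 * Y) by
    refine ⟨?_, fun h2 ↦ ?_⟩
    · have : (b : ℝ) ^ 2 < 4 * Y := by exact_mod_cast h.1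
      linarith
    · have : (b : ℝ) ^ 2 < 2 * Y := by exact_mod_cast h.2 h2
      linarith
  by_cases h2 : p = 2
  · subst h2
    refine ⟨?_, fun h ↦ absurd rfl h⟩
    push_cast at *
    have hYodd : Odd Y := Int.not_even_iff_odd.mp fun h ↦ hpY h.two_dvd
    have haodd : Odd a := Int.not_even_iff_odd.mp fun h ↦ hpa h.two_dvd
    have hbeven : Even b := even_iff_two_dvd.mpr hpb
    have hay : Odd (a * Y ^ 2) := haodd.mul hYodd.pow
    have hXodd : Odd X := by
      have : Odd (X ^ 2) := by
        rw [show X ^ 2 = (a * Y ^ 2) ^ 2 + b * (b * (Y ^ 4 - 1)) by linear_combination heq]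
        exact hay.pow.add_even (hbeven.mul_right _)
      exact (Int.odd_pow' two_ne_zero).mp this
    obtain ⟨u, hu⟩ := (hXodd.sub_odd hay).two_dvd
    obtain ⟨v, hv⟩ := (hXodd.add_odd hay).two_dvd
    obtain ⟨q, hq⟩ : (4 : ℤ) ∣ Y ^ 4 - 1 := by
      obtain ⟨j, rfl⟩ := hYodd
      exact ⟨4 * j ^ 4 + 8 * j ^ 3 + 6 * j ^ 2 + 2 * j, by ring⟩
    have huv : u * v = b ^ 2 * q := by
      rw [hu, hv, hq] at hfac
      linarith
    obtain ⟨c, s, hs, hc⟩ := triangle <| by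
      rw [hu, hv]
      refine (Int.prime_pow_dvd_or_dvd_of_dvd_mul hp' (hb2 ▸ ⟨q, huv⟩) fun h₁ h₂ ↦ ?_).imp
        (fun h ↦ hb2 ▸ h.mul_left 2) (fun h ↦ hb2 ▸ h.mul_left 2)
      have : (2 : ℤ) ∣ X := by
        rw [show X = u + v by linarith]
        exact dvd_add h₁ h₂
      exact Int.not_even_iff_odd.mpr hXodd (even_iff_two_dvd.mpr this)
    obtain ⟨n, rfl⟩ := Nat.exists_eq_succ_of_ne_zero hm.ne'
    have hb' : b = 2 * 2 ^ n := by rw [hb, pow_succ']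
    have hcodd : Odd c := by
      have : Odd (c ^ 2) := by
        rw [show c ^ 2 = Y ^ 2 - b * (b * s * s) by linear_combination -hc]
        exact hYodd.pow.sub_even (hbeven.mul_right _)
      exact (Int.odd_pow' two_ne_zero).mp this
    obtain ⟨u', hu'⟩ := (hYodd.sub_odd hcodd).two_dvd
    obtain ⟨v', hv'⟩ := (hYodd.add_odd hcodd).two_dvd
    have huv' : u' * v' = 2 ^ (n * 2) * s ^ 2 := by
      have h4 : (2 * u') * (2 * v') = 4 * (2 ^ (n * 2) * s ^ 2) := by
        rw [← hu', ← hv', pow_mul]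
        rw [hb'] at hc
        linear_combination hc
      linarith
    have hlt := abs_lt.mp (Int.abs_lt_of_sq_eq_sq_add_sq (by linarith)
      (mul_ne_zero hb0.ne' hs) hc)
    have hle : (2 : ℤ) ^ (n * 2) < Y := by
      obtain h | h := Int.prime_pow_dvd_or_dvd_of_dvd_mul hp' ⟨_, huv'⟩ fun h₁ h₂ ↦ hpY <| by
        rw [show Y = u' + v' by linarith]
        exact dvd_add h₁ h₂
      all_goals
        have := Int.le_of_dvd (by linarith) h
        linarith
    rw [hb', mul_pow, ← pow_mul]
    linarith
  · have hp2 : ¬(p : ℤ) ∣ 2 := fun h ↦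
      h2 ((Nat.prime_dvd_prime_iff_eq hp Nat.prime_two).mp (by exact_mod_cast h))
    obtain ⟨c, s, hs, hc⟩ := triangle <| by
      rw [hb2] at hfac ⊢
      refine Int.prime_pow_dvd_or_dvd_of_dvd_mul hp' ⟨_, hfac⟩ fun h₁ h₂ ↦ ?_
      have h : (p : ℤ) ∣ 2 * (a * Y ^ 2) := by
        rw [show 2 * (a * Y ^ 2) = X + a * Y ^ 2 - (X - a * Y ^ 2) by ring]
        exact dvd_sub h₂ h₁
      obtain h | h | h := (hp'.dvd_or_dvd h).imp_right hp'.dvd_or_dvd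
      · exact hp2 h
      · exact hpa h
      · exact hpY (hp'.dvd_of_dvd_pow h)
    have hlt := abs_lt.mp (Int.abs_lt_of_sq_eq_sq_add_sq (by linarith)
      (mul_ne_zero hb0.ne' hs) hc)
    have hfac' : (Y - c) * (Y + c) = (p : ℤ) ^ (m * 2) * s ^ 2 := by
      rw [← hb2]
      linear_combination hc
    have hle : b ^ 2 < 2 * Y := by
      rw [hb2]
      obtain h | h := Int.prime_pow_dvd_or_dvd_of_dvd_mul hp' ⟨_, hfac'⟩ fun h₁ h₂ ↦ by
        have h : (p : ℤ) ∣ 2 * Y := by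
          rw [show 2 * Y = Y - c + (Y + c) by ring]
          exact dvd_add h₁ h₂
        exact (hp'.dvd_or_dvd h).elim hp2 hpY
      all_goals
        have := Int.le_of_dvd (by linarith) h
        linarith
    exact ⟨by linarith, fun _ ↦ hle⟩
end

section
/- Let a be a positive integer, m a non-negative integer and p a prime such that gcd(a, p^m) = 1, a² + p^(2m) is not a perfect square, and the negative Pell equation x² − (a² + p^(2m))·y² = −1 has an integer solution. Put b = p^m and D = a² + b². If (X₁, Y₁) and (X₂, Y₂) are pairs of positive integers with gcd(X₁, Y₁) = gcd(X₂, Y₂) = 1, Y₂ > Y₁ > 1, X₁² − D·Y₁⁴ = −b² and X₂² − D·Y₂⁴ = −b², then Y₂ > 7.98·(D/b²)·Y₁³. -/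
open Pell in
/-- If `x² - D y² = -1` is solvable then every norm-one element `P + Q√D` is, up to sign, the square
of an element `T + U√D` of norm `±1`. -/
theorem exists_sq_of_norm_one {D : ℤ} (hD : 0 < D) (hns : ¬ IsSquare D)
    (hpell : ∃ x y : ℤ, x ^ 2 - D * y ^ 2 = -1) {P Q : ℤ} (h : P ^ 2 - D * Q ^ 2 = 1) :
    ∃ T U σ τ : ℤ, (σ = 1 ∨ σ = -1) ∧ (τ = 1 ∨ τ = -1) ∧ T ^ 2 - D * U ^ 2 = τ ∧
      P = σ * (T ^ 2 + D * U ^ 2) ∧ Q = σ * (2 * T * U) := by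
  obtain ⟨ε, hε⟩ := IsFundamental.exists_of_not_isSquare hD hns
  obtain ⟨x, y, hxy⟩ := hpell
  have key (s : Solution₁ D) : ∃ n : ℤ, ∃ σ : ℤ, (σ = 1 ∨ σ = -1) ∧
      s.x = σ * (ε ^ n).x ∧ s.y = σ * (ε ^ n).y := by
    obtain ⟨n, hn | hn⟩ := hε.eq_zpow_or_neg_zpow s
    · exact ⟨n, 1, Or.inl rfl, by simp [hn], by simp [hn]⟩
    · exact ⟨n, -1, Or.inr rfl, by simp [hn], by simp [hn]⟩
  have hsq (s : Solution₁ D) (k : ℤ) : (s ^ (2 * k)).x = (s ^ k).x ^ 2 + D * (s ^ k).y ^ 2 ∧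
      (s ^ (2 * k)).y = 2 * (s ^ k).x * (s ^ k).y := by
    rw [two_mul, zpow_add, Solution₁.x_mul, Solution₁.y_mul]
    constructor <;> ring
  obtain ⟨n, σ, hσ, hPx, hQx⟩ := key (Solution₁.mk P Q h)
  rw [Solution₁.x_mk] at hPx
  rw [Solution₁.y_mk] at hQx
  obtain ⟨j, σ', hσ', hj, hj'⟩ := key (Solution₁.mk (x ^ 2 + D * y ^ 2) (2 * x * y)
    (by linear_combination (x ^ 2 - D * y ^ 2 - 1) * hxy))
  rw [Solution₁.x_mk] at hj
  rw [Solution₁.y_mk] at hj'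
  rcases Int.even_or_odd' n with ⟨k, rfl | rfl⟩
  · refine ⟨(ε ^ k).x, (ε ^ k).y, σ, 1, hσ, Or.inl rfl, (ε ^ k).prop, ?_, ?_⟩
    · rw [hPx, (hsq ε k).1]
    · rw [hQx, (hsq ε k).2]
  rcases Int.even_or_odd' j with ⟨l, rfl | rfl⟩
  · exfalso
    rw [(hsq ε l).1] at hj
    have hp := (ε ^ l).prop
    generalize (ε ^ l).x = u at *
    generalize (ε ^ l).y = v at *
    have hDy : 0 ≤ D * y ^ 2 := by positivity
    have hDv : 0 ≤ D * v ^ 2 := by positivity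
    rcases hσ' with rfl | rfl
    · have h1 : u ^ 2 = x ^ 2 + 1 := by linarith
      have hx : x = 0 := by
        by_contra hx
        have h2 : |x| < |u| := sq_lt_sq.1 (by linarith)
        have h3 : 0 < |x| := abs_pos.2 hx
        rw [← sq_abs u, ← sq_abs x] at h1
        nlinarith
      subst hx
      have h2 : D * y ^ 2 = 1 := by linarith
      have h3 : D = 1 := Int.eq_one_of_mul_eq_one_right hD.le h2
      exact hns ⟨1, by simpa using h3⟩
    · nlinarith [sq_nonneg u, sq_nonneg x]
  · -- `ε = ± (x + y√D)² ε^{-2l}`, so the odd power of `ε` is a square as well.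
    have hp := (ε ^ (k - l)).prop
    have hdec : ε ^ (2 * k + 1) = ε ^ (2 * l + 1) * ε ^ (2 * (k - l)) := by
      rw [← zpow_add]; congr 1; ring
    have hσσ : σ' * σ' = 1 := by rcases hσ' with rfl | rfl <;> rfl
    have e1 : (ε ^ (2 * l + 1)).x = σ' * (x ^ 2 + D * y ^ 2) := by
      rw [hj, ← mul_assoc, hσσ, one_mul]
    have e2 : (ε ^ (2 * l + 1)).y = σ' * (2 * x * y) := by
      rw [hj', ← mul_assoc, hσσ, one_mul]
    rw [hdec, Solution₁.x_mul, e1, e2, (hsq ε _).1, (hsq ε _).2] at hPx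
    rw [hdec, Solution₁.y_mul, e1, e2, (hsq ε _).1, (hsq ε _).2] at hQx
    generalize (ε ^ (k - l)).x = u at *
    generalize (ε ^ (k - l)).y = v at *
    refine ⟨x * u + D * y * v, x * v + y * u, σ * σ', -1, ?_, Or.inr rfl, ?_, ?_, ?_⟩
    · rcases hσ with rfl | rfl <;> rcases hσ' with rfl | rfl <;> simp
    · linear_combination (u ^ 2 - D * v ^ 2) * hxy - hp
    · rw [hPx]; ring
    · rw [hQx]; ring

theorem odd_of_sq_add_sq_eq_mul_pow_four {b D X Y : ℤ} (hXY : IsCoprime X Y)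
    (h : X ^ 2 + b ^ 2 = D * Y ^ 4) : Odd Y := by
  rw [← Int.not_even_iff_odd]
  rintro ⟨k, rfl⟩
  have hX : Odd X := by
    rw [← Int.not_even_iff_odd]
    intro hX
    have := hXY.isUnit_of_dvd' hX.two_dvd ⟨k, by ring⟩
    norm_num [Int.isUnit_iff] at this
  obtain ⟨c, rfl⟩ := hX
  rcases Int.even_or_odd' b with ⟨d, rfl | rfl⟩
  · have : 4 * (c ^ 2 + c + d ^ 2) + 1 = 4 * (4 * D * k ^ 4) := by linarith
    omega
  · have : 4 * (c ^ 2 + c + d ^ 2 + d) + 2 = 4 * (4 * D * k ^ 4) := by linarith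
    omega

/-- A power of a prime dividing a product of two numbers not both divisible by the prime divides
one of the factors. -/
theorem prime_pow_dvd_or_dvd {p : ℤ} (hp : Prime p) {n : ℕ} {u v : ℤ} (h : p ^ n ∣ u * v)
    (hn : ¬ (p ∣ u ∧ p ∣ v)) : p ^ n ∣ u ∨ p ^ n ∣ v := by
  by_cases hu : p ∣ u
  · exact Or.inl (hp.pow_dvd_of_dvd_mul_right n (fun hv => hn ⟨hu, hv⟩) h)
  · exact Or.inr (hp.pow_dvd_of_dvd_mul_left n hu h)

theorem sq_dvd_sub_or_sq_dvd_add {a : ℤ} {m p : ℕ} (hp : p.Prime) {b : ℤ} (hb : b = (p : ℤ) ^ m)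
    (hab : IsCoprime a b) {X Y : ℤ} (hXY : IsCoprime X Y)
    (h : X ^ 2 - (a ^ 2 + b ^ 2) * Y ^ 4 = -b ^ 2) :
    b ^ 2 ∣ X - a * Y ^ 2 ∨ b ^ 2 ∣ X + a * Y ^ 2 := by
  rcases Nat.eq_zero_or_pos m with rfl | hm
  · left; simp [hb]
  have hpZ : Prime (p : ℤ) := Nat.prime_iff_prime_int.1 hp
  have hpb : (p : ℤ) ∣ b := hb ▸ dvd_pow_self _ hm.ne'
  have hpa : ¬ (p : ℤ) ∣ a := fun hpa => hpZ.not_isUnit (hab.isUnit_of_dvd' hpa hpb)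
  have hprod : (X - a * Y ^ 2) * (X + a * Y ^ 2) = b ^ 2 * (Y ^ 4 - 1) := by linear_combination h
  have hbp : b ^ 2 = (p : ℤ) ^ (2 * m) := by rw [hb, ← pow_mul, mul_comm]
  have hnX : ¬ ((p : ℤ) ∣ X ∧ (p : ℤ) ∣ a * Y ^ 2) := by
    rintro ⟨h1, h2⟩
    rcases hpZ.dvd_or_dvd h2 with h2 | h2
    · exact hpa h2
    · exact hpZ.not_isUnit (hXY.isUnit_of_dvd' h1 (hpZ.dvd_of_dvd_pow h2))
  rcases hp.eq_two_or_odd' with rfl | hodd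
  · -- For `p = 2` both factors are even, and their halves are not both even.
    obtain ⟨k, rfl⟩ := odd_of_sq_add_sq_eq_mul_pow_four (b := b) (D := a ^ 2 + b ^ 2) hXY
      (by linarith)
    have ha : Odd a := by
      rw [← Int.not_even_iff_odd, even_iff_two_dvd]; exact_mod_cast hpa
    have haY : Odd (a * (2 * k + 1) ^ 2) := ha.mul (Odd.pow ⟨k, rfl⟩)
    have hX : Odd X := by
      have h4 : Even (b ^ 2) :=
        ((even_iff_two_dvd (a := b)).2 (by exact_mod_cast hpb)).pow_of_ne_zero two_ne_zero
      have h3 : Odd (X ^ 2) := by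
        have : X ^ 2 = a ^ 2 * (2 * k + 1) ^ 4 + b ^ 2 * ((2 * k + 1) ^ 4 - 1) := by linarith
        rw [this]
        exact (ha.pow.mul (Odd.pow ⟨k, rfl⟩)).add_even (h4.mul_right _)
      exact (Int.odd_pow' two_ne_zero).1 h3
    obtain ⟨u, hu⟩ := hX.sub_odd haY
    obtain ⟨v, hv⟩ := hX.add_odd haY
    obtain ⟨c, hc⟩ := hX
    have hdvd : ((2 : ℕ) : ℤ) ^ (2 * m) ∣ u * v := by
      rw [← hbp]
      refine ⟨4 * k ^ 4 + 8 * k ^ 3 + 6 * k ^ 2 + 2 * k, ?_⟩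
      rw [hu, hv] at hprod
      linarith
    have := prime_pow_dvd_or_dvd hpZ hdvd (by
      rintro ⟨⟨u', hu'⟩, ⟨v', hv'⟩⟩
      push_cast at hu' hv'
      omega)
    rw [← hbp] at this
    rw [hu, hv]
    exact this.imp (fun h => dvd_add h h) (fun h => dvd_add h h)
  · rw [hbp]
    refine prime_pow_dvd_or_dvd hpZ (by rw [hprod, hbp]; exact dvd_mul_right _ _) ?_
    rintro ⟨h1, h2⟩
    have hp2 : ¬ (p : ℤ) ∣ 2 := by
      intro h2
      have := (Nat.prime_dvd_prime_iff_eq hp Nat.prime_two).1 (by exact_mod_cast h2)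
      subst this
      exact absurd hodd (by decide)
    refine hnX ⟨(hpZ.dvd_or_dvd (a := 2) ?_).resolve_left hp2,
      (hpZ.dvd_or_dvd (a := 2) ?_).resolve_left hp2⟩
    · have := dvd_add h1 h2
      ring_nf at this ⊢; exact this
    · have := dvd_sub h2 h1
      ring_nf at this ⊢; exact this

/-- The arithmetic core: `X + b i` is, up to signs and conjugation, `(a - b i) (s + t i)⁴`. -/
theorem exists_gaussian_fourth_power_of_dvd {a b : ℤ} (hb : 0 < b)
    (hnotsq : ¬ IsSquare (a ^ 2 + b ^ 2))
    (hpell : ∃ x y : ℤ, x ^ 2 - (a ^ 2 + b ^ 2) * y ^ 2 = -1)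
    {X Y : ℤ} (hXY : IsCoprime X Y) (hY : 0 < Y)
    (h : X ^ 2 - (a ^ 2 + b ^ 2) * Y ^ 4 = -b ^ 2) (hdvd : b ^ 2 ∣ X - a * Y ^ 2) :
    ∃ s t : ℤ, IsCoprime s t ∧ Y = s ^ 2 + t ^ 2 ∧
      (a * (4 * s * t * (s ^ 2 - t ^ 2)) - b * (s ^ 4 - 6 * s ^ 2 * t ^ 2 + t ^ 4)) ^ 2 = b ^ 2 := by
  have hYodd : Odd Y := odd_of_sq_add_sq_eq_mul_pow_four (b := b) (D := a ^ 2 + b ^ 2) hXY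
    (by linarith)
  have hb0 : b ^ 2 ≠ 0 := by positivity
  obtain ⟨c, hc⟩ := hdvd
  obtain rfl : X = a * Y ^ 2 + b ^ 2 * c := by linarith
  have hnorm : (a * c - Y ^ 2) ^ 2 - (a ^ 2 + b ^ 2) * (-c) ^ 2 = 1 := by
    apply mul_left_cancel₀ hb0
    linear_combination -h
  obtain ⟨T, U, σ, τ, hσ, hτ, hTU, hP, hQ⟩ :=
    exists_sq_of_norm_one (by positivity) hnotsq hpell hnorm
  have hYsq : Y ^ 2 = -σ * ((T + a * U) ^ 2 + (b * U) ^ 2) := by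
    linear_combination -hP - a * hQ
  have hσ1 : σ = -1 := by
    rcases hσ with rfl | rfl
    · nlinarith [sq_nonneg (T + a * U), sq_nonneg (b * U)]
    · rfl
  subst hσ1
  have hττ : τ ^ 2 = 1 := by rcases hτ with rfl | rfl <;> rfl
  obtain ⟨A, hA⟩ : ∃ A, A = T + a * U := ⟨_, rfl⟩
  obtain ⟨B, hB⟩ : ∃ B, B = b * U := ⟨_, rfl⟩
  rw [← hA, ← hB] at hYsq
  have hX : a * Y ^ 2 + b ^ 2 * c = a * (A ^ 2 - B ^ 2) + 2 * b * A * B := by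
    rw [hYsq, hA, hB]
    linear_combination (-b ^ 2) * hQ
  have hI : 2 * a * A * B - b * (A ^ 2 - B ^ 2) = -b * τ := by
    rw [hA, hB, ← hTU]; ring
  have hpyth : PythagoreanTriple A B Y := by
    unfold PythagoreanTriple; linarith
  have hcop : Int.gcd A B = 1 := by
    rw [← Int.isCoprime_iff_gcd_eq_one]
    refine isCoprime_of_prime_dvd ?_ ?_
    · rintro ⟨rfl, rfl⟩
      nlinarith
    · intro q hq hqA hqB
      refine hq.not_isUnit (hXY.isUnit_of_dvd' ?_ ?_)
      · rw [hX]
        exact dvd_add ((dvd_sub (dvd_pow hqA two_ne_zero) (dvd_pow hqB two_ne_zero)).mul_left _)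
          (hqB.mul_left _)
      · refine hq.dvd_of_dvd_pow (n := 2) ?_
        rw [hYsq]
        exact (dvd_add (dvd_pow hqA two_ne_zero) (dvd_pow hqB two_ne_zero)).mul_left _
  rcases Int.even_or_odd A with hAe | hAo
  · have hBo : B % 2 = 1 := by
      rw [← Int.odd_iff, ← Int.not_even_iff_odd]
      intro hBe
      have := (Int.isCoprime_iff_gcd_eq_one.2 hcop).isUnit_of_dvd' hAe.two_dvd hBe.two_dvd
      norm_num [Int.isUnit_iff] at this
    obtain ⟨s, t, h1, h2, h3, h4, -⟩ :=
      hpyth.symm.coprime_classification' (by rwa [Int.gcd_comm]) hBo hY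
    refine ⟨s, -t, (Int.isCoprime_iff_gcd_eq_one.2 h4).neg_right, by rw [h3]; ring, ?_⟩
    have : a * (4 * s * -t * (s ^ 2 - (-t) ^ 2)) - b * (s ^ 4 - 6 * s ^ 2 * (-t) ^ 2 + (-t) ^ 4)
        = b * τ := by
      rw [h1, h2] at hI
      linear_combination -hI
    rw [this, mul_pow, hττ, mul_one]
  · obtain ⟨s, t, h1, h2, h3, h4, -⟩ :=
      hpyth.coprime_classification' hcop (Int.odd_iff.1 hAo) hY
    refine ⟨s, t, Int.isCoprime_iff_gcd_eq_one.2 h4, h3, ?_⟩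
    have : a * (4 * s * t * (s ^ 2 - t ^ 2)) - b * (s ^ 4 - 6 * s ^ 2 * t ^ 2 + t ^ 4)
        = -b * τ := by
      rw [h1, h2] at hI
      linear_combination hI
    rw [this, mul_pow, hττ, mul_one, neg_sq]

theorem exists_gaussian_fourth_power {a : ℤ} {m p : ℕ} (hp : p.Prime) {b : ℤ}
    (hb : b = (p : ℤ) ^ m) (hab : IsCoprime a b) (hnotsq : ¬ IsSquare (a ^ 2 + b ^ 2))
    (hpell : ∃ x y : ℤ, x ^ 2 - (a ^ 2 + b ^ 2) * y ^ 2 = -1)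
    {X Y : ℤ} (hXY : IsCoprime X Y) (hY : 0 < Y)
    (h : X ^ 2 - (a ^ 2 + b ^ 2) * Y ^ 4 = -b ^ 2) :
    ∃ s t : ℤ, IsCoprime s t ∧ Y = s ^ 2 + t ^ 2 ∧
      (a * (4 * s * t * (s ^ 2 - t ^ 2)) - b * (s ^ 4 - 6 * s ^ 2 * t ^ 2 + t ^ 4)) ^ 2 = b ^ 2 := by
  have hb0 : 0 < b := by
    rw [hb]; exact pow_pos (by exact_mod_cast hp.pos) m
  rcases sq_dvd_sub_or_sq_dvd_add hp hb hab hXY h with hd | hd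
  · exact exists_gaussian_fourth_power_of_dvd hb0 hnotsq hpell hXY hY h hd
  · obtain ⟨s, t, h1, h2, h3⟩ := exists_gaussian_fourth_power_of_dvd (a := -a) hb0
      (by rwa [neg_sq]) (by rwa [neg_sq]) hXY hY (by rwa [neg_sq])
      (by rwa [neg_mul, sub_neg_eq_add])
    exact ⟨s, -t, h1.neg_right, by rw [h2]; ring, by rw [← h3]; ring⟩

theorem sq_add_sq_eq_of_isCoprime_of_mul_eq {s₁ t₁ s₂ t₂ : ℤ} (h₁ : IsCoprime s₁ t₁)
    (h₂ : IsCoprime s₂ t₂) (h : s₁ * t₂ = t₁ * s₂) : s₁ ^ 2 + t₁ ^ 2 = s₂ ^ 2 + t₂ ^ 2 := by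
  have hs : s₁.natAbs = s₂.natAbs := Int.natAbs_eq_of_dvd_dvd
    (h₁.dvd_of_dvd_mul_left ⟨t₂, h.symm⟩) (h₂.dvd_of_dvd_mul_right ⟨t₁, by linarith⟩)
  have ht : t₁.natAbs = t₂.natAbs := Int.natAbs_eq_of_dvd_dvd
    (h₁.symm.dvd_of_dvd_mul_left ⟨s₂, h⟩) (h₂.symm.dvd_of_dvd_mul_right ⟨s₁, by linarith⟩)
  rw [Int.natAbs_eq_iff_sq_eq.1 hs, Int.natAbs_eq_iff_sq_eq.1 ht]

/-- The imaginary part `4xy(x² - y²)` of `(x + y i)⁴` cannot be small unless it vanishes. -/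
theorem le_sq_im_pow_four {x y : ℤ} (hx : x ≠ 0) (hy : y ≠ 0) (hodd : Odd (x ^ 2 + y ^ 2)) :
    4 * (2 * (x ^ 2 + y ^ 2) - 1) * (x ^ 2 + y ^ 2 - 1) ^ 2
      ≤ (4 * x * y * (x ^ 2 - y ^ 2)) ^ 2 := by
  have one_le {z : ℤ} (hz : z ≠ 0) : 1 ≤ z ^ 2 := Int.add_one_le_of_lt (sq_pos_of_ne_zero hz)
  have hx1 := one_le hx
  have hy1 := one_le hy
  have hxy : x ^ 2 ≠ y ^ 2 := by
    intro h
    rw [h] at hodd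
    exact (Int.not_even_iff_odd.2 hodd) ⟨_, rfl⟩
  have hd := one_le (z := x - y) (fun h => hxy (by rw [sub_eq_zero.1 h]))
  have he := one_le (z := x + y) (fun h => hxy (by rw [eq_neg_of_add_eq_zero_left h, neg_sq]))
  have h1 : 2 * (x ^ 2 + y ^ 2) - 1 ≤ (2 * x * y) ^ 2 := by
    nlinarith [mul_nonneg (sub_nonneg.2 hx1) (sub_nonneg.2 hy1)]
  have h2 : 2 * (x ^ 2 + y ^ 2) - 1 ≤ (x ^ 2 - y ^ 2) ^ 2 := by
    nlinarith [mul_nonneg (sub_nonneg.2 hd) (sub_nonneg.2 he)]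
  nlinarith [mul_nonneg (sub_nonneg.2 h1) (sub_nonneg.2 h2)]

/-- If `a I - b R = ± b` for two Gaussian integers `R + I i` of norms `M₁⁴` and `M₂⁴`, then their
arguments are close. -/
theorem mul_sq_det_le {a b R₁ I₁ R₂ I₂ M₁ M₂ : ℤ}
    (hD : 0 < a ^ 2 + b ^ 2) (hR₁ : R₁ ^ 2 + I₁ ^ 2 = M₁ ^ 4) (hR₂ : R₂ ^ 2 + I₂ ^ 2 = M₂ ^ 4)
    (h₁ : (a * I₁ - b * R₁) ^ 2 = b ^ 2) (h₂ : (a * I₂ - b * R₂) ^ 2 = b ^ 2) :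
    (a ^ 2 + b ^ 2) * (R₁ * I₂ - I₁ * R₂) ^ 2 ≤ b ^ 2 * (M₁ ^ 2 + M₂ ^ 2) ^ 2 := by
  obtain ⟨D, hDd⟩ : ∃ D, D = a ^ 2 + b ^ 2 := ⟨_, rfl⟩
  obtain ⟨Z₁, hZ₁⟩ : ∃ Z, Z = a * R₁ + b * I₁ := ⟨_, rfl⟩
  obtain ⟨Z₂, hZ₂⟩ : ∃ Z, Z = a * R₂ + b * I₂ := ⟨_, rfl⟩
  obtain ⟨W₁, hW₁⟩ : ∃ W, W = a * I₁ - b * R₁ := ⟨_, rfl⟩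
  obtain ⟨W₂, hW₂⟩ : ∃ W, W = a * I₂ - b * R₂ := ⟨_, rfl⟩
  have e₁ : Z₁ ^ 2 + b ^ 2 = D * M₁ ^ 4 := by
    rw [hZ₁, hDd, ← hR₁]; linear_combination -h₁
  have e₂ : Z₂ ^ 2 + b ^ 2 = D * M₂ ^ 4 := by
    rw [hZ₂, hDd, ← hR₂]; linear_combination -h₂
  have hdet : D * (R₁ * I₂ - I₁ * R₂) = Z₁ * W₂ - W₁ * Z₂ := by
    rw [hZ₁, hZ₂, hW₁, hW₂, hDd]; ring
  rw [← hW₁] at h₁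
  rw [← hW₂] at h₂
  rw [← hDd] at hD ⊢
  have hprod : |Z₁ * Z₂| ≤ D * M₁ ^ 2 * M₂ ^ 2 := by
    refine abs_le_of_sq_le_sq ?_ (by positivity)
    calc (Z₁ * Z₂) ^ 2 = Z₁ ^ 2 * Z₂ ^ 2 := by ring
      _ ≤ (D * M₁ ^ 4) * (D * M₂ ^ 4) :=
        mul_le_mul (by nlinarith [sq_nonneg b]) (by nlinarith [sq_nonneg b]) (sq_nonneg _)
          (by positivity)
      _ = _ := by ring
  have hW : |W₁ * W₂| = b ^ 2 := by
    rw [abs_mul, (sq_eq_sq_iff_abs_eq_abs _ _).1 h₁, (sq_eq_sq_iff_abs_eq_abs _ _).1 h₂,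
      abs_mul_abs_self, sq]
  have hcross : -(2 * (Z₁ * Z₂) * (W₁ * W₂)) ≤ 2 * (D * M₁ ^ 2 * M₂ ^ 2) * b ^ 2 := by
    have h3 : |Z₁ * Z₂| * |W₁ * W₂| ≤ D * M₁ ^ 2 * M₂ ^ 2 * b ^ 2 := by
      rw [hW]; exact mul_le_mul_of_nonneg_right hprod (sq_nonneg b)
    rw [← abs_mul] at h3
    linarith [neg_abs_le (Z₁ * Z₂ * (W₁ * W₂))]
  refine le_of_mul_le_mul_left ?_ hD
  calc D * (D * (R₁ * I₂ - I₁ * R₂) ^ 2) = (D * (R₁ * I₂ - I₁ * R₂)) ^ 2 := by ring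
    _ = Z₁ ^ 2 * W₂ ^ 2 + W₁ ^ 2 * Z₂ ^ 2 - 2 * (Z₁ * Z₂) * (W₁ * W₂) := by rw [hdet]; ring
    _ = b ^ 2 * (Z₁ ^ 2 + Z₂ ^ 2) - 2 * (Z₁ * Z₂) * (W₁ * W₂) := by rw [h₁, h₂]; ring
    _ ≤ b ^ 2 * (D * M₁ ^ 4 + D * M₂ ^ 4) + 2 * (D * M₁ ^ 2 * M₂ ^ 2) * b ^ 2 := by
      nlinarith [mul_nonneg (sq_nonneg b) (sq_nonneg b)]
    _ = _ := by ring

/-- One bootstrapping step for the gap: if `Y₁Y₂` and `Y₂/Y₁` are large, the constant improves. -/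
theorem gap_step {K y z α β : ℝ} (hK : 0 < K) (hy : 0 < y) (hz : 0 < z)
    (h : 4 * K * (2 * (y * z) - 1) * (y * z - 1) ^ 2 ≤ (y ^ 2 + z ^ 2) ^ 2)
    (hα : 1 ≤ α) (hN : α ≤ y * z) (hβ : 0 < β) (hβz : β * y ≤ z) :
    8 * (1 - 1 / α) ^ 3 / (1 + 1 / β ^ 2) ^ 2 * K * y ^ 3 ≤ z := by
  have hα0 : 0 < α := by linarith
  have hyz : 0 < y * z := mul_pos hy hz
  have hc0 : 0 ≤ 1 - 1 / α := by
    rw [sub_nonneg, div_le_one hα0]; exact hα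
  have hc1 : (1 - 1 / α) * (y * z) ≤ y * z - 1 := by
    have : 1 ≤ 1 / α * (y * z) := by
      rw [one_div, inv_mul_eq_div, le_div_iff₀ hα0]; linarith
    linarith
  have hy2 : y ^ 2 ≤ 1 / β ^ 2 * z ^ 2 := by
    rw [one_div, inv_mul_eq_div, le_div_iff₀ (by positivity)]
    nlinarith [mul_pos hβ hy]
  generalize 1 - 1 / α = c at *
  generalize 1 / β ^ 2 = d at *
  have hd : 0 < 1 + d := by
    by_contra hd
    nlinarith [sq_pos_of_pos hy, sq_pos_of_pos hz]
  have hl : 8 * K * c ^ 3 * (y * z) ^ 3 ≤ 4 * K * (2 * (y * z) - 1) * (y * z - 1) ^ 2 := by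
    have h1 : (c * (y * z)) ^ 2 ≤ (y * z - 1) ^ 2 := pow_le_pow_left₀ (by positivity) hc1 2
    have h2 : 2 * (c * (y * z)) ≤ 2 * (y * z) - 1 := by linarith
    have h3 := mul_le_mul h2 h1 (by positivity) (le_trans (by positivity) h2)
    nlinarith [mul_le_mul_of_nonneg_left h3 hK.le]
  have hr : (y ^ 2 + z ^ 2) ^ 2 ≤ ((1 + d) * z ^ 2) ^ 2 :=
    pow_le_pow_left₀ (by positivity) (by linarith) 2
  have hm : (8 * K * c ^ 3 * y ^ 3) * z ^ 3 ≤ ((1 + d) ^ 2 * z) * z ^ 3 := by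
    calc _ = 8 * K * c ^ 3 * (y * z) ^ 3 := by ring
      _ ≤ _ := (hl.trans h).trans hr
      _ = _ := by ring
  have hm' := le_of_mul_le_mul_right hm (by positivity)
  calc _ = (8 * K * c ^ 3 * y ^ 3) / (1 + d) ^ 2 := by ring
    _ ≤ z := by rw [div_le_iff₀ (by positivity)]; linarith

theorem gap_of_le {K y z : ℝ} (hK : 1 < K) (hy : 5 ≤ y) (hyz : y ≤ z)
    (h : 4 * K * (2 * (y * z) - 1) * (y * z - 1) ^ 2 ≤ (y ^ 2 + z ^ 2) ^ 2) :
    7.98 * K * y ^ 3 < z := by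
  have hK0 : 0 < K := by linarith
  have hy0 : 0 < y := by linarith
  have hz0 : 0 < z := by linarith
  have boot {γ : ℝ} (hγ : 0 ≤ γ) (hg : γ * K * y ^ 3 ≤ z) : 25 * γ * y ≤ z ∧ 625 * γ ≤ y * z := by
    have h1 : 25 * γ * y ≤ z := by
      refine le_trans ?_ hg
      have h3 : γ * y * 25 ≤ γ * y * y ^ 2 :=
        mul_le_mul_of_nonneg_left (by nlinarith) (by positivity)
      have h4 : γ * y ^ 3 * 1 ≤ γ * y ^ 3 * K :=
        mul_le_mul_of_nonneg_left hK.le (by positivity)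
      linarith
    refine ⟨h1, ?_⟩
    have h2 : 25 * γ * 25 ≤ 25 * γ * y ^ 2 :=
      mul_le_mul_of_nonneg_left (by nlinarith) (by positivity)
    nlinarith
  have weaken {γ δ : ℝ} (hg : δ * K * y ^ 3 ≤ z) (hγ : γ ≤ δ) : γ * K * y ^ 3 ≤ z := by
    refine le_trans ?_ hg
    gcongr
  have g1 := weaken (γ := 1) (gap_step (α := 25) (β := 1) hK0 hy0 hz0 h (by norm_num)
    (by nlinarith) (by norm_num) (by linarith)) (by norm_num)
  obtain ⟨r1, n1⟩ := boot (by norm_num) g1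
  have g2 := weaken (γ := 7) (gap_step (α := 625) (β := 25) hK0 hy0 hz0 h (by norm_num)
    (by linarith) (by norm_num) (by linarith)) (by norm_num)
  obtain ⟨r2, n2⟩ := boot (by norm_num) g2
  have g3 := weaken (γ := 7.99) (gap_step (α := 4375) (β := 175) hK0 hy0 hz0 h (by norm_num)
    (by linarith) (by norm_num) (by linarith)) (by norm_num)
  refine lt_of_lt_of_le ?_ g3
  gcongr
  norm_num


/-- Lemma 3.3 (gap principle): Let `a` be a positive integer, `m` a non-negative
integer and `p` a prime such that `gcd(a, p^m) = 1`, `a² + p^(2m)` is not a perfect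
square and the negative Pell equation `x² − (a² + p^(2m))·y² = −1` has an integer
solution. Put `b = p^m` and `D = a² + b²`. If `(X₁, Y₁)` and `(X₂, Y₂)` are coprime
positive integer solutions of `X² − D·Y⁴ = −b²` with `Y₂ > Y₁ > 1`, then
`Y₂ > 7.98·(D/b²)·Y₁³`. -/
theorem gap_principle
    (a : ℤ) (m p : ℕ) (ha : 0 < a) (hp : p.Prime)
    (b : ℤ) (hb : b = (p : ℤ) ^ m)
    (hab : IsCoprime a b)
    (hnotsq : ¬ IsSquare (a ^ 2 + b ^ 2))
    (hpell : ∃ x y : ℤ, x ^ 2 - (a ^ 2 + b ^ 2) * y ^ 2 = -1)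
    (X₁ Y₁ X₂ Y₂ : ℤ) (hX₁ : 0 < X₁) (hX₂ : 0 < X₂)
    (hXY₁ : IsCoprime X₁ Y₁) (hXY₂ : IsCoprime X₂ Y₂)
    (hY : 1 < Y₁) (hYY : Y₁ < Y₂)
    (heq₁ : X₁ ^ 2 - (a ^ 2 + b ^ 2) * Y₁ ^ 4 = -b ^ 2)
    (heq₂ : X₂ ^ 2 - (a ^ 2 + b ^ 2) * Y₂ ^ 4 = -b ^ 2) :
    (Y₂ : ℝ) > 7.98 * (((a : ℝ) ^ 2 + (b : ℝ) ^ 2) / (b : ℝ) ^ 2) * (Y₁ : ℝ) ^ 3 := by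
  have hb0 : 0 < b := by
    rw [hb]; exact pow_pos (by exact_mod_cast hp.pos) m
  obtain ⟨s₁, t₁, hc₁, hs₁, hi₁⟩ :=
    exists_gaussian_fourth_power hp hb hab hnotsq hpell hXY₁ (by linarith) heq₁
  obtain ⟨s₂, t₂, hc₂, hs₂, hi₂⟩ :=
    exists_gaussian_fourth_power hp hb hab hnotsq hpell hXY₂ (by linarith) heq₂
  have ho₁ : Odd Y₁ := odd_of_sq_add_sq_eq_mul_pow_four (b := b) (D := a ^ 2 + b ^ 2) hXY₁
    (by linarith)
  have ho₂ : Odd Y₂ := odd_of_sq_add_sq_eq_mul_pow_four (b := b) (D := a ^ 2 + b ^ 2) hXY₂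
    (by linarith)
  have hY5 : 5 ≤ Y₁ := by
    have h4 : Y₁ % 4 ≠ 3 := by
      rw [hs₁]
      rcases Int.even_or_odd' s₁ with ⟨u, rfl | rfl⟩ <;>
        rcases Int.even_or_odd' t₁ with ⟨v, rfl | rfl⟩ <;> ring_nf <;> omega
    obtain ⟨k, hk⟩ := ho₁
    omega
  have hN : (s₁ * s₂ + t₁ * t₂) ^ 2 + (s₁ * t₂ - t₁ * s₂) ^ 2 = Y₁ * Y₂ := by
    rw [hs₁, hs₂]; ring
  have hx0 : s₁ * s₂ + t₁ * t₂ ≠ 0 := by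
    intro h0
    have := sq_add_sq_eq_of_isCoprime_of_mul_eq hc₁ hc₂.symm.neg_left
      (by linarith)
    linarith
  have hy0 : s₁ * t₂ - t₁ * s₂ ≠ 0 := by
    intro h0
    have := sq_add_sq_eq_of_isCoprime_of_mul_eq hc₁ hc₂ (by linarith)
    linarith
  have hlow := le_sq_im_pow_four hx0 hy0 (by rw [hN]; exact ho₁.mul ho₂)
  have hupp := mul_sq_det_le (M₁ := Y₁) (M₂ := Y₂) (by positivity) (by rw [hs₁]; ring)
    (by rw [hs₂]; ring) hi₁ hi₂
  rw [hN] at hlow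
  have hmain : (a ^ 2 + b ^ 2) * (4 * (2 * (Y₁ * Y₂) - 1) * (Y₁ * Y₂ - 1) ^ 2)
      ≤ b ^ 2 * (Y₁ ^ 2 + Y₂ ^ 2) ^ 2 := by
    refine (mul_le_mul_of_nonneg_left hlow (by positivity)).trans (le_of_eq_of_le ?_ hupp)
    ring
  have hbR : (0 : ℝ) < b := by exact_mod_cast hb0
  have haR : (0 : ℝ) < a := by exact_mod_cast ha
  refine gap_of_le (z := (Y₂ : ℝ)) ?_ (by exact_mod_cast hY5) (by exact_mod_cast hYY.le) ?_
  · rw [one_lt_div (by positivity)]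
    exact lt_add_of_pos_left _ (by positivity)
  · have hmainR : ((a : ℝ) ^ 2 + b ^ 2) * (4 * (2 * (Y₁ * Y₂) - 1) * (Y₁ * Y₂ - 1) ^ 2)
        ≤ b ^ 2 * ((Y₁ : ℝ) ^ 2 + Y₂ ^ 2) ^ 2 := by exact_mod_cast hmain
    rw [← mul_le_mul_iff_right₀ (show (0 : ℝ) < b ^ 2 by positivity)]
    refine le_of_eq_of_le ?_ hmainR
    field_simp
end

section
/- Let b ≥ 3 be an odd positive integer not divisible by 5, and let a = (b² − 5)/4. Then a is a positive integer, and the two pairs (a, 1) and ((b⁶ + 5·b⁴ + 15·b² − 5)/16, (b² + 1)/2) are distinct pairs of positive integers, each having coprime coordinates, and each satisfying X² − (a² + b²)·Y⁴ = −b². In particular, the equation X² − (a² + b²)·Y⁴ = −b² has at least two coprime positive integer solutions. -/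
/-- Example 1 of Remark 1: Let `b ≥ 3` be an odd positive integer not divisible by `5`
and let `a = (b² − 5)/4`. Then `a` is a positive integer and the two distinct pairs
`(a, 1)` and `((b⁶ + 5·b⁴ + 15·b² − 5)/16, (b² + 1)/2)`, each having coprime positive
coordinates, both satisfy `X² − (a² + b²)·Y⁴ = −b²`. -/
theorem example_one_two_solutions
    (b : ℤ) (hb3 : 3 ≤ b) (hodd : Odd b) (h5 : ¬ (5 ∣ b)) :
    ∃ a X₂ Y₂ : ℤ,
      4 * a = b ^ 2 - 5 ∧
      16 * X₂ = b ^ 6 + 5 * b ^ 4 + 15 * b ^ 2 - 5 ∧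
      2 * Y₂ = b ^ 2 + 1 ∧
      0 < a ∧ 0 < X₂ ∧ 0 < Y₂ ∧
      ((a, (1 : ℤ)) : ℤ × ℤ) ≠ (X₂, Y₂) ∧
      IsCoprime a (1 : ℤ) ∧ IsCoprime X₂ Y₂ ∧
      a ^ 2 - (a ^ 2 + b ^ 2) * 1 ^ 4 = -b ^ 2 ∧
      X₂ ^ 2 - (a ^ 2 + b ^ 2) * Y₂ ^ 4 = -b ^ 2 := by
  obtain ⟨k, rfl⟩ := hodd
  obtain ⟨n, hn⟩ := Int.even_mul_succ_self k
  have hb : (2 * k + 1) ^ 2 = 8 * n + 1 := by linear_combination 4 * hn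
  have hn1 : 1 ≤ n := by nlinarith
  have hb4 : (2 * k + 1) ^ 4 = (8 * n + 1) ^ 2 := by rw [← hb]; ring
  have hb6 : (2 * k + 1) ^ 6 = (8 * n + 1) ^ 3 := by rw [← hb]; ring
  rw [hb6, hb4, hb]
  refine ⟨2 * n - 1, 32 * n ^ 3 + 32 * n ^ 2 + 14 * n + 1, 4 * n + 1, by ring, by ring, by ring,
    by linarith, by positivity, by positivity, ?_, isCoprime_one_right,
    ⟨-1, 8 * n ^ 2 + 6 * n + 2, by ring⟩, by ring, by ring⟩
  intro h
  have hY : 1 = 4 * n + 1 := congrArg Prod.snd h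
  linarith
end

section
/- Let b be an odd positive integer and let a = (5·b² − 1)/4. Then a is a positive integer, and the two pairs (a, 1) and ((3125·b⁶ + 625·b⁴ + 75·b² − 1)/16, (25·b² + 1)/2) are distinct pairs of positive integers, each having coprime coordinates, and each satisfying X² − (a² + b²)·Y⁴ = −b². In particular, the equation X² − (a² + b²)·Y⁴ = −b² has at least two coprime positive integer solutions. -/
/-- Example 2 of Remark 1: Let `b` be an odd positive integer and let
`a = (5·b² − 1)/4`. Then `a` is a positive integer and the two distinct pairs
`(a, 1)` and `((3125·b⁶ + 625·b⁴ + 75·b² − 1)/16, (25·b² + 1)/2)`, each having coprime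
positive coordinates, both satisfy `X² − (a² + b²)·Y⁴ = −b²`. -/
theorem example_two_two_solutions
    (b : ℤ) (hb : 0 < b) (hodd : Odd b) :
    ∃ a X₂ Y₂ : ℤ,
      4 * a = 5 * b ^ 2 - 1 ∧
      16 * X₂ = 3125 * b ^ 6 + 625 * b ^ 4 + 75 * b ^ 2 - 1 ∧
      2 * Y₂ = 25 * b ^ 2 + 1 ∧
      0 < a ∧ 0 < X₂ ∧ 0 < Y₂ ∧
      ((a, (1 : ℤ)) : ℤ × ℤ) ≠ (X₂, Y₂) ∧
      IsCoprime a (1 : ℤ) ∧ IsCoprime X₂ Y₂ ∧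
      a ^ 2 - (a ^ 2 + b ^ 2) * 1 ^ 4 = -b ^ 2 ∧
      X₂ ^ 2 - (a ^ 2 + b ^ 2) * Y₂ ^ 4 = -b ^ 2 := by
  obtain ⟨k, hk⟩ : (8 : ℤ) ∣ b ^ 2 - 1 := Int.eight_dvd_sq_sub_one_of_odd hodd
  have hsq : b ^ 2 = 8 * k + 1 := by linarith
  have hk0 : 0 ≤ k := by
    have : 0 < b ^ 2 := by positivity
    omega
  have h4 : b ^ 4 = (8 * k + 1) ^ 2 := by rw [← hsq]; ring
  have h6 : b ^ 6 = (8 * k + 1) ^ 3 := by rw [← hsq]; ring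
  refine ⟨10 * k + 1, 100000 * k ^ 3 + 40000 * k ^ 2 + 5350 * k + 239, 100 * k + 13,
    ?_, ?_, ?_, by positivity, by positivity, by positivity, ?_, isCoprime_one_right,
    ⟨-5, 5000 * k ^ 2 + 1350 * k + 92, by ring⟩, by ring, ?_⟩
  · rw [hsq]; ring
  · rw [h6, h4, hsq]; ring
  · rw [hsq]; ring
  · intro h
    have := (Prod.ext_iff.mp h).2
    dsimp only at this
    omega
  · rw [hsq]; ring
end

section
/- Let b₁ ≥ 3 be an odd positive integer not divisible by 5 and set b = b₁², a = (b² − 5)/4. Then the three pairs (a, 1), ((b⁶ + 5·b⁴ + 15·b² − 5)/16, (b² + 1)/2) and ((b³ + 3·b)/4, b₁) are pairwise distinct pairs of positive integers each satisfying X² − (a² + b²)·Y⁴ = −b². In particular, the equation X² − (a² + b²)·Y⁴ = −b² has at least three positive integer solutions. -/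
/-- Remark after Corollary 1.1: Let `b₁ ≥ 3` be an odd positive integer not divisible
by `5`, and set `b = b₁²`, `a = (b² − 5)/4`. Then the three pairwise distinct pairs
`(a, 1)`, `((b⁶ + 5·b⁴ + 15·b² − 5)/16, (b² + 1)/2)` and `((b³ + 3·b)/4, b₁)` are
positive integer solutions of `X² − (a² + b²)·Y⁴ = −b²`. -/
theorem example_three_solutions
    (b₁ : ℤ) (hb₁3 : 3 ≤ b₁) (hodd : Odd b₁) (h5 : ¬ (5 ∣ b₁))
    (b : ℤ) (hb : b = b₁ ^ 2) :
    ∃ a X₂ Y₂ X₃ : ℤ,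
      4 * a = b ^ 2 - 5 ∧
      16 * X₂ = b ^ 6 + 5 * b ^ 4 + 15 * b ^ 2 - 5 ∧
      2 * Y₂ = b ^ 2 + 1 ∧
      4 * X₃ = b ^ 3 + 3 * b ∧
      0 < a ∧ 0 < X₂ ∧ 0 < Y₂ ∧ 0 < X₃ ∧
      ((a, (1 : ℤ)) : ℤ × ℤ) ≠ (X₂, Y₂) ∧
      ((a, (1 : ℤ)) : ℤ × ℤ) ≠ (X₃, b₁) ∧
      ((X₂, Y₂) : ℤ × ℤ) ≠ (X₃, b₁) ∧
      a ^ 2 - (a ^ 2 + b ^ 2) * 1 ^ 4 = -b ^ 2 ∧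
      X₂ ^ 2 - (a ^ 2 + b ^ 2) * Y₂ ^ 4 = -b ^ 2 ∧
      X₃ ^ 2 - (a ^ 2 + b ^ 2) * b₁ ^ 4 = -b ^ 2 := by
  obtain ⟨m, hm⟩ := Int.eight_dvd_sq_sub_one_of_odd hodd
  have hbm : b = 8 * m + 1 := by linarith
  have hb9 : 3 * b₁ ≤ b := by nlinarith
  obtain ⟨n, hn⟩ : ∃ n, b ^ 2 = 16 * n + 1 := ⟨4 * m ^ 2 + m, by rw [hbm]; ring⟩
  have hn_pos : 0 < n := by nlinarith
  have hlt : b₁ < 8 * n + 1 := by nlinarith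
  have h4 : b ^ 4 = (16 * n + 1) ^ 2 := by rw [← hn]; ring
  have h6 : b ^ 6 = (16 * n + 1) ^ 3 := by rw [← hn]; ring
  refine ⟨4 * n - 1, 256 * n ^ 3 + 128 * n ^ 2 + 28 * n + 1, 8 * n + 1, b * (4 * n + 1),
    by rw [hn]; ring, by rw [h6, h4, hn]; ring, by rw [hn]; ring,
    by linear_combination (-b) * hn, by linarith, by positivity, by positivity,
    mul_pos (by linarith) (by linarith), ?_, ?_, ?_, by ring, by rw [hn]; ring, ?_⟩
  · intro h
    have := congrArg Prod.snd h
    dsimp only at this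
    linarith
  · intro h
    have := congrArg Prod.snd h
    dsimp only at this
    linarith
  · intro h
    have := congrArg Prod.snd h
    dsimp only at this
    linarith
  · have hb₁4 : b₁ ^ 4 = 16 * n + 1 := by rw [← hn, hb]; ring
    rw [hb₁4, mul_pow, hn]
    ring
end
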